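/- arXiv:1604.07903 — 4 statements merged into one kernel-verified Lean document; each statement's English description precedes it below -/
import Mathlib

section
/- Let Δ be a nondegenerate triangle and k ≥ 3. A symmetric matrix field τ ∈ P_k(Δ;𝕊₂) is uniquely determined by: (1) its values at the three vertices of Δ; (2) the moments ∫_e τν·p ds for all p ∈ P_{k−2}(e;ℝ²) on each edge e of Δ; (3) the interior moments ∫_Δ τ : p dx dy for all p in the bubble space H_{Δ,k,b}. In other words, if all these quantities vanish then τ = 0, and the number of these conditions equals dim P_k(Δ;𝕊₂) = 3(k+1)(k+2)/2. -/
open Matrix MvPolynomial MeasureTheory intervalIntegral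

/-- A nonnegative continuous function with zero integral vanishes on open subsets. -/
lemma zero_on_open {X : Type*} [TopologicalSpace X] [MeasurableSpace X] [BorelSpace X]
    (μ : Measure X) [μ.IsOpenPosMeasure] (f : X → ℝ) (hf : Continuous f) (s U : Set X)
    (hs : MeasurableSet s)
    (hU : IsOpen U) (hUs : U ⊆ s) (h0 : ∀ y ∈ s, 0 ≤ f y) (hi : IntegrableOn f s μ)
    (hmom : ∫ y in s, f y ∂μ = 0) : ∀ y ∈ U, f y = 0 := by
  have h1 : 0 ≤ᵐ[μ.restrict s] f := (ae_restrict_iff' hs).2 (Filter.Eventually.of_forall h0)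
  have h2 := (setIntegral_eq_zero_iff_of_nonneg_ae h1 hi).1 hmom
  have h3 : f =ᵐ[μ.restrict U] 0 := ae_restrict_of_ae_restrict_of_subset hUs h2
  exact Measure.eqOn_open_of_ae_eq h3 hU hf.continuousOn continuousOn_const

/-- Restriction of a polynomial to a line. -/
noncomputable def lineP (a d : Fin 2 → ℝ) (f : MvPolynomial (Fin 2) ℝ) : Polynomial ℝ :=
  aeval (fun c => Polynomial.C (d c) * Polynomial.X + Polynomial.C (a c)) f

lemma lineP_eval (a d : Fin 2 → ℝ) (f : MvPolynomial (Fin 2) ℝ) (t : ℝ) :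
    (lineP a d f).eval t = eval (a + t • d) f := by
  unfold lineP
  rw [← Polynomial.coe_evalRingHom]
  rw [MvPolynomial.aeval_def, MvPolynomial.hom_eval₂]
  rw [← MvPolynomial.eval₂_id]
  congr 1
  · ext r; simp
  · ext c; simp; ring

lemma lineP_natDegree (a d : Fin 2 → ℝ) (f : MvPolynomial (Fin 2) ℝ) (k : ℕ)
    (hf : f.totalDegree ≤ k) : (lineP a d f).natDegree ≤ k := by
  have := MvPolynomial.aeval_natDegree_le (n := 1) f hf
    (fun c => Polynomial.C (d c) * Polynomial.X + Polynomial.C (a c))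
    (fun c => Polynomial.natDegree_linear_le)
  simpa [lineP] using this

lemma affine_line (L : MvPolynomial (Fin 2) ℝ) (hL : L.totalDegree ≤ 1) (a d : Fin 2 → ℝ) (t : ℝ) :
    eval (a + t • d) L = eval a L + t * (eval (a + d) L - eval a L) := by
  have h := lineP_natDegree a d L 1 hL
  obtain ⟨p, q, hpq⟩ := Polynomial.exists_eq_X_add_C_of_natDegree_le_one h
  have h0 := lineP_eval a d L 0
  have h1 := lineP_eval a d L 1
  have ht := lineP_eval a d L t
  rw [hpq] at h0 h1 ht
  simp at h0 h1 ht
  rw [← ht, ← h0, ← h1]; ring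

lemma affine_rep (L : MvPolynomial (Fin 2) ℝ) (hL : L.totalDegree ≤ 1) :
    ∃ c a b : ℝ, ∀ y : Fin 2 → ℝ, eval y L = c + a * y 0 + b * y 1 := by
  refine ⟨eval 0 L, eval ![1,0] L - eval 0 L, eval ![0,1] L - eval 0 L, fun y => ?_⟩
  have h1 := affine_line L hL 0 ![1,0] (2 * y 0)
  have h2 := affine_line L hL 0 ![0,1] (2 * y 1)
  have h3 := affine_line L hL ![2 * y 0, 0] ![-(2 * y 0), 2 * y 1] (1/2)
  have e1 : (0 : Fin 2 → ℝ) + (2 * y 0) • ![1,0] = ![2 * y 0, 0] := by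
    ext i; fin_cases i <;> simp
  have e2 : (0 : Fin 2 → ℝ) + (2 * y 1) • ![0,1] = ![0, 2 * y 1] := by
    ext i; fin_cases i <;> simp
  have e3 : ![2 * y 0, 0] + (1/2 : ℝ) • ![-(2 * y 0), 2 * y 1] = y := by
    ext i; fin_cases i <;> simp; ring
  have e4 : ![2 * y 0, 0] + ![-(2 * y 0), 2 * y 1] = ![0, 2 * y 1] := by
    ext i; fin_cases i <;> simp
  rw [e1] at h1
  rw [e2] at h2
  rw [e3, e4, h1, h2] at h3
  rw [h3]
  simp only [zero_add]
  ring

lemma dvd_sub_bind (L : MvPolynomial (Fin 2) ℝ) (d : Fin 2 → ℝ) (f : MvPolynomial (Fin 2) ℝ) :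
    L ∣ f - bind₁ (fun i => X i - L * C (d i)) f := by
  induction f using MvPolynomial.induction_on with
  | C a => simp
  | add p q hp hq =>
    rw [map_add, add_sub_add_comm]
    exact dvd_add hp hq
  | mul_X p i hp =>
    rw [map_mul, bind₁_X_right]
    have : p * X i - (bind₁ fun i => X i - L * C (d i)) p * (X i - L * C (d i))
      = (p - (bind₁ fun i => X i - L * C (d i)) p) * X i
        + L * (C (d i) * (bind₁ fun i => X i - L * C (d i)) p) := by ring
    rw [this]
    exact dvd_add (hp.mul_right _) (dvd_mul_right _ _)

lemma dvd_of_line (L f : MvPolynomial (Fin 2) ℝ) (a b d : Fin 2 → ℝ)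
    (hproj : ∀ y, ∃ t : ℝ, y - eval y L • d = a + t • (b - a))
    (S : Set ℝ) (hS : S.Infinite) (h0 : ∀ t ∈ S, eval (a + t • (b - a)) f = 0) : L ∣ f := by
  have hl : lineP a (b - a) f = 0 := by
    apply Polynomial.eq_zero_of_infinite_isRoot
    refine hS.mono fun t ht => ?_
    simp only [Set.mem_ofPred_eq, Polynomial.IsRoot.def, lineP_eval]
    exact h0 t ht
  have hb : bind₁ (fun i => X i - L * C (d i)) f = 0 := by
    apply MvPolynomial.funext
    intro y
    obtain ⟨t, ht⟩ := hproj y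
    have : eval y (bind₁ (fun i => X i - L * C (d i)) f) = eval (y - eval y L • d) f := by
      rw [← coe_aeval_eq_eval, ← coe_aeval_eq_eval]
      simp only [RingHom.coe_coe, aeval_bind₁]
      congr 2
      ext i
      simp [aeval_eq_eval]
    rw [this, ht, ← lineP_eval, hl]; simp
  have := dvd_sub_bind L d f
  rwa [hb, sub_zero] at this

lemma det_ne (x : Fin 3 → (Fin 2 → ℝ))
    (hnd : LinearIndependent ℝ ![x 1 - x 0, x 2 - x 0]) :
    (x 1 0 - x 0 0) * (x 2 1 - x 0 1) - (x 1 1 - x 0 1) * (x 2 0 - x 0 0) ≠ 0 := by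
  intro h
  rw [LinearIndependent.pair_iff] at hnd
  have h1 := hnd (x 2 1 - x 0 1) (-(x 1 1 - x 0 1)) (by
    ext i; fin_cases i <;> simp <;> linarith)
  have h2 := hnd (x 2 0 - x 0 0) (-(x 1 0 - x 0 0)) (by
    ext i; fin_cases i <;> simp <;> linarith)
  have h3 := hnd 1 0 (by
    ext i; fin_cases i <;> simp <;> linarith [h1.1, h1.2, h2.1, h2.2])
  simp at h3

lemma bary (x : Fin 3 → (Fin 2 → ℝ))
    (hnd : LinearIndependent ℝ ![x 1 - x 0, x 2 - x 0])
    (lam : Fin 3 → MvPolynomial (Fin 2) ℝ)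
    (hdeg : ∀ i, (lam i).totalDegree ≤ 1)
    (hlam : ∀ i j, eval (x j) (lam i) = if i = j then (1 : ℝ) else 0) (y : Fin 2 → ℝ) :
    ∑ i, eval y (lam i) = 1 ∧ ∀ c, y c = ∑ i, eval y (lam i) * x i c := by
  have hd := det_ne x hnd
  set D := (x 1 0 - x 0 0) * (x 2 1 - x 0 1) - (x 1 1 - x 0 1) * (x 2 0 - x 0 0) with hD
  obtain ⟨s, hs⟩ : ∃ s, s * D = (y 0 - x 0 0) * (x 2 1 - x 0 1) - (y 1 - x 0 1) * (x 2 0 - x 0 0) :=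
    ⟨_, div_mul_cancel₀ _ hd⟩
  obtain ⟨t, ht⟩ : ∃ t, t * D = (x 1 0 - x 0 0) * (y 1 - x 0 1) - (x 1 1 - x 0 1) * (y 0 - x 0 0) :=
    ⟨_, div_mul_cancel₀ _ hd⟩
  have y0 : y 0 = (1 - s - t) * x 0 0 + s * x 1 0 + t * x 2 0 := by
    apply mul_right_cancel₀ hd
    linear_combination (-(x 1 0 - x 0 0)) * hs - (x 2 0 - x 0 0) * ht + (y 0 - x 0 0) * hD
  have y1 : y 1 = (1 - s - t) * x 0 1 + s * x 1 1 + t * x 2 1 := by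
    apply mul_right_cancel₀ hd
    linear_combination (-(x 1 1 - x 0 1)) * hs - (x 2 1 - x 0 1) * ht + (y 1 - x 0 1) * hD
  have hL : ∀ i, eval y (lam i) = (1 - s - t) * (if i = 0 then 1 else 0)
      + s * (if i = 1 then 1 else 0) + t * (if i = 2 then 1 else 0) := by
    intro i
    obtain ⟨c, a, b, h⟩ := affine_rep (lam i) (hdeg i)
    rw [← hlam i 0, ← hlam i 1, ← hlam i 2, h, h, h, h, y0, y1]
    ring
  simp only [hL]
  refine ⟨by simp [Fin.sum_univ_three]; ring, fun c => ?_⟩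
  fin_cases c
  · simp [Fin.sum_univ_three]; linarith
  · simp [Fin.sum_univ_three]; linarith

lemma dim_count (k : ℕ) : 3 * Module.finrank ℝ (restrictTotalDegree (Fin 2) ℝ k)
      = 3 * (k + 1) * (k + 2) / 2 := by
  have e : {n : Fin 2 →₀ ℕ | (n.sum fun _ e => e) ≤ k} ≃ Σ i : Fin (k+1), Fin (i.1+1) :=
    { toFun := fun n => ⟨⟨n.1 0 + n.1 1, by
          have := n.2
          simp [Finsupp.sum_fintype] at this; omega⟩, ⟨n.1 0, by simp⟩⟩
      invFun := fun p => ⟨Finsupp.equivFunOnFinite.symm ![p.2.1, p.1.1 - p.2.1], by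
          have := p.1.2; have := p.2.2
          simp [Finsupp.sum_fintype]; omega⟩
      left_inv := fun n => by
        ext i; fin_cases i <;> simp
      right_inv := fun p => by
        obtain ⟨⟨a, ha⟩, ⟨b, hb⟩⟩ := p
        have hb' : b + (a - b) = a := by simp at hb; omega
        simp only [Finsupp.equivFunOnFinite_symm_apply_apply, cons_val_zero]
        congr!
         }
  have h1 : Module.finrank ℝ (restrictTotalDegree (Fin 2) ℝ k) = ∑ i : Fin (k+1), (i.1+1) := by
    have := Module.finrank_eq_nat_card_basis (basisRestrictSupport ℝ {n : Fin 2 →₀ ℕ | (n.sum fun _ e => e) ≤ k})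
    rw [Nat.card_congr e] at this
    refine this.trans ?_
    simp
  have h2 : (∑ i : Fin (k+1), (i.1+1)) * 2 = (k+1)*(k+2) := by
    rw [Fin.sum_univ_eq_sum_range (fun i => i+1)]
    have : ∀ n : ℕ, (∑ i ∈ Finset.range (n+1), (i+1)) * 2 = (n+1)*(n+2) := by
      intro n
      induction n with
      | zero => simp
      | succ m ih => rw [Finset.sum_range_succ, add_mul, ih]; ring
    exact this _
  rw [h1, mul_assoc 3, ← h2]
  omega

lemma edge_zero (k : ℕ) (q : Polynomial ℝ) (hq : q.natDegree ≤ k)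
    (h0 : q.eval 0 = 0) (h1 : q.eval 1 = 0)
    (h : ∀ p : Polynomial ℝ, p.natDegree ≤ k - 2 → ∫ t in (0:ℝ)..1, q.eval t * p.eval t = 0) :
    q = 0 := by
  obtain ⟨r, hr⟩ := Polynomial.dvd_iff_isRoot.2 h0
  have hr1 : r.eval 1 = 0 := by
    rw [hr] at h1; simpa using h1
  obtain ⟨w, hw⟩ := Polynomial.dvd_iff_isRoot.2 hr1
  by_contra hne
  have hw0 : w ≠ 0 := by rintro rfl; simp [hw] at hr; exact hne hr
  have hr0 : r ≠ 0 := by rintro rfl; simp at hr; exact hne hr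
  have hwd : w.natDegree ≤ k - 2 := by
    rw [hr, Polynomial.natDegree_mul (Polynomial.X_sub_C_ne_zero _) hr0, hw,
      Polynomial.natDegree_mul (Polynomial.X_sub_C_ne_zero _) hw0] at hq
    simp only [Polynomial.natDegree_X_sub_C] at hq
    omega
  have hi := h (-w) (by simpa using hwd)
  have hc : Continuous fun t : ℝ => q.eval t * (-w).eval t := by fun_prop
  have hex : ∀ t : ℝ, q.eval t * (-w).eval t = t * (1 - t) * w.eval t ^ 2 := by
    intro t; rw [hr, hw]; simp; ring
  rw [intervalIntegral.integral_of_le zero_le_one] at hi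
  have hz := zero_on_open volume _ hc (Set.Ioc 0 1) (Set.Ioo 0 1) measurableSet_Ioc isOpen_Ioo
    Set.Ioo_subset_Ioc_self (fun t ht => by
      rw [hex]
      have := ht.1.le
      have := sub_nonneg.2 ht.2
      positivity) ((hc.integrableOn_Icc).mono_set Set.Ioc_subset_Icc_self) hi
  apply hw0
  apply Polynomial.eq_zero_of_infinite_isRoot
  refine (Set.Ioo_infinite (zero_lt_one (α := ℝ))).mono fun t ht => ?_
  have h3 := hz t ht
  rw [hex] at h3
  have h4 : t * (1 - t) ≠ 0 := mul_ne_zero ht.1.ne' (sub_pos.2 ht.2).ne'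
  exact pow_eq_zero_iff two_ne_zero |>.1 ((mul_eq_zero.1 h3).resolve_left h4)

lemma lam_deg (x : Fin 3 → (Fin 2 → ℝ)) (lam : Fin 3 → MvPolynomial (Fin 2) ℝ)
    (hlam : ∀ i j, eval (x j) (lam i) = if i = j then (1 : ℝ) else 0) (i j : Fin 3) (hij : i ≠ j) :
    lam i ≠ 0 ∧ 1 ≤ (lam i).totalDegree := by
  have h1 := hlam i i
  have h2 := hlam i j
  simp only [if_true, if_neg hij] at h1 h2
  constructor
  · intro h; simp [h] at h1
  · by_contra hc
    have := totalDegree_eq_zero_iff_eq_C.1 (by omega : (lam i).totalDegree = 0)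
    rw [this, eval_C] at h1 h2
    rw [h1] at h2; exact one_ne_zero h2

lemma bubble_factor (x : Fin 3 → (Fin 2 → ℝ))
    (hnd : LinearIndependent ℝ ![x 1 - x 0, x 2 - x 0])
    (lam : Fin 3 → MvPolynomial (Fin 2) ℝ)
    (hdeg : ∀ i, (lam i).totalDegree ≤ 1)
    (hlam : ∀ i j, eval (x j) (lam i) = if i = j then (1 : ℝ) else 0)
    (i j l : Fin 3) (hij : i ≠ j) (hjl : j ≠ l) (hil : i ≠ l) (k : ℕ)
    (f : MvPolynomial (Fin 2) ℝ) (hf : f.totalDegree ≤ k)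
    (h1 : ∀ t : ℝ, eval (x j + t • (x l - x j)) f = 0)
    (h2 : ∀ t : ℝ, eval (x i + t • (x l - x i)) f = 0) :
    ∃ p : MvPolynomial (Fin 2) ℝ, p.totalDegree ≤ k - 2 ∧ f = lam i * lam j * p := by
  have hb : ∀ y, eval y (lam i) + eval y (lam j) + eval y (lam l) = 1 ∧
      ∀ c, y c = eval y (lam i) * x i c + eval y (lam j) * x j c + eval y (lam l) * x l c := by
    intro y
    obtain ⟨ha, hc⟩ := bary x hnd lam hdeg hlam y
    have key : ∀ g : Fin 3 → ℝ, ∑ m, g m = g i + g j + g l := by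
      intro g
      rw [Fin.sum_univ_three]
      fin_cases i <;> fin_cases j <;> fin_cases l <;> simp at hij hjl hil ⊢ <;> ring
    rw [key] at ha
    exact ⟨ha, fun c => by rw [← key (fun m => eval y (lam m) * x m c)]; exact hc c⟩
  obtain ⟨g, hg⟩ : lam i ∣ f := by
    refine dvd_of_line (lam i) f (x j) (x l) (x i - x j) (fun y => ⟨eval y (lam l), ?_⟩)
      Set.univ Set.infinite_univ (fun t _ => h1 t)
    ext c
    have h := (hb y).2 c
    have h' := (hb y).1
    simp only [Pi.sub_apply, Pi.smul_apply, Pi.add_apply, smul_eq_mul]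
    linear_combination h + x j c * h'
  obtain ⟨p, hp⟩ : lam j ∣ g := by
    refine dvd_of_line (lam j) g (x i) (x l) (x j - x i) (fun y => ⟨eval y (lam l), ?_⟩)
      (Set.Ioo 0 1) (Set.Ioo_infinite zero_lt_one) (fun t ht => ?_)
    · ext c
      have h := (hb y).2 c
      have h' := (hb y).1
      simp only [Pi.sub_apply, Pi.smul_apply, Pi.add_apply, smul_eq_mul]
      linear_combination h + x i c * h'
    · have h3 := h2 t
      rw [hg, map_mul, affine_line _ (hdeg i)] at h3
      rw [add_sub_cancel, hlam, hlam, if_pos rfl, if_neg hil] at h3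
      rcases mul_eq_zero.1 h3 with h | h
      · linarith [ht.2]
      · exact h
  refine ⟨p, ?_, by rw [hg, hp]; ring⟩
  by_cases hp0 : p = 0
  · simp [hp0]
  obtain ⟨i0, i1⟩ := lam_deg x lam hlam i j hij
  obtain ⟨j0, j1⟩ := lam_deg x lam hlam j l hjl
  have hg0 : g ≠ 0 := by rw [hp]; exact mul_ne_zero j0 hp0
  rw [hg, totalDegree_mul_of_isDomain i0 hg0, hp, totalDegree_mul_of_isDomain j0 hp0] at hf
  omega

/-- Normal components vanish on each edge line. -/
lemma edge_vanish (k : ℕ) (a b : Fin 2 → ℝ)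
    (τ : Matrix (Fin 2) (Fin 2) (MvPolynomial (Fin 2) ℝ))
    (hτ : ∀ a b, (τ a b).totalDegree ≤ k)
    (ha : τ.map (eval a) = 0) (hb : τ.map (eval b) = 0) (ν : Fin 2 → ℝ)
    (h : ∀ p : Fin 2 → Polynomial ℝ, (∀ r, (p r).natDegree ≤ k - 2) →
            ∫ t in (0:ℝ)..1,
              ((τ.map (eval (a + t • (b - a)))) *ᵥ ν) ⬝ᵥ
                (fun r => (p r).eval t) = 0) (r : Fin 2) (t : ℝ) :
    eval (a + t • (b - a)) (τ r 0) * ν 0 + eval (a + t • (b - a)) (τ r 1) * ν 1 = 0 := by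
  have hE : ∀ t, (lineP a (b - a) (τ r 0 * C (ν 0) + τ r 1 * C (ν 1))).eval t =
      eval (a + t • (b - a)) (τ r 0) * ν 0 + eval (a + t • (b - a)) (τ r 1) * ν 1 := by
    intro t; rw [lineP_eval]; simp
  have hz : lineP a (b - a) (τ r 0 * C (ν 0) + τ r 1 * C (ν 1)) = 0 := by
    apply edge_zero k
    · apply lineP_natDegree
      refine (totalDegree_add _ _).trans (max_le ?_ ?_)
      · refine (totalDegree_mul _ _).trans ?_
        simpa using hτ r 0
      · refine (totalDegree_mul _ _).trans ?_
        simpa using hτ r 1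
    · rw [hE]
      have e0 := congrFun (congrFun ha r) 0
      have e1 := congrFun (congrFun ha r) 1
      simp at e0 e1
      simp [e0, e1]
    · rw [hE]
      have e0 := congrFun (congrFun hb r) 0
      have e1 := congrFun (congrFun hb r) 1
      simp at e0 e1
      simp [e0, e1]
    · intro p hp
      refine Eq.trans ?_ (h (fun s => if s = r then p else 0) (fun s => by split_ifs <;> simp [hp]))
      apply intervalIntegral.integral_congr
      intro t _
      dsimp only
      rw [hE]
      fin_cases r <;> simp [dotProduct, mulVec, Fin.sum_univ_two]
  rw [← hE, hz]; simp

/-- The coefficient of `τ` along one of the tangential dyads, up to scaling. -/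
noncomputable def cf (m n : Fin 2 → ℝ) (s : ℝ) (τ : Matrix (Fin 2) (Fin 2) (MvPolynomial (Fin 2) ℝ)) :
    MvPolynomial (Fin 2) ℝ :=
  C s * ∑ a, ∑ b, C (m a * n b) * τ a b

lemma cf_deg (m n : Fin 2 → ℝ) (s : ℝ) (k : ℕ)
    (τ : Matrix (Fin 2) (Fin 2) (MvPolynomial (Fin 2) ℝ))
    (hτ : ∀ a b, (τ a b).totalDegree ≤ k) : (cf m n s τ).totalDegree ≤ k := by
  unfold cf
  refine (totalDegree_mul _ _).trans ?_
  rw [totalDegree_C, zero_add]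
  refine totalDegree_finsetSum_le fun a _ => totalDegree_finsetSum_le fun b _ => ?_
  refine (totalDegree_mul _ _).trans ?_
  rw [totalDegree_C, zero_add]
  exact hτ a b

lemma cf_eval (m n : Fin 2 → ℝ) (s : ℝ) (τ : Matrix (Fin 2) (Fin 2) (MvPolynomial (Fin 2) ℝ))
    (y : Fin 2 → ℝ) : eval y (cf m n s τ) = s *
      (m 0 * (eval y (τ 0 0) * n 0 + eval y (τ 0 1) * n 1)
        + m 1 * (eval y (τ 1 0) * n 0 + eval y (τ 1 1) * n 1)) := by
  simp only [cf, Fin.sum_univ_two, map_mul, map_add, eval_C]; ring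

lemma cf_symm (m n : Fin 2 → ℝ) (s : ℝ) (τ : Matrix (Fin 2) (Fin 2) (MvPolynomial (Fin 2) ℝ))
    (h : ∀ a b, τ a b = τ b a) : cf m n s τ = cf n m s τ := by
  simp only [cf, Fin.sum_univ_two, h 1 0, mul_comm (m _)]; ring

/-- Rotation by a right angle. -/
def rot (u : Fin 2 → ℝ) : Fin 2 → ℝ := ![-u 1, u 0]

lemma bary_subset (x : Fin 3 → (Fin 2 → ℝ))
    (hnd : LinearIndependent ℝ ![x 1 - x 0, x 2 - x 0])
    (lam : Fin 3 → MvPolynomial (Fin 2) ℝ)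
    (hdeg : ∀ i, (lam i).totalDegree ≤ 1)
    (hlam : ∀ i j, eval (x j) (lam i) = if i = j then (1 : ℝ) else 0) :
    {y | ∀ i, 0 < eval y (lam i)} ⊆ convexHull ℝ (Set.range x) := by
  intro y hy
  obtain ⟨h1, h2⟩ := bary x hnd lam hdeg hlam y
  have : y = ∑ i, eval y (lam i) • x i := by
    ext c; rw [h2 c]; simp
  rw [this]
  exact (convex_convexHull ℝ _).sum_mem (fun i _ => (hy i).le) h1
    (fun i _ => subset_convexHull ℝ _ (Set.mem_range_self i))

lemma eq_zero_of_open (U : Set (Fin 2 → ℝ)) (hU : IsOpen U) (hne : U.Nonempty)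
    (f : MvPolynomial (Fin 2) ℝ) (h : ∀ y ∈ U, eval y f = 0) : f = 0 := by
  obtain ⟨c, hc⟩ := hne
  obtain ⟨ε, hε, hb⟩ := Metric.isOpen_iff.1 hU c hc
  apply MvPolynomial.funext_set (fun i => Metric.ball (c i) ε)
  · intro i
    rw [Real.ball_eq_Ioo]
    exact Set.Ioo_infinite (by linarith)
  · intro y hy
    rw [map_zero]
    apply h _ (hb _)
    rw [ball_pi _ hε]
    exact hy

/-- Unisolvence of the degrees of freedom (vertex values, edge moments against
`P_{k-2}`, interior moments against the bubble space) for symmetric matrix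
polynomials of degree ≤ k on a nondegenerate triangle, together with the
dimension count `dim P_k(Δ;𝕊₂) = 3(k+1)(k+2)/2`. -/
theorem symmetric_matrix_polynomial_unisolvence
    (k : ℕ) (hk : 3 ≤ k)
    (x : Fin 3 → (Fin 2 → ℝ))
    (hnd : LinearIndependent ℝ ![x 1 - x 0, x 2 - x 0])
    (lam : Fin 3 → MvPolynomial (Fin 2) ℝ)
    (hdeg : ∀ i, (lam i).totalDegree ≤ 1)
    (hlam : ∀ i j, eval (x j) (lam i) = if i = j then (1 : ℝ) else 0)
    (Δ : Set (Fin 2 → ℝ)) (hΔ : Δ = convexHull ℝ (Set.range x))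
    (T : Fin 3 → Fin 3 → Matrix (Fin 2) (Fin 2) (MvPolynomial (Fin 2) ℝ))
    (hT : ∀ i j, T i j = (vecMulVec (x j - x i) (x j - x i)).map C) :
    (∀ τ : Matrix (Fin 2) (Fin 2) (MvPolynomial (Fin 2) ℝ),
      (∀ a b, τ a b = τ b a) → (∀ a b, (τ a b).totalDegree ≤ k) →
      -- (1) vertex values vanish
      (∀ i : Fin 3, τ.map (eval (x i)) = 0) →
      -- (2) edge moments against `P_{k-2}(e;ℝ²)` vanish
      (∀ i j : Fin 3, i ≠ j →
        ∀ ν : Fin 2 → ℝ, ν ⬝ᵥ (x j - x i) = 0 →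
          ∀ p : Fin 2 → Polynomial ℝ, (∀ r, (p r).natDegree ≤ k - 2) →
            ∫ t in (0:ℝ)..1,
              ((τ.map (eval (x i + t • (x j - x i)))) *ᵥ ν) ⬝ᵥ
                (fun r => (p r).eval t) = 0) →
      -- (3) interior moments against the bubble space vanish
      (∀ p : Fin 3 → Fin 3 → MvPolynomial (Fin 2) ℝ,
        (∀ i j, (p i j).totalDegree ≤ k - 2) →
        ∫ y in Δ, ∑ a : Fin 2, ∑ b : Fin 2,
          eval y (τ a b) *
            eval y (((lam 0 * lam 1 * p 0 1) • T 0 1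
              + (lam 0 * lam 2 * p 0 2) • T 0 2
              + (lam 1 * lam 2 * p 1 2) • T 1 2) a b) = 0) →
      τ = 0) ∧
    3 * Module.finrank ℝ (restrictTotalDegree (Fin 2) ℝ k)
      = 3 * (k + 1) * (k + 2) / 2 := by
  refine ⟨fun τ hsym hτ hv he hmom => ?_, dim_count k⟩
  subst hΔ
  have hd := det_ne x hnd
  set D := (x 1 0 - x 0 0) * (x 2 1 - x 0 1) - (x 1 1 - x 0 1) * (x 2 0 - x 0 0) with hD
  -- normal components vanish on every edge
  have hedge : ∀ i j : Fin 3, i ≠ j → ∀ ν : Fin 2 → ℝ, ν ⬝ᵥ (x j - x i) = 0 →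
      ∀ r t, eval (x i + t • (x j - x i)) (τ r 0) * ν 0
        + eval (x i + t • (x j - x i)) (τ r 1) * ν 1 = 0 := fun i j hij ν hν r t =>
    edge_vanish k (x i) (x j) τ hτ (hv i) (hv j) ν (he i j hij ν hν) r t
  have hrot : ∀ i j l m: Fin 3, (l = i ∧ m = j) ∨ (l = j ∧ m = i) →
      rot (x j - x i) ⬝ᵥ (x m - x l) = 0 := by
    rintro i j l m (⟨rfl, rfl⟩ | ⟨rfl, rfl⟩) <;>
      simp [rot, dotProduct, Fin.sum_univ_two] <;> ring
  have hcf : ∀ i j l : Fin 3, i ≠ j → j ≠ l → i ≠ l → ∀ s : ℝ,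
      ∃ p : MvPolynomial (Fin 2) ℝ, p.totalDegree ≤ k - 2 ∧
        cf (rot (x l - x i)) (rot (x l - x j)) s τ = lam i * lam j * p := by
    intro i j l hij hjl hil s
    apply bubble_factor x hnd lam hdeg hlam i j l hij hjl hil k _ (cf_deg _ _ _ _ _ hτ)
    · intro t
      have := hedge j l hjl _ (hrot j l j l (Or.inl ⟨rfl, rfl⟩))
      rw [cf_eval, this 0 t, this 1 t]; ring
    · intro t
      have := hedge i l hil _ (hrot i l i l (Or.inl ⟨rfl, rfl⟩))
      rw [cf_symm _ _ _ _ hsym, cf_eval, this 0 t, this 1 t]; ring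
  obtain ⟨p01, d01, e01⟩ := hcf 0 1 2 (by decide) (by decide) (by decide) (1 / D ^ 2)
  obtain ⟨p02, d02, e02⟩ := hcf 0 2 1 (by decide) (by decide) (by decide) (1 / D ^ 2)
  obtain ⟨p12, d12, e12⟩ := hcf 1 2 0 (by decide) (by decide) (by decide) (1 / D ^ 2)
  have hI := hmom (fun i j => if i = 0 ∧ j = 1 then p01 else if i = 0 ∧ j = 2 then p02 else p12)
    (fun i j => by
      split_ifs <;> assumption)
  have hrep : ∀ y a b, eval y ((((lam 0 * lam 1 * (p01)) • T 0 1
              + (lam 0 * lam 2 * (p02)) • T 0 2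
              + (lam 1 * lam 2 * (p12)) • T 1 2)) a b) = eval y (τ a b) := by
    intro y a b
    rw [← e01, ← e02, ← e12]
    simp only [hT, Matrix.add_apply, Matrix.smul_apply, Matrix.map_apply, vecMulVec_apply,
      smul_eq_mul, map_add, map_mul, map_neg, cf_eval, eval_C, rot, Pi.sub_apply, cons_val_zero,
      cons_val_one, hsym 1 0]
    have hD1 : 1 / D ^ 2 * D ^ 2 = 1 := by field_simp
    generalize 1 / D ^ 2 = s at hD1
    rw [hD] at hD1
    fin_cases a <;> fin_cases b
    · simp only [Fin.zero_eta, Fin.mk_one]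
      linear_combination (eval y (τ 0 0)) * hD1
    · simp only [Fin.zero_eta, Fin.mk_one]
      linear_combination (eval y (τ 0 1)) * hD1
    · simp only [Fin.zero_eta, Fin.mk_one, hsym 1 0]
      linear_combination (eval y (τ 0 1)) * hD1
    · simp only [Fin.zero_eta, Fin.mk_one]
      linear_combination (eval y (τ 1 1)) * hD1
  have hcont : Continuous fun y : Fin 2 → ℝ => ∑ a : Fin 2, ∑ b : Fin 2,
      eval y (τ a b) * eval y (τ a b) :=
    continuous_finsetSum _ fun a _ => continuous_finsetSum _ fun b _ =>
      (MvPolynomial.continuous_eval _).mul (MvPolynomial.continuous_eval _)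
  have hI2 : ∫ y in convexHull ℝ (Set.range x), ∑ a : Fin 2, ∑ b : Fin 2,
      eval y (τ a b) * eval y (τ a b) = 0 := by
    refine Eq.trans ?_ hI
    congr 1
    ext y
    refine Finset.sum_congr rfl fun a _ => Finset.sum_congr rfl fun b _ => ?_
    rw [← hrep y a b]
    simp
  have hcomp : IsCompact (convexHull ℝ (Set.range x)) :=
    (Set.finite_range x).isCompact_convexHull (𝕜 := ℝ)
  have hUo : IsOpen {y : Fin 2 → ℝ | ∀ i, 0 < eval y (lam i)} := by
    have : {y : Fin 2 → ℝ | ∀ i, 0 < eval y (lam i)} = ⋂ i, {y | 0 < eval y (lam i)} := by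
      ext y; simp
    rw [this]
    exact isOpen_iInter_of_finite fun i =>
      isOpen_lt continuous_const (MvPolynomial.continuous_eval _)
  have hz := zero_on_open volume _ hcont _ _ hcomp.measurableSet hUo
    (bary_subset x hnd lam hdeg hlam)
    (fun y _ => Finset.sum_nonneg fun a _ => Finset.sum_nonneg fun b _ => mul_self_nonneg _)
    (hcont.continuousOn.integrableOn_compact hcomp) hI2
  have hne : {y : Fin 2 → ℝ | ∀ i, 0 < eval y (lam i)}.Nonempty := by
    refine ⟨fun c => (x 0 c + x 1 c + x 2 c) / 3, fun i => ?_⟩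
    obtain ⟨c, a, b, h⟩ := affine_rep (lam i) (hdeg i)
    have h0 := hlam i 0
    have h1 := hlam i 1
    have h2 := hlam i 2
    rw [h] at h0 h1 h2 ⊢
    fin_cases i <;> simp at h0 h1 h2 <;> linarith
  ext a b : 1
  refine eq_zero_of_open _ hUo hne _ fun y hy => ?_
  have h := hz y hy
  have h1 := (Finset.sum_eq_zero_iff_of_nonneg (fun a _ => Finset.sum_nonneg fun b _ =>
    mul_self_nonneg _)).1 h a (Finset.mem_univ _)
  have h2 := (Finset.sum_eq_zero_iff_of_nonneg (fun b _ => mul_self_nonneg _)).1 h1 b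
    (Finset.mem_univ _)
  exact mul_self_eq_zero.1 h2
end

section
/- Let Δ be a nondegenerate triangle and k ≥ 1. A vector field τ ∈ P_k(Δ;ℝ²) is uniquely determined by: (1) the edge moments ∫_e (τ·ν) p ds for all p ∈ P_k(e;ℝ) and each edge e ⊂ ∂Δ; (2) ∫_Δ τ·∇p dx dy for all p ∈ P_{k−1}(Δ;ℝ); (3) ∫_Δ τ·w dx dy for all w of the form w = curl(b v) with v ∈ P_{k−2}(Δ;ℝ), where b = λ₁λ₂λ₃. (BDM unisolvence.) -/
open Matrix MvPolynomial MeasureTheory intervalIntegral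

theorem bdm_hasDerivAt (p : MvPolynomial (Fin 2) ℝ) (a d : Fin 2 → ℝ) (t : ℝ) :
    HasDerivAt (fun t : ℝ => eval (a + t • d) p)
      (d 0 * eval (a + t • d) (pderiv 0 p) + d 1 * eval (a + t • d) (pderiv 1 p)) t := by
  induction p using MvPolynomial.induction_on with
  | C c => simpa using hasDerivAt_const t c
  | add p q hp hq =>
    have := hp.add hq
    simp only [map_add]
    refine this.congr_deriv ?_
    ring
  | mul_X p i hp =>
    have hX : HasDerivAt (fun t : ℝ => a i + t * d i) (d i) t := by
      simpa using ((hasDerivAt_id t).mul_const (d i)).const_add (a i)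
    have := hp.mul hX
    simp only [map_mul, eval_X, Pi.add_apply, Pi.smul_apply, smul_eq_mul]
    refine this.congr_deriv ?_
    simp only [Derivation.leibniz, map_add, smul_eq_mul, map_mul, eval_X, Pi.add_apply,
      Pi.smul_apply]
    fin_cases i <;> simp [pderiv_X] <;> ring

theorem bdm_deg_one (p : MvPolynomial (Fin 2) ℝ) (hp : p.totalDegree ≤ 1) :
    ∃ a b c : ℝ, p = C a + C b * X 0 + C c * X 1 := by
  refine ⟨coeff 0 p, coeff (Finsupp.single 0 1) p, coeff (Finsupp.single 1 1) p, ?_⟩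
  ext m
  by_cases hm : 1 < m.degree
  · have h0 : coeff m p = 0 := by
      apply coeff_eq_zero_of_totalDegree_lt
      exact lt_of_le_of_lt hp hm
    have hq : (C (coeff 0 p) + C (coeff (Finsupp.single 0 1) p) * X 0
        + C (coeff (Finsupp.single 1 1) p) * X 1 : MvPolynomial (Fin 2) ℝ).totalDegree ≤ 1 := by
      refine (totalDegree_add _ _).trans (max_le ((totalDegree_add _ _).trans (max_le ?_ ?_)) ?_)
      · simp
      · refine (totalDegree_mul _ _).trans ?_
        simp
      · refine (totalDegree_mul _ _).trans ?_
        simp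
    rw [h0, eq_comm]
    apply coeff_eq_zero_of_totalDegree_lt
    exact lt_of_le_of_lt hq hm
  · have hd : m 0 + m 1 ≤ 1 := by
      have : m.degree = m 0 + m 1 := by simp [Finsupp.degree_eq_sum]
      omega
    have : m = 0 ∨ m = Finsupp.single 0 1 ∨ m = Finsupp.single 1 1 := by
      have h3 : (m 0 = 0 ∧ m 1 = 0) ∨ (m 0 = 1 ∧ m 1 = 0) ∨ (m 0 = 0 ∧ m 1 = 1) := by omega
      rcases h3 with h | h | h
      · left; ext i; fin_cases i <;> simp [h]
      · right; left; ext i; fin_cases i <;> simp [h]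
      · right; right; ext i; fin_cases i <;> simp [h]
    rcases this with rfl | rfl | rfl <;>
      simp [coeff_C, coeff_C_mul, coeff_X, Finsupp.single_left_inj, eq_comm]

theorem bdm_det (e f : Fin 2 → ℝ) (h : LinearIndependent ℝ ![e, f]) :
    e 0 * f 1 - e 1 * f 0 ≠ 0 := by
  intro hd
  rw [LinearIndependent.pair_iff] at h
  have h1 := h (f 1) (-e 1) (by ext i; fin_cases i <;> simp <;> linarith)
  have h2 := h (f 0) (-e 0) (by ext i; fin_cases i <;> simp <;> linarith)
  have h3 := h 1 0 (by
    ext i; fin_cases i <;> simp <;> linarith [h1.2, h2.2])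
  exact one_ne_zero h3.1

theorem bdm_aff (x : Fin 3 → (Fin 2 → ℝ))
    (hnd : LinearIndependent ℝ ![x 1 - x 0, x 2 - x 0])
    (p : MvPolynomial (Fin 2) ℝ) (hp : p.totalDegree ≤ 1) (h : ∀ i, eval (x i) p = 0) :
    p = 0 := by
  obtain ⟨a, b, c, rfl⟩ := bdm_deg_one p hp
  have hd := bdm_det _ _ hnd
  simp only [Pi.sub_apply] at hd
  have h0 := h 0
  have h1 := h 1
  have h2 := h 2
  simp at h0 h1 h2
  have hb : b = 0 := by
    have : b * ((x 1 0 - x 0 0) * (x 2 1 - x 0 1) - (x 1 1 - x 0 1) * (x 2 0 - x 0 0)) = 0 := by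
      linear_combination (h1 - h0) * (x 2 1 - x 0 1) - (h2 - h0) * (x 1 1 - x 0 1)
    exact (mul_eq_zero.mp this).resolve_right hd
  have hc : c = 0 := by
    have : c * ((x 1 0 - x 0 0) * (x 2 1 - x 0 1) - (x 1 1 - x 0 1) * (x 2 0 - x 0 0)) = 0 := by
      linear_combination (h2 - h0) * (x 1 0 - x 0 0) - (h1 - h0) * (x 2 0 - x 0 0)
    exact (mul_eq_zero.mp this).resolve_right hd
  subst hb hc
  have : a = 0 := by linarith
  simp [this]

/-- The barycentric identities. -/
theorem bdm_bary (x : Fin 3 → (Fin 2 → ℝ))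
    (hnd : LinearIndependent ℝ ![x 1 - x 0, x 2 - x 0])
    (lam : Fin 3 → MvPolynomial (Fin 2) ℝ)
    (hdeg : ∀ i, (lam i).totalDegree ≤ 1)
    (hlam : ∀ i j, eval (x j) (lam i) = if i = j then (1 : ℝ) else 0) :
    (lam 0 + lam 1 + lam 2 = 1) ∧ ∀ r : Fin 2,
      X r = lam 0 * C (x 0 r) + lam 1 * C (x 1 r) + lam 2 * C (x 2 r) := by
  constructor
  · rw [← sub_eq_zero]
    apply bdm_aff x hnd
    · refine (totalDegree_sub _ _).trans (max_le ((totalDegree_add _ _).trans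
        (max_le ((totalDegree_add _ _).trans (max_le ?_ ?_)) ?_)) ?_) <;> simp [hdeg]
    · intro i; fin_cases i <;> simp [hlam]
  · intro r
    rw [← sub_eq_zero]
    apply bdm_aff x hnd
    · refine (totalDegree_sub _ _).trans (max_le ?_ ((totalDegree_add _ _).trans
        (max_le ((totalDegree_add _ _).trans (max_le ?_ ?_)) ?_)))
      · simp
      all_goals
        refine (totalDegree_mul _ _).trans ?_
        simp [hdeg]
    · intro i; fin_cases i <;> simp [hlam]

theorem bdm_eval_line (p : MvPolynomial (Fin 2) ℝ) (a d : Fin 2 → ℝ) (t : ℝ) :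
    (aeval (fun r => Polynomial.C (a r) + Polynomial.C (d r) * Polynomial.X) p :
      Polynomial ℝ).eval t = eval (a + t • d) p := by
  induction p using MvPolynomial.induction_on with
  | C c => simp
  | add p q hp hq => simp [hp, hq]
  | mul_X p i hp => simp [hp, mul_comm t]

/-- A polynomial vanishing on an open edge is divisible by the barycentric coordinate. -/
theorem bdm_dvd (a c d : Fin 2 → ℝ) (l m n p : MvPolynomial (Fin 2) ℝ)
    (hsum : l + m + n = 1)
    (hX : ∀ r : Fin 2, X r = l * C (a r) + m * C (c r) + n * C (d r))
    (h : ∀ t ∈ Set.Ioo (0:ℝ) 1, eval (a + t • (c - a)) p = 0) : n ∣ p := by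
  set g : Polynomial ℝ :=
    aeval (fun r => Polynomial.C (a r) + Polynomial.C ((c - a) r) * Polynomial.X) p with hg
  have hg0 : g = 0 := by
    apply Polynomial.eq_zero_of_infinite_isRoot
    refine (Set.Ioo_infinite (zero_lt_one (α := ℝ))).mono ?_
    intro t ht
    change g.eval t = 0
    rw [hg, bdm_eval_line, h t ht]
  rw [← Ideal.mem_span_singleton, ← Ideal.Quotient.eq_zero_iff_mem]
  let π := Ideal.Quotient.mkₐ ℝ (Ideal.span {n})
  have hn : π n = 0 := by
    change Ideal.Quotient.mk _ n = 0
    rw [Ideal.Quotient.eq_zero_iff_mem]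
    exact Ideal.mem_span_singleton_self n
  have key : π = ((Polynomial.aeval (π m)).comp
      (aeval (fun r => Polynomial.C (a r) + Polynomial.C ((c - a) r) * Polynomial.X))) := by
    apply MvPolynomial.algHom_ext
    intro r
    have hl : l = 1 - m - n := by rw [← hsum]; ring
    have e : (X r : MvPolynomial (Fin 2) ℝ)
        = C (a r) + m * C (c r - a r) + n * C (d r - a r) := by
      rw [hX r, hl]; simp only [map_sub]; ring
    have hC : ∀ z : ℝ, π (C z) = algebraMap ℝ _ z := fun z => π.commutes z
    rw [e, map_add, map_add, map_mul, map_mul, hn, ← e]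
    simp [hC, mul_comm (π m)]
  change π p = 0
  rw [key, AlgHom.comp_apply, ← hg, hg0, map_zero]

/-- Antiderivative in the variable `i`. -/
noncomputable def bdmInt (i : Fin 2) : MvPolynomial (Fin 2) ℝ →ₗ[ℝ] MvPolynomial (Fin 2) ℝ :=
  (basisMonomials (Fin 2) ℝ).constr ℝ
    (fun m => monomial (m + Finsupp.single i 1) (1 / ((m i : ℝ) + 1)))

theorem bdmInt_monomial (i : Fin 2) (m : Fin 2 →₀ ℕ) (c : ℝ) :
    bdmInt i (monomial m c) = monomial (m + Finsupp.single i 1) (c / ((m i : ℝ) + 1)) := by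
  have h : (monomial m c : MvPolynomial (Fin 2) ℝ) = c • basisMonomials (Fin 2) ℝ m := by
    simp [smul_monomial]
  rw [h, map_smul, bdmInt, Module.Basis.constr_basis, smul_monomial]
  congr 1
  simp [div_eq_mul_inv]

theorem bdmInt_self (i : Fin 2) (p : MvPolynomial (Fin 2) ℝ) : pderiv i (bdmInt i p) = p := by
  induction p using MvPolynomial.induction_on' with
  | monomial m c =>
    rw [bdmInt_monomial, pderiv_monomial]
    have : ((m i : ℝ) + 1) ≠ 0 := by positivity
    simp [this]
  | add p q hp hq => simp [hp, hq]

theorem bdmInt_comm (i j : Fin 2) (hij : i ≠ j) (p : MvPolynomial (Fin 2) ℝ) :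
    pderiv j (bdmInt i p) = bdmInt i (pderiv j p) := by
  induction p using MvPolynomial.induction_on' with
  | monomial m c =>
    rw [bdmInt_monomial, pderiv_monomial, pderiv_monomial, bdmInt_monomial]
    have h1 : (Finsupp.single i 1 : Fin 2 →₀ ℕ) j = 0 := by simp [hij]
    have h2 : (Finsupp.single j 1 : Fin 2 →₀ ℕ) i = 0 := by simp [hij.symm]
    by_cases hm : m j = 0
    · simp [hm, h1]
    · have : m + Finsupp.single i 1 - Finsupp.single j 1
          = m - Finsupp.single j 1 + Finsupp.single i 1 := by
        ext k
        by_cases hk : k = j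
        · subst hk; simp [h1]
        · simp [Finsupp.single_apply, Ne.symm hk]
      rw [this]
      congr 1
      simp [h1, h2]
      ring
  | add p q hp hq => simp [hp, hq]

theorem bdmInt_deg (i : Fin 2) (p : MvPolynomial (Fin 2) ℝ) :
    (bdmInt i p).totalDegree ≤ p.totalDegree + 1 := by
  conv_lhs => rw [p.as_sum, map_sum]
  apply totalDegree_finsetSum_le
  intro m hm
  rw [bdmInt_monomial]
  refine (totalDegree_monomial_le _ _).trans ?_
  have := le_totalDegree hm
  change (m + Finsupp.single i 1).sum (fun _ e => e) ≤ _
  rw [Finsupp.sum_add_index' (by simp) (by simp)]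
  simpa using this

theorem bdm_pderiv_deg (i : Fin 2) (p : MvPolynomial (Fin 2) ℝ) :
    (pderiv i p).totalDegree ≤ p.totalDegree - 1 := by
  conv_lhs => rw [p.as_sum, map_sum]
  apply totalDegree_finsetSum_le
  intro m hm
  rw [pderiv_monomial]
  by_cases h : m i = 0
  · simp [h]
  refine (totalDegree_monomial_le _ _).trans ?_
  have h1 := le_totalDegree hm
  have h2 : m = (m - Finsupp.single i 1) + Finsupp.single i 1 := by
    ext k
    by_cases hk : k = i
    · subst hk; simp; omega
    · simp [Ne.symm hk]
  rw [h2, Finsupp.sum_add_index' (by simp) (by simp)] at h1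
  simp only [Finsupp.sum_single_index] at h1
  change (m - Finsupp.single i 1).sum (fun _ e => e) ≤ _
  omega

/-- Polynomial potentials for divergence free fields. -/
theorem bdm_potential (k : ℕ) (τ : Fin 2 → MvPolynomial (Fin 2) ℝ)
    (hk : ∀ r, (τ r).totalDegree ≤ k)
    (hdiv : pderiv 0 (τ 0) + pderiv 1 (τ 1) = 0) :
    ∃ w : MvPolynomial (Fin 2) ℝ, w.totalDegree ≤ k + 1 ∧ pderiv 1 w = τ 0 ∧
      pderiv 0 w = - τ 1 := by
  have hg : (τ 1 + pderiv 0 (bdmInt 1 (τ 0))).totalDegree ≤ k := by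
    refine (totalDegree_add _ _).trans (max_le (hk 1) ?_)
    have := bdm_pderiv_deg 0 (bdmInt 1 (τ 0))
    have := bdmInt_deg 1 (τ 0)
    have := hk 0
    omega
  refine ⟨bdmInt 1 (τ 0) - bdmInt 0 (τ 1 + pderiv 0 (bdmInt 1 (τ 0))), ?_, ?_, ?_⟩
  · refine (totalDegree_sub _ _).trans (max_le ?_ ?_)
    · exact (bdmInt_deg _ _).trans (by have := hk 0; omega)
    · exact (bdmInt_deg _ _).trans (by omega)
  · rw [map_sub, bdmInt_self, bdmInt_comm 0 1 (by decide), map_add,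
      bdmInt_comm 1 0 (by decide), bdmInt_self, add_comm, hdiv]
    simp
  · rw [map_sub, bdmInt_self]; ring

theorem bdm_interior (x : Fin 3 → (Fin 2 → ℝ))
    (hnd : LinearIndependent ℝ ![x 1 - x 0, x 2 - x 0]) :
    (interior (convexHull ℝ (Set.range x))).Nonempty := by
  rw [interior_convexHull_nonempty_iff_affineSpan_eq_top]
  have hai : AffineIndependent ℝ x := by
    rw [affineIndependent_iff_linearIndependent_vsub ℝ x 0]
    rw [← linearIndependent_equiv (finSuccAboveEquiv (0 : Fin 3))]
    have : ((fun i : {y : Fin 3 // y ≠ 0} => (x i -ᵥ x 0 : Fin 2 → ℝ)) ∘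
        (finSuccAboveEquiv (0 : Fin 3))) = ![x 1 - x 0, x 2 - x 0] := by
      funext i
      fin_cases i <;> rfl
    rw [this]
    exact hnd
  rw [hai.affineSpan_eq_top_iff_card_eq_finrank_add_one]
  simp

/-- A nonnegative polynomial with vanishing integral over the triangle vanishes. -/
theorem bdm_pos (x : Fin 3 → (Fin 2 → ℝ))
    (hnd : LinearIndependent ℝ ![x 1 - x 0, x 2 - x 0])
    (p : MvPolynomial (Fin 2) ℝ) (hp : ∀ y, 0 ≤ eval y p)
    (h : ∫ y in convexHull ℝ (Set.range x), eval y p = 0) : p = 0 := by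
  have hc : Continuous (fun y : Fin 2 → ℝ => eval y p) := continuous_eval p
  have hK : IsCompact (convexHull ℝ (Set.range x)) :=
    (Set.finite_range x).isCompact_convexHull (𝕜 := ℝ)
  have hi := hc.continuousOn.integrableOn_compact (μ := volume) hK
  rw [MeasureTheory.integral_eq_zero_iff_of_nonneg_ae (Filter.Eventually.of_forall hp) hi] at h
  have h' := ae_restrict_of_ae_restrict_of_subset interior_subset h
  have h2 := Measure.eqOn_open_of_ae_eq h' isOpen_interior hc.continuousOn continuousOn_const
  obtain ⟨y, hy⟩ := bdm_interior x hnd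
  obtain ⟨ε, hε, hb⟩ := Metric.isOpen_iff.mp isOpen_interior y hy
  rw [ball_pi _ hε] at hb
  apply MvPolynomial.funext_set (fun i => Metric.ball (y i) ε)
  · intro i
    rw [Real.ball_eq_Ioo]
    exact Set.Ioo_infinite (by linarith)
  · intro z hz
    rw [map_zero]
    exact h2 (hb hz)

theorem bdm_edge (k : ℕ) (τ : Fin 2 → MvPolynomial (Fin 2) ℝ)
    (hτ : ∀ r, (τ r).totalDegree ≤ k) (a d ν : Fin 2 → ℝ)
    (h : ∀ q : Polynomial ℝ, q.natDegree ≤ k → ∫ t in (0:ℝ)..1,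
            ((fun r => eval (a + t • d) (τ r)) ⬝ᵥ ν) * q.eval t = 0) (t : ℝ) :
    eval (a + t • d) (τ 0) * ν 0 + eval (a + t • d) (τ 1) * ν 1 = 0 := by
  let γ : Fin 2 → Polynomial ℝ := fun r => Polynomial.C (a r) + Polynomial.C (d r) * Polynomial.X
  have hγ : ∀ r, (γ r).natDegree ≤ 1 := by
    intro r
    simp only [γ]
    compute_degree
  let g : Polynomial ℝ := aeval γ (τ 0) * Polynomial.C (ν 0) + aeval γ (τ 1) * Polynomial.C (ν 1)
  have hgd : g.natDegree ≤ k := by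
    have : ∀ r, (aeval γ (τ r)).natDegree ≤ k := by
      intro r
      have := MvPolynomial.aeval_natDegree_le (τ r) (hτ r) γ hγ
      simpa using this
    refine Polynomial.natDegree_add_le_of_degree_le ?_ ?_ <;>
      exact (Polynomial.natDegree_mul_C_le _ _).trans (this _)
  have hge : ∀ t, g.eval t = (fun r => eval (a + t • d) (τ r)) ⬝ᵥ ν := by
    intro t
    simp [g, γ, bdm_eval_line, dotProduct, Fin.sum_univ_two]
  have h0 := h g hgd
  simp only [← hge] at h0
  have hg0 : g = 0 := by
    rw [intervalIntegral.integral_of_le zero_le_one, MeasureTheory.integral_eq_zero_iff_of_nonneg_ae] at h0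
    · have h' := ae_restrict_of_ae_restrict_of_subset Set.Ioo_subset_Ioc_self h0
      have h2 := Measure.eqOn_open_of_ae_eq h' isOpen_Ioo
        (g.continuous.mul g.continuous).continuousOn continuousOn_const
      apply Polynomial.eq_zero_of_infinite_isRoot
      refine (Set.Ioo_infinite (zero_lt_one (α := ℝ))).mono ?_
      intro t ht
      exact mul_self_eq_zero.mp (h2 ht)
    · exact Filter.Eventually.of_forall (fun t => mul_self_nonneg _)
    · exact ((g.continuous.mul g.continuous).intervalIntegrable 0 1).1
  have := hge t
  rw [hg0] at this
  simpa [dotProduct, Fin.sum_univ_two, eq_comm] using this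

/-- The reference triangle. -/
def bdmT : Set (ℝ × ℝ) := {p | 0 ≤ p.1 ∧ 0 ≤ p.2 ∧ p.1 + p.2 ≤ 1}

theorem bdmT_closed : IsClosed bdmT := by
  have h1 : IsClosed {p : ℝ × ℝ | 0 ≤ p.1} := isClosed_le continuous_const continuous_fst
  have h2 : IsClosed {p : ℝ × ℝ | 0 ≤ p.2} := isClosed_le continuous_const continuous_snd
  have h3 : IsClosed {p : ℝ × ℝ | p.1 + p.2 ≤ 1} :=
    isClosed_le (continuous_fst.add continuous_snd) continuous_const
  exact h1.inter (h2.inter h3)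

theorem bdmT_compact : IsCompact bdmT := by
  refine (isCompact_Icc (a := ((0 : ℝ), (0 : ℝ))) (b := (1, 1))).of_isClosed_subset
    bdmT_closed ?_
  rintro ⟨s, t⟩ ⟨h1, h2, h3⟩
  simp only at h1 h2 h3
  exact ⟨⟨h1, h2⟩, ⟨by simp only; linarith, by simp only; linarith⟩⟩

theorem bdm_fubini (f : ℝ × ℝ → ℝ) (hf : Continuous f) :
    ∫ p in bdmT, f p = ∫ s in (0:ℝ)..1, ∫ t in (0:ℝ)..(1 - s), f (s, t) := by
  have hi : IntegrableOn f bdmT volume := hf.continuousOn.integrableOn_compact bdmT_compact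
  rw [← MeasureTheory.integral_indicator bdmT_closed.measurableSet, Measure.volume_eq_prod, integral_prod,
    intervalIntegral.integral_of_le zero_le_one, ← integral_Icc_eq_integral_Ioc,
    ← MeasureTheory.integral_indicator measurableSet_Icc]
  · congr 1
    funext s
    by_cases hs : s ∈ Set.Icc (0:ℝ) 1
    · rw [Set.indicator_of_mem hs, intervalIntegral.integral_of_le (by linarith [hs.2]),
        ← integral_Icc_eq_integral_Ioc, ← MeasureTheory.integral_indicator measurableSet_Icc]
      congr 1
      funext t
      by_cases ht : t ∈ Set.Icc (0:ℝ) (1 - s)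
      · rw [Set.indicator_of_mem ht, Set.indicator_of_mem]
        exact ⟨hs.1, ht.1, by simp only; linarith [ht.2]⟩
      · rw [Set.indicator_of_notMem ht, Set.indicator_of_notMem]
        rintro ⟨h1, h2, h3⟩
        simp only at h1 h2 h3
        exact ht ⟨h2, by linarith⟩
    · rw [Set.indicator_of_notMem hs]
      have : ∀ t, bdmT.indicator f (s, t) = 0 := by
        intro t
        rw [Set.indicator_of_notMem]
        rintro ⟨h1, h2, h3⟩
        simp only at h1 h2 h3
        exact hs ⟨h1, by linarith⟩
      simp [this]
  · exact (integrable_indicator_iff bdmT_closed.measurableSet).mpr hi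

theorem bdm_swap (f : ℝ × ℝ → ℝ) :
    ∫ p in bdmT, f p = ∫ p in bdmT, f p.swap := by
  rw [← MeasureTheory.integral_indicator bdmT_closed.measurableSet,
    ← MeasureTheory.integral_indicator bdmT_closed.measurableSet, Measure.volume_eq_prod,
    ← integral_prod_swap]
  congr 1
  funext p
  have : p.swap ∈ bdmT ↔ p ∈ bdmT := by
    constructor <;> rintro ⟨h1, h2, h3⟩
    · exact ⟨h2, h1, by rw [Prod.fst_swap, Prod.snd_swap] at h3; linarith⟩
    · exact ⟨h2, h1, by simp only [Prod.fst_swap, Prod.snd_swap]; linarith⟩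
  by_cases hp : p ∈ bdmT
  · rw [Set.indicator_of_mem hp, Set.indicator_of_mem (this.mpr hp)]
  · rw [Set.indicator_of_notMem hp, Set.indicator_of_notMem (fun h => hp (this.mp h))]

theorem bdm_image (x : Fin 3 → (Fin 2 → ℝ)) :
    (fun y : Fin 2 → ℝ => x 0 + (y 0 • (x 1 - x 0) + y 1 • (x 2 - x 0))) ''
      (MeasurableEquiv.finTwoArrow (α := ℝ) ⁻¹' bdmT) = convexHull ℝ (Set.range x) := by
  apply Set.Subset.antisymm
  · rintro _ ⟨y, ⟨h1, h2, h3⟩, rfl⟩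
    have hc := convex_convexHull ℝ (Set.range x)
    have hm : ∀ i, x i ∈ convexHull ℝ (Set.range x) :=
      fun i => subset_convexHull ℝ _ ⟨i, rfl⟩
    change 0 ≤ y 0 at h1
    change 0 ≤ y 1 at h2
    change y 0 + y 1 ≤ 1 at h3
    have := hc.sum_mem (t := Finset.univ) (w := ![1 - y 0 - y 1, y 0, y 1]) (z := x)
      (by intro i _; fin_cases i <;> simp <;> linarith)
      (by simp [Fin.sum_univ_three]; ring) (fun i _ => hm i)
    convert this using 1
    rw [Fin.sum_univ_three]
    ext r
    simp
    ring
  · apply convexHull_min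
    · rintro _ ⟨i, rfl⟩
      fin_cases i
      · exact ⟨![0, 0], ⟨by simp, by simp, by simp⟩, by simp⟩
      · exact ⟨![1, 0], ⟨by simp, by simp, by simp⟩, by simp⟩
      · exact ⟨![0, 1], ⟨by simp, by simp, by simp⟩, by simp⟩
    · rintro _ ⟨y, ⟨h1, h2, h3⟩, rfl⟩ _ ⟨z, ⟨k1, k2, k3⟩, rfl⟩ a b ha hb hab
      change 0 ≤ y 0 at h1
      change 0 ≤ y 1 at h2
      change y 0 + y 1 ≤ 1 at h3
      change 0 ≤ z 0 at k1
      change 0 ≤ z 1 at k2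
      change z 0 + z 1 ≤ 1 at k3
      refine ⟨a • y + b • z, ⟨?_, ?_, ?_⟩, ?_⟩
      · change 0 ≤ a * y 0 + b * z 0
        positivity
      · change 0 ≤ a * y 1 + b * z 1
        positivity
      · change (a * y 0 + b * z 0) + (a * y 1 + b * z 1) ≤ 1
        nlinarith
      · ext r
        simp
        linear_combination (-x 0 r) * hab

theorem bdm_cov (x : Fin 3 → (Fin 2 → ℝ))
    (hd : (x 1 - x 0) 0 * (x 2 - x 0) 1 - (x 1 - x 0) 1 * (x 2 - x 0) 0 ≠ 0) :
    ∃ c : ℝ, ∀ g : (Fin 2 → ℝ) → ℝ, ∫ y in convexHull ℝ (Set.range x), g y =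
      c * ∫ p in bdmT, g (x 0 + (p.1 • (x 1 - x 0) + p.2 • (x 2 - x 0))) := by
  let L : (Fin 2 → ℝ) →L[ℝ] (Fin 2 → ℝ) :=
    (ContinuousLinearMap.proj 0 : (Fin 2 → ℝ) →L[ℝ] ℝ).smulRight (x 1 - x 0) +
    (ContinuousLinearMap.proj 1 : (Fin 2 → ℝ) →L[ℝ] ℝ).smulRight (x 2 - x 0)
  refine ⟨|L.det|, fun g => ?_⟩
  rw [← bdm_image x]
  rw [integral_image_eq_integral_abs_det_fderiv_smul (f' := fun _ => L)]
  · rw [← MeasureTheory.integral_const_mul]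
    exact (volume_preserving_finTwoArrow ℝ).setIntegral_preimage_emb
      (MeasurableEquiv.measurableEmbedding _)
      (fun p => |L.det| * g (x 0 + (p.1 • (x 1 - x 0) + p.2 • (x 2 - x 0)))) bdmT
  · exact (MeasurableEquiv.measurable _) bdmT_closed.measurableSet
  · intro y _
    exact (L.hasFDerivAt.const_add (x 0)).hasFDerivWithinAt
  · intro y _ z _ h
    have h' := add_left_cancel h
    have e0 := congrFun h' 0
    have e1 := congrFun h' 1
    simp only [Pi.add_apply, Pi.smul_apply, smul_eq_mul] at e0 e1
    ext r
    fin_cases r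
    · apply mul_right_cancel₀ hd
      simp only [Fin.zero_eta]
      linear_combination e0 * (x 2 - x 0) 1 - e1 * (x 2 - x 0) 0
    · apply mul_right_cancel₀ hd
      simp only [Fin.mk_one]
      linear_combination e1 * (x 1 - x 0) 0 - e0 * (x 1 - x 0) 1

theorem bdm_ftc (a e f : Fin 2 → ℝ) (p : MvPolynomial (Fin 2) ℝ) :
    ∫ q in bdmT, eval (a + (q.1 • e + q.2 • f)) (C (f 0) * pderiv 0 p + C (f 1) * pderiv 1 p) =
      ∫ s in (0:ℝ)..1, (eval (a + (s • e + (1 - s) • f)) p - eval (a + s • e) p) := by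
  rw [bdm_fubini (fun q : ℝ × ℝ => eval (a + (q.1 • e + q.2 • f))
    (C (f 0) * pderiv 0 p + C (f 1) * pderiv 1 p))
    ((continuous_eval _).comp (by fun_prop))]
  congr 1
  funext s
  simp only
  have h := intervalIntegral.integral_eq_sub_of_hasDerivAt (a := (0 : ℝ)) (b := 1 - s)
    (fun t _ => bdm_hasDerivAt p (a + s • e) f t)
    (Continuous.intervalIntegrable (by
      have h0 : Continuous (fun t : ℝ => a + s • e + t • f) := by fun_prop
      have h1 := (continuous_eval (pderiv 0 p)).comp h0
      have h2 := (continuous_eval (pderiv 1 p)).comp h0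
      exact (continuous_const.mul h1).add (continuous_const.mul h2)) _ _)
  simp only [zero_smul, add_zero] at h
  simp only [map_add, map_mul, eval_C, ← add_assoc]
  exact h

theorem bdm_div (x : Fin 3 → (Fin 2 → ℝ))
    (hd : (x 1 - x 0) 0 * (x 2 - x 0) 1 - (x 1 - x 0) 1 * (x 2 - x 0) 0 ≠ 0)
    (F : Fin 2 → MvPolynomial (Fin 2) ℝ)
    (hF : ∀ i j : Fin 3, i ≠ j → ∀ t : ℝ,
      eval (x i + t • (x j - x i)) (F 0) * (x j - x i) 1
        - eval (x i + t • (x j - x i)) (F 1) * (x j - x i) 0 = 0) :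
    ∫ y in convexHull ℝ (Set.range x), eval y (pderiv 0 (F 0) + pderiv 1 (F 1)) = 0 := by
  obtain ⟨c, hc⟩ := bdm_cov x hd
  rw [hc]
  have h01 := hF 0 1 (by decide)
  have h02 := hF 0 2 (by decide)
  have h12 := hF 1 2 (by decide)
  have hx12 : x 2 - x 1 = (x 2 - x 0) - (x 1 - x 0) := by abel
  have hP : ∀ t : ℝ, x 1 + t • (x 2 - x 1) = x 0 + (t • (x 2 - x 0) + (1 - t) • (x 1 - x 0)) := by
    intro t
    ext r
    simp
    ring
  simp only [hP] at h12
  rw [hx12] at h12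
  generalize x 1 - x 0 = e at *
  generalize x 2 - x 0 = f at *
  generalize x 0 = a at *
  let G1 : MvPolynomial (Fin 2) ℝ := F 0 * C (f 1) - F 1 * C (f 0)
  let G2 : MvPolynomial (Fin 2) ℝ := F 1 * C (e 0) - F 0 * C (e 1)
  let D1 : MvPolynomial (Fin 2) ℝ := C (e 0) * pderiv 0 G1 + C (e 1) * pderiv 1 G1
  let D2 : MvPolynomial (Fin 2) ℝ := C (f 0) * pderiv 0 G2 + C (f 1) * pderiv 1 G2
  have hD : C (e 0 * f 1 - e 1 * f 0) * (pderiv 0 (F 0) + pderiv 1 (F 1)) = D1 + D2 := by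
    simp only [D1, D2, G1, G2, map_sub, map_mul, Derivation.leibniz, pderiv_C, smul_eq_mul]
    ring
  have hcont : ∀ p : MvPolynomial (Fin 2) ℝ,
      Continuous (fun q : ℝ × ℝ => eval (a + (q.1 • e + q.2 • f)) p) :=
    fun p => (continuous_eval p).comp (by fun_prop)
  have hint : ∀ p : MvPolynomial (Fin 2) ℝ,
      IntegrableOn (fun q : ℝ × ℝ => eval (a + (q.1 • e + q.2 • f)) p) bdmT volume :=
    fun p => (hcont p).continuousOn.integrableOn_compact bdmT_compact
  have hcont' : ∀ (p : MvPolynomial (Fin 2) ℝ) (u v : Fin 2 → ℝ),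
      Continuous (fun s : ℝ => eval (a + (s • u + (1 - s) • v)) p) :=
    fun p u v => (continuous_eval p).comp (by fun_prop)
  have hI2 : ∫ q in bdmT, eval (a + (q.1 • e + q.2 • f)) D2 =
      ∫ s in (0:ℝ)..1, eval (a + (s • f + (1 - s) • e)) G2 := by
    rw [bdm_ftc a e f G2]
    have : ∀ s : ℝ, eval (a + s • e) G2 = 0 := by
      intro s
      simp only [G2, map_sub, map_mul, eval_C]
      linear_combination -(h01 s)
    simp only [this, sub_zero]
    have h := intervalIntegral.integral_comp_sub_left (a := (0:ℝ)) (b := 1)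
      (fun s : ℝ => eval (a + (s • e + (1 - s) • f)) G2) 1
    simp only [sub_self, sub_zero, sub_sub_cancel] at h
    rw [← h]
    congr 1
    funext s
    rw [add_comm (s • f)]
  have hI1 : ∫ q in bdmT, eval (a + (q.1 • e + q.2 • f)) D1 =
      ∫ s in (0:ℝ)..1, eval (a + (s • f + (1 - s) • e)) G1 := by
    rw [bdm_swap]
    have h := bdm_ftc a f e G1
    have : ∀ s : ℝ, eval (a + s • f) G1 = 0 := by
      intro s
      simp only [G1, map_sub, map_mul, eval_C]
      linear_combination (h02 s)
    simp only [this, sub_zero] at h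
    rw [← h]
    congr 1
    funext q
    rw [add_comm (q.1 • f)]
    rfl
  have hsum : (e 0 * f 1 - e 1 * f 0) *
      ∫ q in bdmT, eval (a + (q.1 • e + q.2 • f)) (pderiv 0 (F 0) + pderiv 1 (F 1)) = 0 := by
    rw [← MeasureTheory.integral_const_mul]
    have : ∀ q : ℝ × ℝ, (e 0 * f 1 - e 1 * f 0) *
        eval (a + (q.1 • e + q.2 • f)) (pderiv 0 (F 0) + pderiv 1 (F 1)) =
        eval (a + (q.1 • e + q.2 • f)) D1 + eval (a + (q.1 • e + q.2 • f)) D2 := by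
      intro q
      rw [← map_add, ← hD, map_mul, eval_C]
    simp only [this]
    rw [MeasureTheory.integral_add (hint D1) (hint D2), hI1, hI2,
      ← intervalIntegral.integral_add ((hcont' _ _ _).intervalIntegrable _ _)
        ((hcont' _ _ _).intervalIntegrable _ _)]
    have : ∀ s : ℝ, eval (a + (s • f + (1 - s) • e)) G1
        + eval (a + (s • f + (1 - s) • e)) G2 = 0 := by
      intro s
      have := h12 s
      simp only [Pi.sub_apply] at this
      simp only [G1, G2, map_sub, map_mul, eval_C]
      linear_combination this
    simp [this]
  rw [(mul_eq_zero.mp hsum).resolve_left hd, mul_zero]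

theorem bdm_lam_edge (p : MvPolynomial (Fin 2) ℝ) (hp : p.totalDegree ≤ 1)
    (a c : Fin 2 → ℝ) (t : ℝ) :
    eval (a + t • (c - a)) p = (1 - t) * eval a p + t * eval c p := by
  obtain ⟨u, v, w, rfl⟩ := bdm_deg_one p hp
  simp
  ring

theorem bdm_bubble (x : Fin 3 → (Fin 2 → ℝ))
    (hnd : LinearIndependent ℝ ![x 1 - x 0, x 2 - x 0])
    (lam : Fin 3 → MvPolynomial (Fin 2) ℝ)
    (hdeg : ∀ i, (lam i).totalDegree ≤ 1)
    (hlam : ∀ i j, eval (x j) (lam i) = if i = j then (1 : ℝ) else 0)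
    (w : MvPolynomial (Fin 2) ℝ)
    (hw : ∀ i j : Fin 3, i ≠ j → ∀ t : ℝ, eval (x i + t • (x j - x i)) w = 0) :
    ∃ v, w = lam 0 * lam 1 * lam 2 * v := by
  obtain ⟨hs, hX⟩ := bdm_bary x hnd lam hdeg hlam
  obtain ⟨g0, hg0⟩ : lam 0 ∣ w :=
    bdm_dvd (x 1) (x 2) (x 0) (lam 1) (lam 2) (lam 0) w (by rw [← hs]; ring)
      (fun r => by rw [hX r]; ring) (fun t _ => hw 1 2 (by decide) t)
  obtain ⟨g1, hg1⟩ : lam 1 ∣ g0 := by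
    refine bdm_dvd (x 0) (x 2) (x 1) (lam 0) (lam 2) (lam 1) g0 (by rw [← hs]; ring)
      (fun r => by rw [hX r]; ring) (fun t ht => ?_)
    have h := hw 0 2 (by decide) t
    rw [hg0, map_mul, bdm_lam_edge _ (hdeg 0)] at h
    simp only [hlam] at h
    refine (mul_eq_zero.mp h).resolve_left ?_
    have := ht.2
    simp
    linarith
  obtain ⟨g2, hg2⟩ : lam 2 ∣ g1 := by
    refine bdm_dvd (x 0) (x 1) (x 2) (lam 0) (lam 1) (lam 2) g1 hs hX (fun t ht => ?_)
    have h := hw 0 1 (by decide) t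
    rw [hg0, hg1, map_mul, map_mul, bdm_lam_edge _ (hdeg 0), bdm_lam_edge _ (hdeg 1)] at h
    simp only [hlam] at h
    refine (mul_eq_zero.mp ((mul_eq_zero.mp h).resolve_left ?_)).resolve_left ?_
    · have := ht.2
      simp
      linarith
    · have := ht.1
      simp
      linarith
  exact ⟨g2, by rw [hg0, hg1, hg2]; ring⟩

/-- BDM unisolvence: a polynomial vector field of degree ≤ k on a
nondegenerate triangle is uniquely determined by its edge moments of its
normal component, its interior moments against gradients of `P_{k-1}`, and
its interior moments against `curl (b·P_{k-2})`. -/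
theorem BDM_unisolvence
    (k : ℕ) (hk : 1 ≤ k)
    (x : Fin 3 → (Fin 2 → ℝ))
    (hnd : LinearIndependent ℝ ![x 1 - x 0, x 2 - x 0])
    (lam : Fin 3 → MvPolynomial (Fin 2) ℝ)
    (hdeg : ∀ i, (lam i).totalDegree ≤ 1)
    (hlam : ∀ i j, eval (x j) (lam i) = if i = j then (1 : ℝ) else 0)
    (Δ : Set (Fin 2 → ℝ)) (hΔ : Δ = convexHull ℝ (Set.range x))
    (b : MvPolynomial (Fin 2) ℝ) (hb : b = lam 0 * lam 1 * lam 2)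
    (τ : Fin 2 → MvPolynomial (Fin 2) ℝ)
    (hτdeg : ∀ r, (τ r).totalDegree ≤ k)
    -- (1) edge moments of the normal component vanish
    (h1 : ∀ i j : Fin 3, i ≠ j →
      ∀ ν : Fin 2 → ℝ, ν ⬝ᵥ (x j - x i) = 0 →
        ∀ q : Polynomial ℝ, q.natDegree ≤ k →
          ∫ t in (0:ℝ)..1,
            ((fun r => eval (x i + t • (x j - x i)) (τ r)) ⬝ᵥ ν) * q.eval t
              = 0)
    -- (2) interior moments against gradients of `P_{k-1}` vanish
    (h2 : ∀ p : MvPolynomial (Fin 2) ℝ, p.totalDegree ≤ k - 1 →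
      ∫ y in Δ, ∑ r : Fin 2, eval y (τ r) * eval y (pderiv r p) = 0)
    -- (3) interior moments against `curl (b v)`, `v ∈ P_{k-2}`, vanish
    (h3 : ∀ v : MvPolynomial (Fin 2) ℝ, (v.totalDegree : ℤ) ≤ (k : ℤ) - 2 →
      ∫ y in Δ,
        eval y (τ 0) * eval y (pderiv 1 (b * v))
          + eval y (τ 1) * (-(eval y (pderiv 0 (b * v)))) = 0) :
    τ = 0 := by
  subst hΔ hb
  have hd := bdm_det _ _ hnd
  have hK : IsCompact (convexHull ℝ (Set.range x)) :=
    (Set.finite_range x).isCompact_convexHull (𝕜 := ℝ)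
  have hint : ∀ p : MvPolynomial (Fin 2) ℝ,
      IntegrableOn (fun y => eval y p) (convexHull ℝ (Set.range x)) volume :=
    fun p => (continuous_eval p).continuousOn.integrableOn_compact hK
  -- the normal component vanishes on the edges
  have hN : ∀ i j : Fin 3, i ≠ j → ∀ t : ℝ,
      eval (x i + t • (x j - x i)) (τ 0) * (x j - x i) 1
        - eval (x i + t • (x j - x i)) (τ 1) * (x j - x i) 0 = 0 := by
    intro i j hij t
    have h := bdm_edge k τ hτdeg (x i) (x j - x i) ![(x j - x i) 1, -(x j - x i) 0]
      (h1 i j hij _ (by simp [dotProduct, Fin.sum_univ_two]; ring)) t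
    simp only [Matrix.cons_val_zero, Matrix.cons_val_one] at h
    linear_combination h
  -- the divergence vanishes
  have hdiv : pderiv 0 (τ 0) + pderiv 1 (τ 1) = 0 := by
    set p := pderiv 0 (τ 0) + pderiv 1 (τ 1) with hp
    have hpd : p.totalDegree ≤ k - 1 := by
      refine (totalDegree_add _ _).trans (max_le ?_ ?_)
      · exact (bdm_pderiv_deg _ _).trans (Nat.sub_le_sub_right (hτdeg 0) 1)
      · exact (bdm_pderiv_deg _ _).trans (Nat.sub_le_sub_right (hτdeg 1) 1)
    have hD := bdm_div x hd (fun r => p * τ r) (by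
      intro i j hij t
      simp only [map_mul]
      linear_combination (eval (x i + t • (x j - x i)) p) * hN i j hij t)
    have hG := h2 p hpd
    have e1 : ∀ y, eval y (pderiv 0 (p * τ 0) + pderiv 1 (p * τ 1)) =
        eval y (τ 0 * pderiv 0 p + τ 1 * pderiv 1 p) + eval y (p * p) := by
      intro y
      rw [← map_add]
      congr 1
      simp only [Derivation.leibniz, smul_eq_mul]
      linear_combination (-p) * hp
    have e2 : ∀ y, ∑ r : Fin 2, eval y (τ r) * eval y (pderiv r p) =
        eval y (τ 0 * pderiv 0 p + τ 1 * pderiv 1 p) := by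
      intro y
      simp [Fin.sum_univ_two]
    simp only [e1] at hD
    simp only [e2] at hG
    rw [MeasureTheory.integral_add (hint _) (hint _), hG, zero_add] at hD
    have := bdm_pos x hnd (p * p) (fun y => by rw [map_mul]; exact mul_self_nonneg _) hD
    exact mul_self_eq_zero.mp this
  obtain ⟨w, hwd, hw1, hw0⟩ := bdm_potential k τ hτdeg hdiv
  -- the potential is constant on the boundary
  have hconst : ∀ i j : Fin 3, i ≠ j → ∀ t : ℝ,
      eval (x i + t • (x j - x i)) w = eval (x i) w := by
    intro i j hij t
    have hder : ∀ t : ℝ, HasDerivAt (fun t : ℝ => eval (x i + t • (x j - x i)) w) 0 t := by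
      intro t
      refine (bdm_hasDerivAt w (x i) (x j - x i) t).congr_deriv ?_
      rw [hw0, hw1, map_neg]
      linear_combination hN i j hij t
    have := is_const_of_deriv_eq_zero (fun t => (hder t).differentiableAt)
      (fun t => (hder t).deriv) t 0
    simpa using this
  have hvert : ∀ i, eval (x i) w = eval (x 0) w := by
    intro i
    by_cases hi : i = 0
    · rw [hi]
    · have := hconst 0 i (Ne.symm hi) 1
      simpa using this
  obtain ⟨v, hv⟩ := bdm_bubble x hnd lam hdeg hlam (w - C (eval (x 0) w)) (by
    intro i j hij t
    rw [map_sub, eval_C, hconst i j hij t, hvert i, sub_self])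
  have hp1 : pderiv 1 (lam 0 * lam 1 * lam 2 * v) = τ 0 := by
    rw [← hv, map_sub, pderiv_C, sub_zero, hw1]
  have hp0 : pderiv 0 (lam 0 * lam 1 * lam 2 * v) = - τ 1 := by
    rw [← hv, map_sub, pderiv_C, sub_zero, hw0]
  have hfin : τ 0 = 0 ∧ τ 1 = 0 := by
    by_cases hv0 : v = 0
    · rw [hv0, mul_zero, map_zero] at hp1 hp0
      exact ⟨hp1.symm, by rw [← neg_eq_zero]; exact hp0.symm⟩
    have hlne : ∀ i, lam i ≠ 0 := by
      intro i h
      have := hlam i i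
      rw [h] at this
      simp at this
    have hl1 : ∀ i, 1 ≤ (lam i).totalDegree := by
      intro i
      by_contra hcon
      have h0 : (lam i).totalDegree = 0 := by omega
      rw [totalDegree_eq_zero_iff_eq_C] at h0
      have ha := hlam i i
      have hb := hlam i (i + 1)
      rw [h0, eval_C] at ha hb
      rw [ha] at hb
      fin_cases i <;> simp at hb
    have hvd : (v.totalDegree : ℤ) ≤ (k : ℤ) - 2 := by
      have hA : (w - C (eval (x 0) w)).totalDegree ≤ k + 1 :=
        (totalDegree_sub _ _).trans (max_le hwd (by simp))
      rw [hv, totalDegree_mul_of_isDomain (mul_ne_zero (mul_ne_zero (hlne 0) (hlne 1)) (hlne 2))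
        hv0, totalDegree_mul_of_isDomain (mul_ne_zero (hlne 0) (hlne 1)) (hlne 2),
        totalDegree_mul_of_isDomain (hlne 0) (hlne 1)] at hA
      have := hl1 0
      have := hl1 1
      have := hl1 2
      omega
    have h := h3 v hvd
    rw [hp1, hp0] at h
    have e : ∀ y, eval y (τ 0) * eval y (τ 0) + eval y (τ 1) * (-(eval y (- τ 1))) =
        eval y (τ 0 * τ 0 + τ 1 * τ 1) := by
      intro y
      simp
    simp only [e] at h
    have hz := bdm_pos x hnd _ (fun y => by
      rw [map_add, map_mul, map_mul]
      exact add_nonneg (mul_self_nonneg _) (mul_self_nonneg _)) h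
    have hy : ∀ y, eval y (τ 0) = 0 ∧ eval y (τ 1) = 0 := by
      intro y
      have := congrArg (eval y) hz
      rw [map_add, map_mul, map_mul, map_zero] at this
      exact mul_self_add_mul_self_eq_zero.mp this
    exact ⟨MvPolynomial.funext (fun y => by rw [(hy y).1, map_zero]),
      MvPolynomial.funext (fun y => by rw [(hy y).2, map_zero])⟩
  funext r
  fin_cases r
  · exact hfin.1
  · exact hfin.2
end

section
/- On a nondegenerate triangle Δ ⊂ ℝ², for k ≥ 2, the divergence operator div maps the bubble space H_{Δ,k,b} = Σ_{1≤i<j≤3} λ_iλ_j P_{k−2}(Δ;ℝ) t_{i,j}t_{i,j}^T (applied row-wise to symmetric matrix fields) onto the L²(Δ)-orthogonal complement R^⊥(Δ) of the 2D rigid motion space R(Δ) = span{(1,0),(0,1),(y,−x)} inside P_{k−1}(Δ;ℝ²). -/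
open Matrix MvPolynomial MeasureTheory

namespace DivBubble

lemma td_add {f g : MvPolynomial (Fin 2) ℝ} {n : ℕ} (hf : f.totalDegree ≤ n)
    (hg : g.totalDegree ≤ n) : (f + g).totalDegree ≤ n :=
  (totalDegree_add f g).trans (max_le hf hg)

lemma td_sub {f g : MvPolynomial (Fin 2) ℝ} {n : ℕ} (hf : f.totalDegree ≤ n)
    (hg : g.totalDegree ≤ n) : (f - g).totalDegree ≤ n :=
  (totalDegree_sub f g).trans (max_le hf hg)

lemma td_mul {f g : MvPolynomial (Fin 2) ℝ} {m l n : ℕ} (hf : f.totalDegree ≤ m)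
    (hg : g.totalDegree ≤ l) (h : m + l ≤ n) : (f * g).totalDegree ≤ n :=
  (totalDegree_mul f g).trans ((add_le_add hf hg).trans h)

lemma td_Cmul {g : MvPolynomial (Fin 2) ℝ} {n : ℕ} (c : ℝ)
    (hg : g.totalDegree ≤ n) : (C c * g).totalDegree ≤ n :=
  td_mul (m := 0) (by simp) hg (by omega)

lemma td_X (i : Fin 2) : (X i : MvPolynomial (Fin 2) ℝ).totalDegree ≤ 1 := by simp

lemma td_pderiv (i : Fin 2) {f : MvPolynomial (Fin 2) ℝ} {n : ℕ} (hf : f.totalDegree ≤ n + 1) :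
    (pderiv i f).totalDegree ≤ n := by
  rw [totalDegree]
  refine Finset.sup_le fun m hm => ?_
  rw [mem_support_iff, coeff_pderiv] at hm
  have h1 : m + Finsupp.single i 1 ∈ f.support := by
    rw [mem_support_iff]
    intro h; simp [h] at hm
  have h2 := (le_totalDegree h1).trans hf
  rw [Finsupp.sum_add_index' (by simp) (by simp)] at h2
  simp at h2
  exact h2

lemma td_aeval (g : Fin 2 → MvPolynomial (Fin 2) ℝ) (hg : ∀ i, (g i).totalDegree ≤ 1)
    (f : MvPolynomial (Fin 2) ℝ) : (aeval g f).totalDegree ≤ f.totalDegree := by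
  conv_lhs => rw [f.as_sum, map_sum]
  refine totalDegree_finsetSum_le fun m hm => ?_
  rw [aeval_monomial]
  refine td_mul (m := 0) (l := f.totalDegree) (by simp) ?_ (by simp)
  refine le_trans ?_ (le_totalDegree hm)
  rw [Finsupp.prod, Finsupp.sum]
  refine (totalDegree_finsetProd _ _).trans (Finset.sum_le_sum fun i _ => ?_)
  refine (totalDegree_pow _ _).trans ?_
  have := hg i
  nlinarith

lemma nd_aeval (g : Fin 2 → Polynomial ℝ) (hg : ∀ i, (g i).natDegree ≤ 1)
    (f : MvPolynomial (Fin 2) ℝ) : (aeval g f).natDegree ≤ f.totalDegree := by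
  conv_lhs => rw [f.as_sum, map_sum]
  refine Polynomial.natDegree_sum_le_of_forall_le _ _ fun m hm => ?_
  rw [aeval_monomial]
  refine (Polynomial.natDegree_C_mul_le _ _).trans ?_
  refine le_trans ?_ (le_totalDegree hm)
  rw [Finsupp.prod, Finsupp.sum]
  refine (Polynomial.natDegree_prod_le _ _).trans (Finset.sum_le_sum fun i _ => ?_)
  refine (Polynomial.natDegree_pow_le).trans ?_
  have := hg i
  nlinarith

lemma td_up (i : Fin 2) (w : Polynomial ℝ) :
    (Polynomial.aeval (X i : MvPolynomial (Fin 2) ℝ) w).totalDegree ≤ w.natDegree := by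
  rw [Polynomial.aeval_eq_sum_range]
  refine totalDegree_finsetSum_le fun m hm => ?_
  refine (totalDegree_smul_le _ _).trans ?_
  rw [totalDegree_X_pow]
  simp at hm; omega

lemma exists_antideriv (i : Fin 2) (f : MvPolynomial (Fin 2) ℝ) :
    ∃ F, pderiv i F = f ∧ X i ∣ F ∧ F.totalDegree ≤ f.totalDegree + 1 := by
  refine ⟨∑ m ∈ f.support, monomial (m + Finsupp.single i 1) (f.coeff m / (m i + 1)), ?_, ?_, ?_⟩
  · rw [map_sum]
    conv_rhs => rw [f.as_sum]
    refine Finset.sum_congr rfl fun m _ => ?_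
    rw [pderiv_monomial]
    have : (m i : ℝ) + 1 ≠ 0 := by positivity
    simp [this]
  · refine Finset.dvd_sum fun m _ => ⟨monomial m (f.coeff m / (m i + 1)), ?_⟩
    rw [X, monomial_mul, add_comm, one_mul]
  · refine totalDegree_finsetSum_le fun m hm => ?_
    refine (totalDegree_monomial_le _ _).trans ?_
    have h2 := le_totalDegree hm
    change (m + Finsupp.single i 1).sum (fun _ e => e) ≤ _
    rw [Finsupp.sum_add_index' (by simp) (by simp)]
    simp
    exact h2

lemma exists_antideriv_uni (f : Polynomial ℝ) :
    ∃ F : Polynomial ℝ, F.derivative = f ∧ F.eval 0 = 0 ∧ F.natDegree ≤ f.natDegree + 1 := by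
  refine ⟨∑ m ∈ Finset.range (f.natDegree + 1), Polynomial.monomial (m + 1) (f.coeff m / (m + 1)), ?_, ?_, ?_⟩
  · rw [map_sum]
    conv_rhs => rw [f.as_sum_range]
    refine Finset.sum_congr rfl fun m _ => ?_
    rw [Polynomial.derivative_monomial]
    have : (m : ℝ) + 1 ≠ 0 := by positivity
    simp [this]
  · simp [Polynomial.eval_finsetSum]
  · refine Polynomial.natDegree_sum_le_of_forall_le _ _ fun m hm => ?_
    refine (Polynomial.natDegree_monomial_le _).trans ?_
    simp at hm; omega

/-- `λ₀` on the reference triangle. -/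
noncomputable def L : MvPolynomial (Fin 2) ℝ := 1 - X 0 - X 1

lemma td_L : L.totalDegree ≤ 1 := td_sub (td_sub (by simp) (td_X 0)) (td_X 1)

lemma L_ne : L ≠ 0 := by
  intro h
  have := congrArg (eval (fun _ => (0:ℝ))) h
  simp [L] at this

lemma dvd_sub_aeval (d : MvPolynomial (Fin 2) ℝ) (g : Fin 2 → MvPolynomial (Fin 2) ℝ)
    (hg : ∀ i, d ∣ X i - g i) (f : MvPolynomial (Fin 2) ℝ) : d ∣ f - aeval g f := by
  induction f using MvPolynomial.induction_on with
  | C a => simp [algebraMap_eq]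
  | add p q hp hq =>
    rw [map_add, add_sub_add_comm]; exact dvd_add hp hq
  | mul_X p i hp =>
    rw [map_mul, aeval_X]
    have : p * X i - aeval g p * g i = (p - aeval g p) * X i + aeval g p * (X i - g i) := by ring
    rw [this]
    exact dvd_add (hp.mul_right _) ((hg i).mul_left _)

/-- restriction to the hypotenuse, parametrised by the coordinate `t` -/
noncomputable def rho0 : MvPolynomial (Fin 2) ℝ →ₐ[ℝ] Polynomial ℝ :=
  aeval ![1 - Polynomial.X, Polynomial.X]
noncomputable def rho1 : MvPolynomial (Fin 2) ℝ →ₐ[ℝ] Polynomial ℝ :=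
  aeval ![Polynomial.X, 1 - Polynomial.X]

lemma nd1 : (1 - Polynomial.X : Polynomial ℝ).natDegree ≤ 1 :=
  (Polynomial.natDegree_sub_le _ _).trans (by simp)

lemma nd_rho0 (f) : (rho0 f).natDegree ≤ f.totalDegree :=
  nd_aeval _ (by intro i; fin_cases i <;> simp [nd1]) f
lemma nd_rho1 (f) : (rho1 f).natDegree ≤ f.totalDegree :=
  nd_aeval _ (by intro i; fin_cases i <;> simp [nd1]) f

lemma L_dvd0 {f : MvPolynomial (Fin 2) ℝ} (h : rho0 f = 0) : L ∣ f := by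
  have := dvd_sub_aeval L ![1 - X 1, X 1]
    (by intro i; fin_cases i
        · exact ⟨-1, by simp [L]; ring⟩
        · simp) f
  have h2 : aeval ![1 - X 1, X 1] f = Polynomial.aeval (X 1 : MvPolynomial (Fin 2) ℝ) (rho0 f) := by
    rw [rho0, ← AlgHom.comp_apply]
    congr 1
    ext i; fin_cases i <;> simp
  rw [h2, h] at this
  simpa using this

lemma L_dvd1 {f : MvPolynomial (Fin 2) ℝ} (h : rho1 f = 0) : L ∣ f := by
  have := dvd_sub_aeval L ![X 0, 1 - X 0]
    (by intro i; fin_cases i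
        · simp
        · exact ⟨-1, by simp [L]⟩) f
  have h2 : aeval ![X 0, 1 - X 0] f = Polynomial.aeval (X 0 : MvPolynomial (Fin 2) ℝ) (rho1 f) := by
    rw [rho1, ← AlgHom.comp_apply]
    congr 1
    ext i; fin_cases i <;> simp
  rw [h2, h] at this
  simpa using this

lemma factor (i : Fin 2) {F : MvPolynomial (Fin 2) ℝ} {n : ℕ} (hF : F.totalDegree ≤ n + 2)
    (h1 : X i ∣ F) (h2 : L ∣ F) : ∃ p, F = X i * L * p ∧ p.totalDegree ≤ n := by
  obtain ⟨G, rfl⟩ := h1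
  have hL : L ∣ G := by
    -- the linear form `L` and `X i` are coprime
    obtain ⟨H, hH⟩ := h2
    have h3 : X i ∣ L * H := ⟨G, hH.symm⟩
    rcases (X_prime (R := ℝ) (i := i)).dvd_or_dvd h3 with h | ⟨K, rfl⟩
    · obtain ⟨K, hK⟩ := h
      have := congrArg (eval (fun _ => (0:ℝ))) hK
      simp [L] at this
    · refine ⟨K, mul_left_cancel₀ (X_ne_zero i) (hH.trans ?_)⟩
      ring
  obtain ⟨p, rfl⟩ := hL
  refine ⟨p, by ring, ?_⟩
  by_cases hp : p = 0
  · simp [hp]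
  have hLp : L * p ≠ 0 := mul_ne_zero L_ne hp
  have hLd : 1 ≤ L.totalDegree := by
    by_contra hc
    have h0 : L.totalDegree = 0 := by omega
    rw [totalDegree_eq_zero_iff_eq_C] at h0
    have e1 := congrArg (eval (fun _ => (0:ℝ))) h0
    have e2 := congrArg (eval (fun _ => (1:ℝ))) h0
    simp only [eval_C] at e1 e2
    rw [← e1] at e2
    simp [L] at e2
    norm_num at e2
  rw [totalDegree_mul_of_isDomain (X_ne_zero i) hLp, totalDegree_mul_of_isDomain L_ne hp,
    totalDegree_X] at hF
  omega

/-- if antiderivative vanishes on the hypotenuse then `f` is attained -/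
lemma solve (i : Fin 2) {F : MvPolynomial (Fin 2) ℝ} {n : ℕ} (hF : F.totalDegree ≤ n + 2)
    (h1 : X i ∣ F) (h2 : L ∣ F) : ∃ p, pderiv i F = pderiv i (X i * L * p) ∧ p.totalDegree ≤ n := by
  obtain ⟨p, hp, hd⟩ := factor i hF h1 h2
  exact ⟨p, by rw [hp], hd⟩

lemma sub_C_pow_dvd {P : Polynomial ℝ} {a : ℝ} {m : ℕ} (h0 : P.eval a = 0)
    (h : (Polynomial.X - Polynomial.C a) ^ m ∣ P.derivative) :
    (Polynomial.X - Polynomial.C a) ^ (m + 1) ∣ P := by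
  by_cases hP : P = 0
  · simp [hP]
  have hd : P.derivative ≠ 0 := by
    intro hd
    have := Polynomial.derivative_eq_zero.1 hd
    obtain ⟨c, rfl⟩ := Polynomial.natDegree_eq_zero.1 this
    simp at h0 hP
    exact hP h0
  rw [← Polynomial.le_rootMultiplicity_iff hP]
  rw [← Polynomial.le_rootMultiplicity_iff hd, Polynomial.derivative_rootMultiplicity_of_root h0] at h
  have := (Polynomial.rootMultiplicity_pos hP).2 h0
  omega

lemma uni_factor {P : Polynomial ℝ} {a b n : ℕ} (h0 : Polynomial.X ^ a ∣ P)
    (h1 : (Polynomial.X - Polynomial.C (1:ℝ)) ^ b ∣ P) (hd : P.natDegree ≤ n) :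
    ∃ w : Polynomial ℝ, P = Polynomial.X ^ a * (1 - Polynomial.X) ^ b * w ∧
      (w = 0 ∨ w.natDegree + a + b ≤ n) := by
  have hc : IsCoprime (Polynomial.X ^ a : Polynomial ℝ) ((Polynomial.X - Polynomial.C (1:ℝ)) ^ b) := by
    refine IsCoprime.pow ?_
    exact ⟨1, -1, by simp⟩
  obtain ⟨w, rfl⟩ := hc.mul_dvd h0 h1
  refine ⟨(-1) ^ b * w, ?_, ?_⟩
  · have : (1 - Polynomial.X : Polynomial ℝ) = (-1) * (Polynomial.X - Polynomial.C 1) := by simp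
    rw [this, mul_pow]
    have h2 : ((-1 : Polynomial ℝ)) ^ b * (-1) ^ b = 1 := by rw [← mul_pow]; simp
    linear_combination (-(Polynomial.X ^ a * (Polynomial.X - Polynomial.C 1) ^ b * w)) * h2
  · by_cases hw : w = 0
    · simp [hw]
    right
    have h3 : (((-1 : Polynomial ℝ)) ^ b * w).natDegree = w.natDegree := by
      rcases neg_one_pow_eq_or (Polynomial ℝ) b with h | h <;> simp [h]
    rw [h3]
    have hX : (Polynomial.X - Polynomial.C (1:ℝ)) ≠ 0 := Polynomial.X_sub_C_ne_zero 1
    rw [Polynomial.natDegree_mul (mul_ne_zero (pow_ne_zero _ Polynomial.X_ne_zero) (pow_ne_zero _ hX)) hw,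
      Polynomial.natDegree_mul (pow_ne_zero _ Polynomial.X_ne_zero) (pow_ne_zero _ hX),
      Polynomial.natDegree_pow, Polynomial.natDegree_pow, Polynomial.natDegree_X_sub_C] at hd
    simp at hd
    omega

lemma pderiv_up (i j : Fin 2) (w : Polynomial ℝ) :
    pderiv i (Polynomial.aeval (X j : MvPolynomial (Fin 2) ℝ) w) =
      if i = j then Polynomial.aeval (X j : MvPolynomial (Fin 2) ℝ) w.derivative else 0 := by
  rw [Derivation.map_aeval]
  by_cases h : i = j
  · subst h; simp
  · rw [pderiv_X_of_ne (Ne.symm h)]; simp [h]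

set_option linter.unusedSimpArgs false

/-- the reference triangle -/
def Rf : Set (Fin 2 → ℝ) := {z | 0 ≤ z 0 ∧ 0 ≤ z 1 ∧ z 0 + z 1 ≤ 1}

lemma Rf_closed : IsClosed Rf := by
  have h : Rf = {z | 0 ≤ z 0} ∩ ({z | 0 ≤ z 1} ∩ {z | z 0 + z 1 ≤ 1}) := rfl
  rw [h]
  refine IsClosed.inter ?_ (IsClosed.inter ?_ ?_)
  · exact isClosed_le (by fun_prop) (by fun_prop)
  · exact isClosed_le (by fun_prop) (by fun_prop)
  · exact isClosed_le (by fun_prop) (by fun_prop)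

lemma Rf_compact : IsCompact Rf := by
  refine IsCompact.of_isClosed_subset (isCompact_Icc (a := (0 : Fin 2 → ℝ)) (b := 1)) Rf_closed ?_
  rintro z ⟨h0, h1, h2⟩
  constructor <;> intro i <;> fin_cases i <;> simp <;> linarith

lemma Rf_integrable {h : (Fin 2 → ℝ) → ℝ} (hc : Continuous h) : IntegrableOn h Rf :=
  hc.continuousOn.integrableOn_compact Rf_compact

lemma Rf_prod (h : (Fin 2 → ℝ) → ℝ) :
    ∫ z in Rf, h z = ∫ p : ℝ × ℝ, Rf.indicator h ![p.1, p.2] := by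
  rw [← integral_indicator Rf_closed.measurableSet]
  have := (volume_preserving_finTwoArrow ℝ).symm.integral_comp
    (MeasurableEquiv.measurableEmbedding _) (Rf.indicator h)
  rw [← this]
  rfl

lemma Rf_prod_int {h : (Fin 2 → ℝ) → ℝ} (hc : Continuous h) :
    Integrable (fun p : ℝ × ℝ => Rf.indicator h ![p.1, p.2]) (volume.prod volume) := by
  have h1 : Integrable (Rf.indicator h) := (integrable_indicator_iff Rf_closed.measurableSet).2
    (Rf_integrable hc)
  exact (volume_preserving_finTwoArrow ℝ).symm.integrable_comp_of_integrable h1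

lemma iter_aux (φ : ℝ → ℝ → ℝ) :
    ∫ t, ∫ s, (if 0 ≤ s ∧ 0 ≤ t ∧ s + t ≤ 1 then φ s t else 0) =
      ∫ t in (0:ℝ)..1, ∫ s in (0:ℝ)..(1 - t), φ s t := by
  rw [intervalIntegral.integral_of_le zero_le_one, ← integral_Icc_eq_integral_Ioc,
    ← integral_indicator measurableSet_Icc]
  congr 1
  ext t
  by_cases ht : t ∈ Set.Icc (0:ℝ) 1
  · rw [Set.indicator_of_mem ht, intervalIntegral.integral_of_le (by linarith [ht.2]),
      ← integral_Icc_eq_integral_Ioc, ← integral_indicator measurableSet_Icc]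
    congr 1
    ext s
    by_cases hs : s ∈ Set.Icc (0:ℝ) (1 - t)
    · rw [Set.indicator_of_mem hs, if_pos ⟨hs.1, ht.1, by linarith [hs.2]⟩]
    · rw [Set.indicator_of_notMem hs, if_neg]
      rintro ⟨a, b, c⟩
      exact hs ⟨a, by linarith⟩
  · rw [Set.indicator_of_notMem ht]
    refine integral_eq_zero_of_ae (Filter.Eventually.of_forall fun s => ?_)
    refine if_neg ?_
    rintro ⟨a, b, c⟩
    exact ht ⟨b, by linarith⟩

lemma ind_eq (h : (Fin 2 → ℝ) → ℝ) (s t : ℝ) : Rf.indicator h ![s, t] =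
    if 0 ≤ s ∧ 0 ≤ t ∧ s + t ≤ 1 then h ![s, t] else 0 := by
  classical
  rw [Set.indicator_apply]
  congr 1

lemma iter0 {h : (Fin 2 → ℝ) → ℝ} (hc : Continuous h) :
    ∫ z in Rf, h z = ∫ t in (0:ℝ)..1, ∫ s in (0:ℝ)..(1 - t), h ![s, t] := by
  rw [Rf_prod, Measure.volume_eq_prod, integral_prod_symm _ (Rf_prod_int hc), ← iter_aux]
  simp_rw [ind_eq]

lemma iter1 {h : (Fin 2 → ℝ) → ℝ} (hc : Continuous h) :
    ∫ z in Rf, h z = ∫ s in (0:ℝ)..1, ∫ t in (0:ℝ)..(1 - s), h ![s, t] := by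
  rw [Rf_prod, Measure.volume_eq_prod, integral_prod _ (Rf_prod_int hc),
    ← iter_aux (fun t s => h ![s, t])]
  simp_rw [ind_eq]
  congr 1; ext s; congr 1; ext t
  congr 1
  simp only [eq_iff_iff]
  constructor <;> rintro ⟨a, b, c⟩ <;> exact ⟨b, a, by linarith⟩

lemma cont_eval (f : MvPolynomial (Fin 2) ℝ) : Continuous (fun z => eval z f) :=
  MvPolynomial.continuous_eval f

lemma deriv0 (G : MvPolynomial (Fin 2) ℝ) (s t : ℝ) :
    HasDerivAt (fun s => eval ![s, t] G) (eval ![s, t] (pderiv 0 G)) s := by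
  induction G using MvPolynomial.induction_on with
  | C a => simpa using hasDerivAt_const s a
  | add p q hp hq =>
    refine ((hp.add hq).congr_deriv (by simp)).congr_of_eventuallyEq ?_
    exact Filter.Eventually.of_forall fun s => by simp
  | mul_X p i hp =>
    fin_cases i
    · have := hp.mul (hasDerivAt_id s)
      refine (this.congr_deriv ?_).congr_of_eventuallyEq ?_
      · simp [pderiv_X]; try ring
      · exact Filter.Eventually.of_forall fun s => by simp
    · have := hp.mul (hasDerivAt_const s t)
      refine (this.congr_deriv ?_).congr_of_eventuallyEq ?_
      · simp [pderiv_X]; try ring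
      · exact Filter.Eventually.of_forall fun s => by simp

lemma deriv1 (G : MvPolynomial (Fin 2) ℝ) (s t : ℝ) :
    HasDerivAt (fun t => eval ![s, t] G) (eval ![s, t] (pderiv 1 G)) t := by
  induction G using MvPolynomial.induction_on with
  | C a => simpa using hasDerivAt_const t a
  | add p q hp hq =>
    refine ((hp.add hq).congr_deriv (by simp)).congr_of_eventuallyEq ?_
    exact Filter.Eventually.of_forall fun s => by simp
  | mul_X p i hp =>
    fin_cases i
    · have := hp.mul (hasDerivAt_const t s)
      refine (this.congr_deriv ?_).congr_of_eventuallyEq ?_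
      · simp [pderiv_X]; try ring
      · exact Filter.Eventually.of_forall fun s => by simp
    · have := hp.mul (hasDerivAt_id t)
      refine (this.congr_deriv ?_).congr_of_eventuallyEq ?_
      · simp [pderiv_X]; try ring
      · exact Filter.Eventually.of_forall fun s => by simp

noncomputable def I (f : MvPolynomial (Fin 2) ℝ) : ℝ := ∫ z in Rf, eval z f

lemma I_add (f g) : I (f + g) = I f + I g := by
  simp only [I, map_add]
  exact integral_add (Rf_integrable (cont_eval f)) (Rf_integrable (cont_eval g))
lemma I_sub (f g) : I (f - g) = I f - I g := by
  simp only [I, map_sub]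
  exact integral_sub (Rf_integrable (cont_eval f)) (Rf_integrable (cont_eval g))
lemma I_C (c : ℝ) (g) : I (C c * g) = c * I g := by
  simp only [I, map_mul, eval_C]
  exact integral_const_mul _ _

lemma eval_rho0 (G : MvPolynomial (Fin 2) ℝ) (t : ℝ) : (rho0 G).eval t = eval ![1 - t, t] G := by
  induction G using MvPolynomial.induction_on with
  | C a => simp [rho0]
  | add p q hp hq => simp [hp, hq]
  | mul_X p i hp => fin_cases i <;> simp [hp] <;> left <;> simp [rho0]

lemma eval_rho1 (G : MvPolynomial (Fin 2) ℝ) (t : ℝ) : (rho1 G).eval t = eval ![t, 1 - t] G := by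
  induction G using MvPolynomial.induction_on with
  | C a => simp [rho1]
  | add p q hp hq => simp [hp, hq]
  | mul_X p i hp => fin_cases i <;> simp [hp] <;> left <;> simp [rho1]

lemma I_pderiv0 {G : MvPolynomial (Fin 2) ℝ} (hG : X 0 ∣ G) :
    I (pderiv 0 G) = ∫ t in (0:ℝ)..1, (rho0 G).eval t := by
  rw [I, iter0 (cont_eval _)]
  congr 1
  ext t
  rw [intervalIntegral.integral_eq_sub_of_hasDerivAt (f := fun s => eval ![s, t] G)
    (fun s _ => deriv0 G s t), eval_rho0]
  · obtain ⟨H, rfl⟩ := hG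
    simp
  · apply Continuous.intervalIntegrable
    exact (cont_eval _).comp (by fun_prop)

lemma I_pderiv1 {G : MvPolynomial (Fin 2) ℝ} (hG : X 1 ∣ G) :
    I (pderiv 1 G) = ∫ t in (0:ℝ)..1, (rho1 G).eval t := by
  rw [I, iter1 (cont_eval _)]
  congr 1
  ext s
  rw [intervalIntegral.integral_eq_sub_of_hasDerivAt (f := fun t => eval ![s, t] G)
    (fun t _ => deriv1 G s t), eval_rho1]
  · obtain ⟨H, rfl⟩ := hG
    simp
  · apply Continuous.intervalIntegrable
    exact (cont_eval _).comp (by fun_prop)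

lemma int_poly (P : Polynomial ℝ) :
    ∫ t in (0:ℝ)..1, P.derivative.eval t = P.eval 1 - P.eval 0 := by
  rw [intervalIntegral.integral_eq_sub_of_hasDerivAt (f := fun s => P.eval s)
    (fun s _ => P.hasDerivAt s)]
  exact (Polynomial.continuous _).intervalIntegrable _ _

/-- tangential derivative along the hypotenuse -/
noncomputable def D (f : MvPolynomial (Fin 2) ℝ) : MvPolynomial (Fin 2) ℝ :=
  pderiv 1 f - pderiv 0 f

lemma I_D (r : MvPolynomial (Fin 2) ℝ) : I (D (X 0 * X 1 * r)) = 0 := by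
  rw [D, I_sub, I_pderiv0 ⟨X 1 * r, by ring⟩, I_pderiv1 ⟨X 0 * r, by ring⟩]
  simp_rw [eval_rho0, eval_rho1]
  have := intervalIntegral.integral_comp_sub_left (a := 0) (b := 1)
    (fun t => eval ![t, 1 - t] (X 0 * X 1 * r)) 1
  simp only [sub_sub_cancel, sub_self, sub_zero] at this
  rw [this, sub_self]

lemma I_D_mul (r : MvPolynomial (Fin 2) ℝ) : I ((X 0 + X 1) * D (X 0 * X 1 * r)) = 0 := by
  rw [← I_D ((X 0 + X 1) * r)]
  congr 1
  simp [D, pderiv_mul, pderiv_X]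
  ring

lemma rho0_L : rho0 L = 0 := by simp [rho0, L]
lemma rho1_L : rho1 L = 0 := by simp [rho1, L]

lemma I_p (p : MvPolynomial (Fin 2) ℝ) : I (pderiv 0 (X 0 * L * p)) = 0 := by
  rw [I_pderiv0 ⟨L * p, by ring⟩]; simp [rho0_L]
lemma I_q (p : MvPolynomial (Fin 2) ℝ) : I (pderiv 1 (X 1 * L * p)) = 0 := by
  rw [I_pderiv1 ⟨L * p, by ring⟩]; simp [rho1_L]
lemma I_p_mul (p : MvPolynomial (Fin 2) ℝ) : I (X 1 * pderiv 0 (X 0 * L * p)) = 0 := by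
  rw [← I_p (X 1 * p)]
  congr 1
  simp [pderiv_mul, pderiv_X]
  ring
lemma I_q_mul (p : MvPolynomial (Fin 2) ℝ) : I (X 0 * pderiv 1 (X 1 * L * p)) = 0 := by
  rw [← I_q (X 0 * p)]
  congr 1
  simp [pderiv_mul, pderiv_X]
  ring

lemma td_D {f : MvPolynomial (Fin 2) ℝ} {n : ℕ} (hf : f.totalDegree ≤ n + 1) :
    (D f).totalDegree ≤ n := td_sub (td_pderiv _ hf) (td_pderiv _ hf)

def Orth (f g : MvPolynomial (Fin 2) ℝ) : Prop :=
  I f = 0 ∧ I g = 0 ∧ I (f * X 1 - g * X 0) = 0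

lemma ref_forward {n : ℕ} {f g p q r : MvPolynomial (Fin 2) ℝ}
    (hp : p.totalDegree ≤ n) (hq : q.totalDegree ≤ n) (hr : r.totalDegree ≤ n)
    (hf : f = pderiv 0 (X 0 * L * p) - D (X 0 * X 1 * r))
    (hg : g = pderiv 1 (X 1 * L * q) + D (X 0 * X 1 * r)) :
    f.totalDegree ≤ n + 1 ∧ g.totalDegree ≤ n + 1 ∧ Orth f g := by
  have h1 : (X 0 * X 1 * r).totalDegree ≤ n + 1 + 1 :=
    td_mul (m := 2) (td_mul (td_X 0) (td_X 1) le_rfl) hr (by omega)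
  have h2 : (X 0 * L * p).totalDegree ≤ n + 1 + 1 :=
    td_mul (m := 2) (td_mul (td_X 0) td_L le_rfl) hp (by omega)
  have h3 : (X 1 * L * q).totalDegree ≤ n + 1 + 1 :=
    td_mul (m := 2) (td_mul (td_X 1) td_L le_rfl) hq (by omega)
  refine ⟨?_, ?_, ?_, ?_, ?_⟩
  · rw [hf]; exact td_sub (td_pderiv _ h2) (td_D h1)
  · rw [hg]; exact td_add (td_pderiv _ h3) (td_D h1)
  · rw [hf, I_sub, I_p, I_D, sub_zero]
  · rw [hg, I_add, I_q, I_D, add_zero]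
  · have : f * X 1 - g * X 0 = X 1 * pderiv 0 (X 0 * L * p) - X 0 * pderiv 1 (X 1 * L * q)
      - (X 0 + X 1) * D (X 0 * X 1 * r) := by rw [hf, hg]; ring
    rw [this, I_sub, I_sub, I_p_mul, I_q_mul, I_D_mul]; simp

lemma C2 : (C 2 : MvPolynomial (Fin 2) ℝ) = 2 := map_ofNat C 2
lemma C3 : (C 3 : MvPolynomial (Fin 2) ℝ) = 3 := map_ofNat C 3
lemma C4 : (C 4 : MvPolynomial (Fin 2) ℝ) = 4 := map_ofNat C 4
lemma C6 : (C 6 : MvPolynomial (Fin 2) ℝ) = 6 := map_ofNat C 6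
lemma PC2 : (Polynomial.C 2 : Polynomial ℝ) = 2 := map_ofNat Polynomial.C 2
lemma PC3 : (Polynomial.C 3 : Polynomial ℝ) = 3 := map_ofNat Polynomial.C 3

lemma ref_step1 {n : ℕ} {f : MvPolynomial (Fin 2) ℝ} (hd : f.totalDegree ≤ n + 1) (hf : I f = 0) :
    ∃ p r : MvPolynomial (Fin 2) ℝ, p.totalDegree ≤ n ∧ r.totalDegree ≤ n ∧
      f = pderiv 0 (X 0 * L * p) - D (X 0 * X 1 * r) := by
  obtain ⟨F, rfl, hX, hFd⟩ := exists_antideriv 0 f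
  have hFd : F.totalDegree ≤ n + 2 := by omega
  rw [I_pderiv0 hX] at hf
  obtain ⟨P, hP, hP0, hPd⟩ := exists_antideriv_uni (rho0 F)
  rw [← hP, int_poly, hP0, sub_zero] at hf
  have hA1 : (rho0 F).eval 1 = 0 := by
    rw [eval_rho0]; obtain ⟨H, rfl⟩ := hX; simp
  have d1 : Polynomial.X ^ 1 ∣ P := by
    have := Polynomial.dvd_iff_isRoot.2 hP0
    simpa using this
  have d2 : (Polynomial.X - Polynomial.C (1:ℝ)) ^ 2 ∣ P := by
    refine sub_C_pow_dvd hf ?_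
    rw [hP, pow_one]
    exact Polynomial.dvd_iff_isRoot.2 hA1
  have hPd' : P.natDegree ≤ n + 3 := by have := nd_rho0 F; omega
  obtain ⟨α, hα, hαd⟩ := uni_factor d1 d2 hPd'
  have hαn : α.natDegree ≤ n := by
    rcases hαd with h | h
    · simp [h]
    · omega
  set a := Polynomial.aeval (X 1 : MvPolynomial (Fin 2) ℝ) α with ha
  set a' := Polynomial.aeval (X 1 : MvPolynomial (Fin 2) ℝ) α.derivative with ha'
  have had : a.totalDegree ≤ n := (td_up _ _).trans hαn
  have e0 : pderiv 0 a = 0 := by rw [ha, pderiv_up]; simp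
  have e1 : pderiv 1 a = a' := by rw [ha, pderiv_up]; simp [ha']
  have e0' : pderiv 0 a' = 0 := by rw [ha', pderiv_up]; simp
  have key : L ∣ F - (X 0 ^ 2 * pderiv 1 (X 1 * a) - 2 * X 0 * X 1 * a) := by
    apply L_dvd0
    have r1 : rho0 a = α := by
      rw [ha, rho0, ← AlgHom.comp_apply]
      conv_rhs => rw [← AlgHom.id_apply (R := ℝ) α]
      congr 1
      ext; simp
    have r2 : rho0 a' = α.derivative := by
      rw [ha', rho0, ← AlgHom.comp_apply]
      conv_rhs => rw [← AlgHom.id_apply (R := ℝ) α.derivative]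
      congr 1
      ext; simp
    have r3 : rho0 (X 0) = 1 - Polynomial.X := by simp [rho0]
    have r4 : rho0 (X 1) = Polynomial.X := by simp [rho0]
    rw [map_sub, ← hP, hα]
    simp only [pderiv_mul, e1, pderiv_X_self, map_add, map_sub, map_mul, map_pow, r1, r2, r3, r4,
      Polynomial.derivative_mul, Polynomial.derivative_pow, Polynomial.derivative_X,
      Polynomial.derivative_one, map_ofNat, map_one]
    simp [PC2, PC3]
    ring
  have hX' : X 0 ∣ F - (X 0 ^ 2 * pderiv 1 (X 1 * a) - 2 * X 0 * X 1 * a) := by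
    refine dvd_sub hX ⟨X 0 * pderiv 1 (X 1 * a) - 2 * X 1 * a, by ring⟩
  have hXa : (X 1 * a).totalDegree ≤ n + 1 := td_mul (td_X 1) had (by omega)
  have h2 : (2 : MvPolynomial (Fin 2) ℝ) = C 2 := C2.symm
  have hdeg : (F - (X 0 ^ 2 * pderiv 1 (X 1 * a) - 2 * X 0 * X 1 * a)).totalDegree ≤ n + 2 := by
    refine td_sub hFd (td_sub ?_ ?_)
    · exact td_mul (m := 2) (by simp) (td_pderiv 1 hXa) (by omega)
    · rw [mul_assoc, mul_assoc, h2]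
      refine td_Cmul _ (td_mul (td_X 0) hXa (by omega))
  obtain ⟨p, hp, hpd⟩ := solve 0 hdeg hX' key
  refine ⟨p, -(2 * a), hpd, ?_, ?_⟩
  · rw [totalDegree_neg, h2]; exact td_Cmul _ had
  · rw [← hp]
    have c0 : pderiv (0 : Fin 2) (2 : MvPolynomial (Fin 2) ℝ) = 0 := by rw [h2, pderiv_C]
    have c1 : pderiv (1 : Fin 2) (2 : MvPolynomial (Fin 2) ℝ) = 0 := by rw [h2, pderiv_C]
    simp [D, pderiv_mul, pderiv_X, e0, e1, e0', pderiv_pow, c0, c1]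
    ring

lemma td_of_X_mul (i : Fin 2) {r : MvPolynomial (Fin 2) ℝ} {n : ℕ}
    (h : (X i * r).totalDegree ≤ n + 1) : r.totalDegree ≤ n := by
  by_cases hr : r = 0
  · simp [hr]
  rw [totalDegree_mul_of_isDomain (X_ne_zero i) hr, totalDegree_X] at h
  omega

lemma ref_step2 {n : ℕ} {g : MvPolynomial (Fin 2) ℝ} (hd : g.totalDegree ≤ n + 1) (hg : I g = 0)
    (hg2 : I (g * X 0) = 0) :
    ∃ p q r : MvPolynomial (Fin 2) ℝ, p.totalDegree ≤ n ∧ q.totalDegree ≤ n ∧ r.totalDegree ≤ n ∧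
      pderiv 0 (X 0 * L * p) = D (X 0 * X 1 * r) ∧
      g = pderiv 1 (X 1 * L * q) + D (X 0 * X 1 * r) := by
  obtain ⟨G, rfl, hX, hGd⟩ := exists_antideriv 1 g
  have hGd : G.totalDegree ≤ n + 2 := by omega
  have hg2' : pderiv 1 G * X 0 = pderiv 1 (X 0 * G) := by
    simp [pderiv_mul, pderiv_X]; ring
  rw [hg2', I_pderiv1 (hX.mul_left _)] at hg2
  rw [I_pderiv1 hX] at hg
  obtain ⟨Q, hQ, hQ0, hQd⟩ := exists_antideriv_uni (rho1 G)
  obtain ⟨W, hW, hW0, hWd⟩ := exists_antideriv_uni Q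
  rw [← hQ, int_poly, hQ0, sub_zero] at hg
  have r3 : rho1 (X 0) = Polynomial.X := by simp [rho1]
  have r4 : rho1 (X 1) = 1 - Polynomial.X := by simp [rho1]
  have hW1 : W.eval 1 = 0 := by
    have e : rho1 (X 0 * G) = (Polynomial.X * Q - W).derivative := by
      rw [map_mul, r3, Polynomial.derivative_sub, Polynomial.derivative_mul, hQ, hW]; simp
    rw [e, int_poly] at hg2
    simp [hg, hW0] at hg2
    exact hg2
  have hB1 : (rho1 G).eval 1 = 0 := by
    rw [eval_rho1]; obtain ⟨H, rfl⟩ := hX; simp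
  have d1 : Polynomial.X ^ 2 ∣ W := by
    have := sub_C_pow_dvd (m := 1) hW0 (by
      rw [hW, pow_one]; exact Polynomial.dvd_iff_isRoot.2 hQ0)
    simpa using this
  have d2 : (Polynomial.X - Polynomial.C (1:ℝ)) ^ 3 ∣ W := by
    refine sub_C_pow_dvd hW1 ?_
    rw [hW]
    refine sub_C_pow_dvd hg ?_
    rw [hQ, pow_one]
    exact Polynomial.dvd_iff_isRoot.2 hB1
  have hWd' : W.natDegree ≤ n + 4 := by have := nd_rho1 G; omega
  obtain ⟨w, hw, hwd⟩ := uni_factor d1 d2 hWd'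
  set a := Polynomial.aeval (X 0 : MvPolynomial (Fin 2) ℝ) w with ha
  set a' := Polynomial.aeval (X 0 : MvPolynomial (Fin 2) ℝ) w.derivative with ha'
  set a'' := Polynomial.aeval (X 0 : MvPolynomial (Fin 2) ℝ) w.derivative.derivative with ha''
  have e0 : pderiv 0 a = a' := by rw [ha, pderiv_up]; simp [ha']
  have e1 : pderiv 1 a = 0 := by rw [ha, pderiv_up]; simp
  have e0' : pderiv 0 a' = a'' := by rw [ha', pderiv_up]; simp [ha'']
  have e1' : pderiv 1 a' = 0 := by rw [ha', pderiv_up]; simp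
  have e1'' : pderiv 1 a'' = 0 := by rw [ha'', pderiv_up]; simp
  have hdeg : ∀ (c : MvPolynomial (Fin 2) ℝ) (m : ℕ), c.totalDegree ≤ m + 1 →
      (c * a).totalDegree ≤ n + m := by
    intro c m hc
    rcases hwd with h | h
    · simp [ha, h]
    · exact td_mul hc (td_up 0 w) (by omega)
  have h6 : (6 : MvPolynomial (Fin 2) ℝ) = C 6 := C6.symm
  have h2 : (2 : MvPolynomial (Fin 2) ℝ) = C 2 := C2.symm
  have h3 : (3 : MvPolynomial (Fin 2) ℝ) = C 3 := C3.symm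
  have n0 : ∀ (i : Fin 2), pderiv i (6 : MvPolynomial (Fin 2) ℝ) = 0 := by
    intro i; rw [h6, pderiv_C]
  have n2 : ∀ (i : Fin 2), pderiv i (2 : MvPolynomial (Fin 2) ℝ) = 0 := by
    intro i; rw [h2, pderiv_C]
  have n3 : ∀ (i : Fin 2), pderiv i (3 : MvPolynomial (Fin 2) ℝ) = 0 := by
    intro i; rw [h3, pderiv_C]
  set r : MvPolynomial (Fin 2) ℝ := -(C 6 * (2 * L * a - X 0 * a + X 0 * L * a')) with hr
  set p : MvPolynomial (Fin 2) ℝ := -(C 6 * (X 0 * a - 2 * X 1 * a - X 0 * X 1 * a')) with hp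
  set N : MvPolynomial (Fin 2) ℝ := (X 0 ^ 2 * X 1 ^ 2 * (C 2 * X 1 - C 3 * (1 - X 0))) * a with hN
  have hr' : X 0 * r = pderiv 0 (C (-6) * ((X 0 ^ 2 * L) * a)) := by
    rw [pderiv_C_mul, hr]
    simp [pderiv_mul, pderiv_X, pderiv_pow, L, e0]
    ring
  have hp' : X 0 * p = C (-6) * D ((X 1 * X 0 ^ 2) * a) := by
    rw [hp]
    simp [D, pderiv_mul, pderiv_X, pderiv_pow, e0, e1]
    ring
  have hrd : r.totalDegree ≤ n := by
    refine td_of_X_mul 0 ?_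
    rw [hr']
    refine td_pderiv 0 (td_Cmul _ (hdeg _ 2 ?_))
    exact td_mul (m := 2) (by simp) td_L (by omega)
  have hpd : p.totalDegree ≤ n := by
    refine td_of_X_mul 0 ?_
    rw [hp']
    refine td_Cmul _ (td_D (hdeg _ 2 ?_))
    exact td_mul (l := 2) (td_X 1) (by simp) (by omega)
  have hNd : (pderiv 0 (pderiv 0 N)).totalDegree ≤ n + 2 := by
    refine td_pderiv 0 (td_pderiv 0 (hdeg _ 4 ?_))
    refine td_mul (m := 4) (l := 1) (td_mul (m := 2) (l := 2) (by simp) (by simp) (by omega)) ?_ (by omega)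
    exact td_sub (td_Cmul _ (td_X 1)) (td_Cmul _ (td_sub (by simp) (td_X 0)))
  have hstr : (X 0 * X 1 * r).totalDegree ≤ n + 2 :=
    td_mul (m := 2) (td_mul (td_X 0) (td_X 1) le_rfl) hrd (by omega)
  have hGd2 : (G - (X 0 * X 1 * r - pderiv 0 (pderiv 0 N))).totalDegree ≤ n + 2 :=
    td_sub hGd (td_sub hstr hNd)
  have hNe : pderiv 0 (pderiv 0 N) = X 1 ^ 2 * ((2 * X 1 - 3) * (2 * a + 4 * X 0 * a' + X 0 ^ 2 * a'')
      + 3 * (6 * X 0 * a + 6 * X 0 ^ 2 * a' + X 0 ^ 3 * a'')) := by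
    rw [hN]
    simp [pderiv_mul, pderiv_X, pderiv_pow, e0, e0', n2, n3, C2, C3]
    ring
  have hX' : X 1 ∣ G - (X 0 * X 1 * r - pderiv 0 (pderiv 0 N)) := by
    refine dvd_sub hX (dvd_sub ⟨X 0 * r, by ring⟩ ?_)
    rw [hNe, pow_two, mul_assoc]
    exact dvd_mul_right _ _
  have key : L ∣ G - (X 0 * X 1 * r - pderiv 0 (pderiv 0 N)) := by
    apply L_dvd1
    have rr : ∀ v : Polynomial ℝ,
        rho1 (Polynomial.aeval (X 0 : MvPolynomial (Fin 2) ℝ) v) = v := by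
      intro v
      rw [rho1, ← AlgHom.comp_apply]
      conv_rhs => rw [← AlgHom.id_apply (R := ℝ) v]
      congr 1
      ext; simp
    have r0 : rho1 a = w := rr _
    have r1 : rho1 a' = w.derivative := rr _
    have r2 : rho1 a'' = w.derivative.derivative := rr _
    have r6 : rho1 (C 6) = 6 := by rw [← h6, map_ofNat]
    rw [map_sub, ← hQ, ← hW, hw, hNe, hr]
    simp only [map_add, map_sub, map_mul, map_pow, map_neg, r0, r1, r2, r3, r4, rho1_L, r6,
      Polynomial.derivative_mul, Polynomial.derivative_pow, Polynomial.derivative_X,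
      Polynomial.derivative_one, map_ofNat, map_one]
    simp [PC2, PC3]
    ring
  obtain ⟨q, hq, hqd⟩ := solve 1 hGd2 hX' key
  refine ⟨p, q, r, hpd, hqd, hrd, ?_, ?_⟩
  · rw [hp, hr]
    simp [D, pderiv_mul, pderiv_X, pderiv_pow, e0, e1, e0', e1', L, n2]
    ring
  · rw [← hq, hNe, hr]
    have n4 : ∀ (i : Fin 2), pderiv i (4 : MvPolynomial (Fin 2) ℝ) = 0 := by
      intro i
      have : (4 : MvPolynomial (Fin 2) ℝ) = C 4 := C4.symm
      rw [this, pderiv_C]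
    simp [D, pderiv_mul, pderiv_X, pderiv_pow, e0, e1, e0', e1', e1'', L, n2, n3, n0, n4, C6]
    ring

lemma ref_backward {n : ℕ} {f g : MvPolynomial (Fin 2) ℝ} (hf : f.totalDegree ≤ n + 1)
    (hg : g.totalDegree ≤ n + 1) (ho : Orth f g) : ∃ p q r : MvPolynomial (Fin 2) ℝ,
      p.totalDegree ≤ n ∧ q.totalDegree ≤ n ∧ r.totalDegree ≤ n ∧
      f = pderiv 0 (X 0 * L * p) - D (X 0 * X 1 * r) ∧
      g = pderiv 1 (X 1 * L * q) + D (X 0 * X 1 * r) := by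
  obtain ⟨h1, h2, h3⟩ := ho
  obtain ⟨p, r, hp, hr, hfe⟩ := ref_step1 hf h1
  have hs : (X 0 * X 1 * r).totalDegree ≤ n + 1 + 1 :=
    td_mul (m := 2) (td_mul (td_X 0) (td_X 1) le_rfl) hr (by omega)
  obtain ⟨p', q, r', hp', hq, hr', e1, e2⟩ := ref_step2 (n := n) (g := g - D (X 0 * X 1 * r))
    (td_sub hg (td_D hs)) (by rw [I_sub, h2, I_D, sub_zero]) (by
      have : (g - D (X 0 * X 1 * r)) * X 0 = X 1 * pderiv 0 (X 0 * L * p)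
        - (X 0 + X 1) * D (X 0 * X 1 * r) - (f * X 1 - g * X 0) := by rw [hfe]; ring
      rw [this, I_sub, I_sub, h3, I_D_mul, I_p_mul]; simp)
  have eD : D (X 0 * X 1 * (r + r')) = D (X 0 * X 1 * r) + D (X 0 * X 1 * r') := by
    simp only [D, mul_add, map_add]; ring
  refine ⟨p + p', q, r + r', td_add hp hp', hq, td_add hr hr', ?_, ?_⟩
  · rw [eD, mul_add, map_add, e1, hfe]; ring
  · rw [eD]; linear_combination e2

lemma affine_form {f : MvPolynomial (Fin 2) ℝ} (hf : f.totalDegree ≤ 1) :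
    ∃ c d e : ℝ, f = C c + C d * X 0 + C e * X 1 := by
  obtain ⟨d, hd⟩ : ∃ d, pderiv 0 f = C d :=
    ⟨_, totalDegree_eq_zero_iff_eq_C.1 (Nat.le_zero.1 (td_pderiv 0 hf))⟩
  obtain ⟨e, he⟩ : ∃ d, pderiv 1 f = C d :=
    ⟨_, totalDegree_eq_zero_iff_eq_C.1 (Nat.le_zero.1 (td_pderiv 1 hf))⟩
  set h := f - C d * X 0 - C e * X 1 with hh
  have h0 : pderiv 0 h = 0 := by simp [hh, hd, pderiv_X]
  have h1 : pderiv 1 h = 0 := by simp [hh, he, pderiv_X]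
  have hi : ∀ i, pderiv i h = 0 := by intro i; fin_cases i; exacts [h0, h1]
  have hc : h = C (coeff 0 h) := by
    ext m
    rw [coeff_C]
    split_ifs with hm
    · rw [← hm]
    · obtain ⟨i, hmi⟩ : ∃ i, m i ≠ 0 := by
        by_contra hcon
        push Not at hcon
        exact hm (Finsupp.ext fun i => (hcon i).symm)
      have hs : Finsupp.single i 1 ≤ m := by
        rw [Finsupp.single_le_iff]; omega
      have := coeff_pderiv (i := i) h (m - Finsupp.single i 1)
      rw [hi i, tsub_add_cancel_of_le hs, coeff_zero] at this
      have hne : (((m - Finsupp.single i 1 : Fin 2 →₀ ℕ) i : ℕ) : ℝ) + 1 ≠ 0 := by positivity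
      rcases mul_eq_zero.1 this.symm with h | h
      · exact h
      · exact absurd h hne
  refine ⟨coeff 0 h, d, e, ?_⟩
  rw [← hc, hh]; ring

def dt (x : Fin 3 → (Fin 2 → ℝ)) : ℝ :=
  (x 1 0 - x 0 0) * (x 2 1 - x 0 1) - (x 1 1 - x 0 1) * (x 2 0 - x 0 0)

lemma dt_ne (x : Fin 3 → (Fin 2 → ℝ))
    (hnd : LinearIndependent ℝ ![x 1 - x 0, x 2 - x 0]) : dt x ≠ 0 := by
  intro h
  rw [LinearIndependent.pair_iff] at hnd
  unfold dt at h
  have e1 := hnd (x 2 1 - x 0 1) (-(x 1 1 - x 0 1)) (by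
    ext r; fin_cases r <;> simp <;> first | linear_combination h | ring)
  have e2 := hnd (x 2 0 - x 0 0) (-(x 1 0 - x 0 0)) (by
    ext r; fin_cases r <;> simp <;> first | linear_combination -h | ring)
  have e3 := hnd 1 0 (by
    ext r; fin_cases r
    · simp; linarith [e2.2]
    · simp; linarith [e1.2])
  exact one_ne_zero e3.1

lemma affine_ext (x : Fin 3 → (Fin 2 → ℝ)) (hx : dt x ≠ 0) {f : MvPolynomial (Fin 2) ℝ}
    (hf : f.totalDegree ≤ 1) (h : ∀ j, eval (x j) f = 0) : f = 0 := by
  obtain ⟨c, d, e, rfl⟩ := affine_form hf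
  have h0 := h 0
  have h1 := h 1
  have h2 := h 2
  simp at h0 h1 h2
  unfold dt at hx
  have hd : d = 0 := by
    refine (mul_eq_zero.1 (?_ : d * _ = 0)).resolve_right hx
    linear_combination (x 2 1 - x 0 1) * (h1 - h0) - (x 1 1 - x 0 1) * (h2 - h0)
  have he : e = 0 := by
    refine (mul_eq_zero.1 (?_ : e * _ = 0)).resolve_right hx
    linear_combination (x 1 0 - x 0 0) * (h2 - h0) - (x 2 0 - x 0 0) * (h1 - h0)
  subst hd he
  simp at h0
  simp [h0]

/-- affine parametrisation, on points -/
def aff (x : Fin 3 → (Fin 2 → ℝ)) (z : Fin 2 → ℝ) : Fin 2 → ℝ :=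
  fun r => x 0 r + (x 1 r - x 0 r) * z 0 + (x 2 r - x 0 r) * z 1

/-- affine parametrisation, on polynomials -/
noncomputable def Phi (x : Fin 3 → (Fin 2 → ℝ)) :
    MvPolynomial (Fin 2) ℝ →ₐ[ℝ] MvPolynomial (Fin 2) ℝ :=
  aeval (fun r => C (x 0 r) + C (x 1 r - x 0 r) * X 0 + C (x 2 r - x 0 r) * X 1)

lemma td_affine (c d e : ℝ) :
    (C c + C d * X 0 + C e * X 1 : MvPolynomial (Fin 2) ℝ).totalDegree ≤ 1 :=
  td_add (td_add (by simp) (td_Cmul _ (td_X 0))) (td_Cmul _ (td_X 1))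

lemma td_Phi (x : Fin 3 → (Fin 2 → ℝ)) (f) : (Phi x f).totalDegree ≤ f.totalDegree :=
  td_aeval _ (fun _ => td_affine _ _ _) f

lemma Phi_X (x : Fin 3 → (Fin 2 → ℝ)) (r : Fin 2) :
    Phi x (X r) = C (x 0 r) + C (x 1 r - x 0 r) * X 0 + C (x 2 r - x 0 r) * X 1 := by
  simp [Phi]

lemma Phi_C (x : Fin 3 → (Fin 2 → ℝ)) (c : ℝ) : Phi x (C c) = C c := by
  simp [Phi, algebraMap_eq]

lemma eval_Phi (x : Fin 3 → (Fin 2 → ℝ)) (f : MvPolynomial (Fin 2) ℝ) (z : Fin 2 → ℝ) :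
    eval z (Phi x f) = eval (aff x z) f := by
  induction f using MvPolynomial.induction_on with
  | C a => simp [Phi_C]
  | add p q hp hq => simp [hp, hq]
  | mul_X p i hp => rw [map_mul, map_mul, map_mul, hp, Phi_X, eval_X]; simp [aff]

lemma pderiv_Phi0 (x : Fin 3 → (Fin 2 → ℝ)) (f : MvPolynomial (Fin 2) ℝ) :
    pderiv 0 (Phi x f) = C (x 1 0 - x 0 0) * Phi x (pderiv 0 f)
      + C (x 1 1 - x 0 1) * Phi x (pderiv 1 f) := by
  induction f using MvPolynomial.induction_on with
  | C a => simp [Phi_C]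
  | add p q hp hq => simp only [map_add, hp, hq]; ring
  | mul_X p i hp =>
    rw [map_mul, pderiv_mul, pderiv_mul, pderiv_mul, hp, Phi_X]
    fin_cases i
    · simp [pderiv_X, Phi_X]; ring
    · simp [pderiv_X, Phi_X]; ring

lemma pderiv_Phi1 (x : Fin 3 → (Fin 2 → ℝ)) (f : MvPolynomial (Fin 2) ℝ) :
    pderiv 1 (Phi x f) = C (x 2 0 - x 0 0) * Phi x (pderiv 0 f)
      + C (x 2 1 - x 0 1) * Phi x (pderiv 1 f) := by
  induction f using MvPolynomial.induction_on with
  | C a => simp [Phi_C]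
  | add p q hp hq => simp only [map_add, hp, hq]; ring
  | mul_X p i hp =>
    rw [map_mul, pderiv_mul, pderiv_mul, pderiv_mul, hp, Phi_X]
    fin_cases i
    · simp [pderiv_X, Phi_X]; ring
    · simp [pderiv_X, Phi_X]; ring

def refv : Fin 3 → (Fin 2 → ℝ) := ![![0, 0], ![1, 0], ![0, 1]]

lemma dt_refv : dt refv ≠ 0 := by simp [dt, refv]

lemma aff_refv (x : Fin 3 → (Fin 2 → ℝ)) (j : Fin 3) : aff x (refv j) = x j := by
  ext r
  fin_cases j <;> simp [aff, refv]


lemma Phi_lam0 (x : Fin 3 → (Fin 2 → ℝ)) (lam : Fin 3 → MvPolynomial (Fin 2) ℝ)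
    (hdeg : ∀ i, (lam i).totalDegree ≤ 1)
    (hlam : ∀ i j, eval (x j) (lam i) = if i = j then (1 : ℝ) else 0) : Phi x (lam 0) = L := by
  rw [← sub_eq_zero]
  refine affine_ext refv dt_refv (td_sub ((td_Phi x _).trans (hdeg 0)) td_L) fun j => ?_
  rw [map_sub, eval_Phi, aff_refv, hlam]
  fin_cases j <;> simp [refv, L]

lemma Phi_lam1 (x : Fin 3 → (Fin 2 → ℝ)) (lam : Fin 3 → MvPolynomial (Fin 2) ℝ)
    (hdeg : ∀ i, (lam i).totalDegree ≤ 1)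
    (hlam : ∀ i j, eval (x j) (lam i) = if i = j then (1 : ℝ) else 0) : Phi x (lam 1) = X 0 := by
  rw [← sub_eq_zero]
  refine affine_ext refv dt_refv (td_sub ((td_Phi x _).trans (hdeg 1)) (td_X 0)) fun j => ?_
  rw [map_sub, eval_Phi, aff_refv, hlam]
  fin_cases j <;> simp [refv]

lemma Phi_lam2 (x : Fin 3 → (Fin 2 → ℝ)) (lam : Fin 3 → MvPolynomial (Fin 2) ℝ)
    (hdeg : ∀ i, (lam i).totalDegree ≤ 1)
    (hlam : ∀ i j, eval (x j) (lam i) = if i = j then (1 : ℝ) else 0) : Phi x (lam 2) = X 1 := by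
  rw [← sub_eq_zero]
  refine affine_ext refv dt_refv (td_sub ((td_Phi x _).trans (hdeg 2)) (td_X 1)) fun j => ?_
  rw [map_sub, eval_Phi, aff_refv, hlam]
  fin_cases j <;> simp [refv]

lemma Phi_Psi (x : Fin 3 → (Fin 2 → ℝ)) (lam : Fin 3 → MvPolynomial (Fin 2) ℝ)
    (hdeg : ∀ i, (lam i).totalDegree ≤ 1)
    (hlam : ∀ i j, eval (x j) (lam i) = if i = j then (1 : ℝ) else 0) (f : MvPolynomial (Fin 2) ℝ) : Phi x (aeval ![lam 1, lam 2] f) = f := by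
  induction f using MvPolynomial.induction_on with
  | C a => simp [algebraMap_eq, Phi_C]
  | add p q hp hq => rw [map_add, map_add, hp, hq]
  | mul_X p i hp =>
    rw [map_mul, map_mul, hp]
    fin_cases i
    · simp [Phi_lam1 x lam hdeg hlam]
    · simp [Phi_lam2 x lam hdeg hlam]

lemma Psi_Phi (x : Fin 3 → (Fin 2 → ℝ)) (lam : Fin 3 → MvPolynomial (Fin 2) ℝ)
    (hdeg : ∀ i, (lam i).totalDegree ≤ 1)
    (hlam : ∀ i j, eval (x j) (lam i) = if i = j then (1 : ℝ) else 0) (hx : dt x ≠ 0) (f : MvPolynomial (Fin 2) ℝ) :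
    aeval ![lam 1, lam 2] (Phi x f) = f := by
  induction f using MvPolynomial.induction_on with
  | C a => simp [algebraMap_eq, Phi_C]
  | add p q hp hq => rw [map_add, map_add, hp, hq]
  | mul_X p i hp =>
    rw [map_mul, map_mul, hp, Phi_X]
    congr 1
    rw [← sub_eq_zero]
    simp only [map_add, map_mul, aeval_X, aeval_C, algebraMap_eq]
    refine affine_ext x hx (td_sub (td_add (td_add (by simp) (td_Cmul _ (hdeg 1)))
      (td_Cmul _ (hdeg 2))) (td_X i)) fun j => ?_
    simp only [map_sub, map_add, map_mul, eval_C, eval_X, Matrix.cons_val_zero,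
      Matrix.cons_val_one, hlam]
    fin_cases j <;> simp

lemma td_Psi (lam : Fin 3 → MvPolynomial (Fin 2) ℝ)
    (hdeg : ∀ i, (lam i).totalDegree ≤ 1) (f : MvPolynomial (Fin 2) ℝ) :
    (aeval ![lam 1, lam 2] f).totalDegree ≤ f.totalDegree :=
  td_aeval _ (by intro i; fin_cases i; exacts [hdeg 1, hdeg 2]) f


lemma hull_eq (x : Fin 3 → (Fin 2 → ℝ)) : convexHull ℝ (Set.range x) = aff x '' Rf := by
  apply Set.Subset.antisymm
  · refine convexHull_min ?_ ?_
    · rintro _ ⟨j, rfl⟩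
      refine ⟨refv j, ?_, aff_refv x j⟩
      fin_cases j <;> simp [refv, Rf]
    · rintro _ ⟨z, ⟨h0, h1, h2⟩, rfl⟩ _ ⟨z', ⟨h0', h1', h2'⟩, rfl⟩ u v hu hv huv
      refine ⟨u • z + v • z', ⟨?_, ?_, ?_⟩, ?_⟩
      · simp; positivity
      · simp; positivity
      · simp; nlinarith
      · ext r
        simp [aff]
        linear_combination (-x 0 r) * huv
  · rintro _ ⟨z, ⟨h0, h1, h2⟩, rfl⟩
    have := (convex_convexHull ℝ (Set.range x)).sum_mem (t := Finset.univ)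
      (w := ![1 - z 0 - z 1, z 0, z 1]) (z := x)
      (by intro i _; fin_cases i <;> simp <;> linarith)
      (by simp [Fin.sum_univ_three]; ring)
      (fun i _ => subset_convexHull ℝ _ ⟨i, rfl⟩)
    convert this using 1
    ext r
    simp [Fin.sum_univ_three, aff]
    ring

lemma int_aff (x : Fin 3 → (Fin 2 → ℝ)) (hx : dt x ≠ 0) (h : (Fin 2 → ℝ) → ℝ) :
    ∫ y in aff x '' Rf, h y = |dt x| * ∫ z in Rf, h (aff x z) := by
  set M : Matrix (Fin 2) (Fin 2) ℝ :=
    !![x 1 0 - x 0 0, x 2 0 - x 0 0; x 1 1 - x 0 1, x 2 1 - x 0 1] with hM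
  have haff : ∀ z, aff x z = x 0 + Matrix.toLin' M z := by
    intro z
    ext r
    fin_cases r <;> simp [aff, hM, Matrix.mulVec, dotProduct, Fin.sum_univ_two] <;> ring
  have hdet : M.det = dt x := by rw [hM, Matrix.det_fin_two_of, dt]; ring
  have hder : ∀ z ∈ Rf, HasFDerivWithinAt (aff x) (Matrix.toLin' M).toContinuousLinearMap Rf z := by
    intro z _
    have : aff x = fun z => x 0 + (Matrix.toLin' M).toContinuousLinearMap z := by
      funext z; rw [haff]; rfl
    rw [this]
    exact (((Matrix.toLin' M).toContinuousLinearMap.hasFDerivAt).const_add (x 0)).hasFDerivWithinAt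
  have hinj : Set.InjOn (aff x) Rf := by
    intro z _ z' _ hz
    rw [haff, haff] at hz
    have hz := add_left_cancel hz
    have hu : IsUnit M := (Matrix.isUnit_iff_isUnit_det M).2 (by rw [hdet]; exact hx.isUnit)
    exact Matrix.mulVec_injective_iff_isUnit.2 hu (by simpa using hz)
  rw [integral_image_eq_integral_abs_det_fderiv_smul volume Rf_closed.measurableSet hder hinj]
  have : (Matrix.toLin' M).toContinuousLinearMap.det = dt x := by
    rw [← hdet, ← LinearMap.det_toLin']; rfl
  rw [this]
  simp only [smul_eq_mul]
  exact integral_const_mul _ _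

lemma int_poly_Delta (x : Fin 3 → (Fin 2 → ℝ)) (hx : dt x ≠ 0) (f : MvPolynomial (Fin 2) ℝ) :
    (∫ y in convexHull ℝ (Set.range x), eval y f) = 0 ↔ I (Phi x f) = 0 := by
  rw [hull_eq, int_aff x hx]
  simp [I, eval_Phi, hx]

/-- the explicit form of the divergence in reference coordinates -/
lemma div_expr (x : Fin 3 → (Fin 2 → ℝ)) (lam : Fin 3 → MvPolynomial (Fin 2) ℝ)
    (hdeg : ∀ i, (lam i).totalDegree ≤ 1)
    (hlam : ∀ i j, eval (x j) (lam i) = if i = j then (1 : ℝ) else 0)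
    (T : Fin 3 → Fin 3 → Matrix (Fin 2) (Fin 2) (MvPolynomial (Fin 2) ℝ))
    (hT : ∀ i j, T i j = (vecMulVec (x j - x i) (x j - x i)).map C)
    (p : Fin 3 → Fin 3 → MvPolynomial (Fin 2) ℝ) (r : Fin 2) :
    Phi x (pderiv 0 (((lam 0 * lam 1 * p 0 1) • T 0 1
                    + (lam 0 * lam 2 * p 0 2) • T 0 2
                    + (lam 1 * lam 2 * p 1 2) • T 1 2) r 0)
                + pderiv 1 (((lam 0 * lam 1 * p 0 1) • T 0 1
                    + (lam 0 * lam 2 * p 0 2) • T 0 2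
                    + (lam 1 * lam 2 * p 1 2) • T 1 2) r 1)) =
    C (x 1 r - x 0 r) * (pderiv 0 (X 0 * L * Phi x (p 0 1)) - D (X 0 * X 1 * Phi x (p 1 2)))
    + C (x 2 r - x 0 r) * (pderiv 1 (X 1 * L * Phi x (p 0 2)) + D (X 0 * X 1 * Phi x (p 1 2))) := by
  have e1 : X 0 * L * Phi x (p 0 1) = Phi x (lam 0 * lam 1 * p 0 1) := by
    rw [map_mul, map_mul, Phi_lam0 x lam hdeg hlam, Phi_lam1 x lam hdeg hlam]; ring
  have e2 : X 1 * L * Phi x (p 0 2) = Phi x (lam 0 * lam 2 * p 0 2) := by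
    rw [map_mul, map_mul, Phi_lam0 x lam hdeg hlam, Phi_lam2 x lam hdeg hlam]; ring
  have e3 : X 0 * X 1 * Phi x (p 1 2) = Phi x (lam 1 * lam 2 * p 1 2) := by
    rw [map_mul, map_mul, Phi_lam1 x lam hdeg hlam, Phi_lam2 x lam hdeg hlam]
  rw [e1, e2, e3]
  generalize lam 0 * lam 1 * p 0 1 = A
  generalize lam 0 * lam 2 * p 0 2 = B
  generalize lam 1 * lam 2 * p 1 2 = E
  have key : ∀ (F : MvPolynomial (Fin 2) ℝ) (u w : ℝ) (i : Fin 2),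
      pderiv i (F * C (u * w)) = C u * C w * pderiv i F := by
    intro F u w i
    rw [mul_comm, pderiv_C_mul, C_mul]
  simp only [hT, Matrix.add_apply, Matrix.smul_apply, Matrix.map_apply, vecMulVec_apply,
    Pi.sub_apply, smul_eq_mul, map_add, map_mul, key, D, pderiv_Phi0, pderiv_Phi1, Phi_C]
  have h1 : pderiv (0 : Fin 2) (0 : MvPolynomial (Fin 2) ℝ) = 0 := map_zero _
  simp only [pderiv_mul, pderiv_C, map_add, map_mul, Phi_C, C_sub, map_zero, mul_zero, add_zero,
    zero_mul, map_sub, sub_zero]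
  ring

end DivBubble

open DivBubble in
/-- On a nondegenerate triangle, the divergence operator maps the bubble space
`H_{Δ,k,b}` onto the orthogonal complement of the rigid motions
`span{(1,0),(0,1),(y,−x)}` inside `P_{k−1}(Δ;ℝ²)`. -/
theorem div_bubble_space_eq_rigid_motion_orthogonal
    (k : ℕ) (hk : 2 ≤ k)
    (x : Fin 3 → (Fin 2 → ℝ))
    (hnd : LinearIndependent ℝ ![x 1 - x 0, x 2 - x 0])
    (lam : Fin 3 → MvPolynomial (Fin 2) ℝ)
    (hdeg : ∀ i, (lam i).totalDegree ≤ 1)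
    (hlam : ∀ i j, eval (x j) (lam i) = if i = j then (1 : ℝ) else 0)
    (Δ : Set (Fin 2 → ℝ)) (hΔ : Δ = convexHull ℝ (Set.range x))
    (T : Fin 3 → Fin 3 → Matrix (Fin 2) (Fin 2) (MvPolynomial (Fin 2) ℝ))
    (hT : ∀ i j, T i j = (vecMulVec (x j - x i) (x j - x i)).map C) :
    {v : Fin 2 → MvPolynomial (Fin 2) ℝ |
        ∃ p : Fin 3 → Fin 3 → MvPolynomial (Fin 2) ℝ,
          (∀ i j, (p i j).totalDegree ≤ k - 2) ∧
          ∀ r : Fin 2,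
            v r = pderiv 0 (((lam 0 * lam 1 * p 0 1) • T 0 1
                    + (lam 0 * lam 2 * p 0 2) • T 0 2
                    + (lam 1 * lam 2 * p 1 2) • T 1 2) r 0)
                + pderiv 1 (((lam 0 * lam 1 * p 0 1) • T 0 1
                    + (lam 0 * lam 2 * p 0 2) • T 0 2
                    + (lam 1 * lam 2 * p 1 2) • T 1 2) r 1)}
      =
    {v : Fin 2 → MvPolynomial (Fin 2) ℝ |
        (∀ r, (v r).totalDegree ≤ k - 1) ∧
        (∫ y in Δ, eval y (v 0)) = 0 ∧
        (∫ y in Δ, eval y (v 1)) = 0 ∧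
        (∫ y in Δ, (eval y (v 0) * y 1 - eval y (v 1) * y 0)) = 0} := by
  have hx := dt_ne x hnd
  obtain ⟨n, rfl⟩ : ∃ n, k = n + 2 := ⟨k - 2, by omega⟩
  have hn2 : n + 2 - 2 = n := by omega
  have hn1 : n + 2 - 1 = n + 1 := by omega
  rw [hn2, hn1, hΔ]
  -- the third moment in reference coordinates
  have hrot : ∀ v : Fin 2 → MvPolynomial (Fin 2) ℝ,
      (∫ y in convexHull ℝ (Set.range x), (eval y (v 0) * y 1 - eval y (v 1) * y 0)) = 0 ↔
        I (Phi x (v 0 * X 1 - v 1 * X 0)) = 0 := by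
    intro v
    rw [← int_poly_Delta x hx]
    simp
  have hcomb : ∀ (v : Fin 2 → MvPolynomial (Fin 2) ℝ) (f g : MvPolynomial (Fin 2) ℝ),
      (∀ r, Phi x (v r) = C (x 1 r - x 0 r) * f + C (x 2 r - x 0 r) * g) →
      I (Phi x (v 0 * X 1 - v 1 * X 0)) =
        ((x 1 0 - x 0 0) * x 0 1 - (x 1 1 - x 0 1) * x 0 0) * I f +
        ((x 2 0 - x 0 0) * x 0 1 - (x 2 1 - x 0 1) * x 0 0) * I g +
        dt x * I (f * X 1 - g * X 0) := by
    intro v f g h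
    rw [← I_C, ← I_C, ← I_C, ← I_add, ← I_add]
    congr 1
    rw [map_sub, map_mul, map_mul, h, h, Phi_X, Phi_X, dt]
    simp only [C_sub, C_mul]
    ring
  ext v
  simp only [Set.mem_ofPred_eq]
  rw [int_poly_Delta x hx, int_poly_Delta x hx, hrot]
  constructor
  · rintro ⟨p, hp, hv⟩
    obtain ⟨f, g, hPv, hf, hg, o1, o2, o3⟩ : ∃ f g : MvPolynomial (Fin 2) ℝ,
        (∀ r, Phi x (v r) = C (x 1 r - x 0 r) * f + C (x 2 r - x 0 r) * g) ∧
        f.totalDegree ≤ n + 1 ∧ g.totalDegree ≤ n + 1 ∧ Orth f g :=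
      ⟨_, _, fun r => (congrArg (Phi x) (hv r)).trans (div_expr x lam hdeg hlam T hT p r),
        ref_forward (n := n) ((td_Phi x _).trans (hp 0 1))
          ((td_Phi x _).trans (hp 0 2)) ((td_Phi x _).trans (hp 1 2)) rfl rfl⟩
    refine ⟨fun r => ?_, ?_, ?_, ?_⟩
    · rw [← Psi_Phi x lam hdeg hlam hx (v r)]
      refine (td_Psi lam hdeg _).trans ?_
      rw [hPv]
      exact td_add (td_Cmul _ hf) (td_Cmul _ hg)
    · rw [hPv, I_add, I_C, I_C, o1, o2]; simp
    · rw [hPv, I_add, I_C, I_C, o1, o2]; simp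
    · rw [hcomb v _ _ hPv, o1, o2, o3]; simp
  · rintro ⟨hd, m0, m1, m2⟩
    set f : MvPolynomial (Fin 2) ℝ := C ((x 2 1 - x 0 1) / dt x) * Phi x (v 0)
      - C ((x 2 0 - x 0 0) / dt x) * Phi x (v 1) with hf
    set g : MvPolynomial (Fin 2) ℝ := C ((x 1 0 - x 0 0) / dt x) * Phi x (v 1)
      - C ((x 1 1 - x 0 1) / dt x) * Phi x (v 0) with hg
    have hPv : ∀ r, Phi x (v r) = C (x 1 r - x 0 r) * f + C (x 2 r - x 0 r) * g := by
      have hC : (C (dt x) : MvPolynomial (Fin 2) ℝ) * C ((dt x)⁻¹) = 1 := by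
        rw [← C_mul, mul_inv_cancel₀ hx, C_1]
      rw [hf, hg]
      simp only [div_eq_mul_inv]
      have hdtC : (C (dt x) : MvPolynomial (Fin 2) ℝ) =
        C (x 1 0 - x 0 0) * C (x 2 1 - x 0 1) - C (x 1 1 - x 0 1) * C (x 2 0 - x 0 0) := by
        rw [dt, C_sub, C_mul, C_mul]
      rw [hdtC] at hC
      simp only [C_mul]
      intro r
      fin_cases r
      · simp only [Fin.zero_eta]
        linear_combination (-Phi x (v 0)) * hC
      · simp only [Fin.mk_one]
        linear_combination (-Phi x (v 1)) * hC
    have o1 : I f = 0 := by rw [hf, I_sub, I_C, I_C, m0, m1]; simp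
    have o2 : I g = 0 := by rw [hg, I_sub, I_C, I_C, m0, m1]; simp
    have o3 : I (f * X 1 - g * X 0) = 0 := by
      rw [hcomb v f g hPv, o1, o2] at m2
      simpa [hx] using m2
    have hdP : ∀ r, (Phi x (v r)).totalDegree ≤ n + 1 := fun r => (td_Phi x _).trans (hd r)
    obtain ⟨p, q, r, hp, hq, hr, ef, eg⟩ := ref_backward (n := n)
      (td_sub (td_Cmul _ (hdP 0)) (td_Cmul _ (hdP 1)))
      (td_sub (td_Cmul _ (hdP 1)) (td_Cmul _ (hdP 0))) ⟨o1, o2, o3⟩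
    refine ⟨fun i j => aeval ![lam 1, lam 2] (if i = 0 then (if j = 1 then p else q) else r),
      fun i j => (td_Psi lam hdeg _).trans (by split_ifs <;> assumption), fun s => ?_⟩
    have hinj : Function.Injective (Phi x) := fun a b hab => by
      rw [← Psi_Phi x lam hdeg hlam hx a, hab, Psi_Phi x lam hdeg hlam hx b]
    apply hinj
    rw [div_expr x lam hdeg hlam T hT (fun i j => aeval ![lam 1, lam 2]
      (if i = 0 then (if j = 1 then p else q) else r)) s, hPv s]
    simp only [Phi_Psi x lam hdeg hlam]
    simp only [if_true, one_ne_zero, if_false, Fin.reduceEq]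
    rw [← ef, ← eg]
end

section
/- Let k ≥ 1 and let K be a nondegenerate tetrahedron. The space Σ_k^{nc}(K) = {τ = Σ_{1≤i<j≤4} p_{ij} t_{i,j}t_{i,j}^T : p_{ij} ∈ P_{ij}}, with P_{ij} = P_k(K;ℝ) + (λ_i−λ_j)·span{λ_ℓ^aλ_m^b : a+b=k} + λ_iλ_j P_{k−1}(K;ℝ), is unisolvent with respect to the degrees of freedom: (1) ∫_F τν·v ds for v ∈ P_k(F;ℝ³) on each face F ⊂ ∂K, and (2) ∫_K τ : p dx for p ∈ H_{K,k+1,b} = Σ_{1≤i<j≤4} λ_iλ_j P_{k−1}(K;ℝ) t_{i,j}t_{i,j}^T. That is, if τ ∈ Σ_k^{nc}(K) annihilates all these functionals then τ = 0. -/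
open Matrix MvPolynomial MeasureTheory

/-- Substituting polynomials of degree at most one does not raise the degree. -/
lemma aux_totalDegree_aeval_le {n m : ℕ} (f : Fin n → MvPolynomial (Fin m) ℝ)
    (hf : ∀ i, (f i).totalDegree ≤ 1) (p : MvPolynomial (Fin n) ℝ) :
    (aeval f p).totalDegree ≤ p.totalDegree := by
  rw [aeval_def, eval₂_eq']
  refine totalDegree_finsetSum_le fun d hd => ?_
  refine (totalDegree_mul _ _).trans ?_
  have h1 : (algebraMap ℝ (MvPolynomial (Fin m) ℝ) (coeff d p)).totalDegree = 0 := by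
    rw [algebraMap_eq]; exact totalDegree_C _
  rw [h1, zero_add]
  refine (totalDegree_finsetProd _ _).trans ?_
  have h2 := le_totalDegree hd
  rw [Finsupp.sum_fintype _ _ (fun _ => rfl)] at h2
  refine le_trans (Finset.sum_le_sum fun i _ => ?_) h2
  calc (f i ^ d i).totalDegree ≤ d i * (f i).totalDegree := totalDegree_pow _ _
    _ ≤ d i * 1 := Nat.mul_le_mul_left _ (hf i)
    _ = d i := mul_one _

/-- A polynomial vanishing on a coordinate hyperplane is divisible by the coordinate. -/
lemma aux_X_dvd {n : ℕ} (i : Fin n) (p : MvPolynomial (Fin n) ℝ)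
    (h : ∀ w : Fin n → ℝ, w i = 0 → eval w p = 0) : X i ∣ p := by
  have key : ∀ q : MvPolynomial (Fin n) ℝ,
      X i ∣ q - aeval (Function.update (X : Fin n → MvPolynomial (Fin n) ℝ) i 0) q := by
    intro q
    induction q using MvPolynomial.induction_on with
    | C a => simp [algebraMap_eq]
    | add p q hp hq =>
      have := dvd_add hp hq
      rw [map_add]
      convert this using 1
      ring
    | mul_X p j hp =>
      rw [map_mul, aeval_X]
      by_cases hj : j = i
      · subst hj; simp
      · rw [Function.update_of_ne hj, ← sub_mul]
        exact hp.mul_right _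
  have h0 : aeval (Function.update (X : Fin n → MvPolynomial (Fin n) ℝ) i 0) p = 0 := by
    apply MvPolynomial.funext
    intro w
    rw [map_zero, ← h (Function.update w i 0) (by simp)]
    have : (eval w) ((aeval (Function.update (X : Fin n → MvPolynomial (Fin n) ℝ) i 0)) p)
        = ((aeval w).comp (aeval (Function.update (X : Fin n → MvPolynomial (Fin n) ℝ) i 0))) p := by
      simp
    rw [this, comp_aeval, ← coe_aeval_eq_eval]
    change _ = aeval (Function.update w i 0) p
    congr 2
    funext j
    by_cases hj : j = i
    · subst hj; simp
    · simp [Function.update_of_ne hj]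
  have := key p
  rwa [h0, sub_zero] at this

/-- A nonnegative polynomial with zero integral over a compact set with interior is zero. -/
lemma aux_integral_zero {n : ℕ} (S : Set (Fin n → ℝ)) (hS : IsCompact S)
    (hi : (interior S).Nonempty) (f : MvPolynomial (Fin n) ℝ)
    (h0 : ∀ y ∈ S, 0 ≤ eval y f) (hint : ∫ y in S, eval y f = 0) : f = 0 := by
  have hc : Continuous fun y => eval y f := MvPolynomial.continuous_eval f
  have hae : (0 : (Fin n → ℝ) → ℝ) ≤ᵐ[volume.restrict S] fun y => eval y f :=
    (ae_restrict_iff' hS.measurableSet).2 (Filter.Eventually.of_forall h0)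
  rw [setIntegral_eq_zero_iff_of_nonneg_ae hae (hc.continuousOn.integrableOn_compact hS)] at hint
  have h1 := ae_restrict_of_ae_restrict_of_subset (interior_subset (s := S)) hint
  have h2 := Measure.eqOn_open_of_ae_eq h1 isOpen_interior hc.continuousOn continuousOn_const
  obtain ⟨y, hy⟩ := hi
  obtain ⟨ε, hε, hb⟩ := Metric.isOpen_iff.1 isOpen_interior y hy
  refine MvPolynomial.funext_set (fun i => Metric.ball (y i) ε) (fun i => ?_) (fun z hz => ?_)
  · rw [Real.ball_eq_Ioo]
    exact Set.Ioo_infinite (by linarith)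
  · rw [map_zero]
    refine h2 (hb ?_)
    rw [Metric.mem_ball, dist_pi_lt_iff hε]
    intro i
    exact hz i trivial

/-- Degree one polynomials are affine functions. -/
lemma aux_affine {n : ℕ} (f : MvPolynomial (Fin n) ℝ) (hf : f.totalDegree ≤ 1) :
    ∃ (c : ℝ) (g : Fin n → ℝ), ∀ y, eval y f = c + g ⬝ᵥ y := by
  have key : ∀ s : Finset (Fin n →₀ ℕ), s ⊆ f.support →
      ∃ (c : ℝ) (g : Fin n → ℝ), ∀ y, ∑ d ∈ s, coeff d f * ∏ i, y i ^ d i = c + g ⬝ᵥ y := by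
    intro s
    induction s using Finset.induction_on with
    | empty => exact fun _ => ⟨0, 0, by simp⟩
    | insert d s hds ih =>
      intro hs
      obtain ⟨c, g, hcg⟩ := ih ((Finset.subset_insert _ _).trans hs)
      have hd := (le_totalDegree (hs (Finset.mem_insert_self d s))).trans hf
      rw [Finsupp.sum_fintype _ _ (fun _ => rfl)] at hd
      by_cases h0 : ∀ i, d i = 0
      · refine ⟨coeff d f + c, g, fun y => ?_⟩
        rw [Finset.sum_insert hds, hcg]
        simp [h0]; ring
      · push Not at h0
        obtain ⟨i, hi⟩ := h0
        have hsplit := Finset.add_sum_erase Finset.univ (fun i => d i) (Finset.mem_univ i)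
        have hi1 : d i = 1 := by omega
        have hz : ∑ j ∈ Finset.univ.erase i, d j = 0 := by omega
        rw [Finset.sum_eq_zero_iff] at hz
        refine ⟨c, g + coeff d f • Pi.single i 1, fun y => ?_⟩
        rw [Finset.sum_insert hds, hcg, ← Finset.mul_prod_erase _ _ (Finset.mem_univ i),
          Finset.prod_eq_one (fun j hj => by rw [hz j hj, pow_zero]), hi1]
        simp [add_dotProduct]; ring
  obtain ⟨c, g, h⟩ := key _ (Finset.Subset.refl _)
  exact ⟨c, g, fun y => by rw [eval_eq', h]⟩

/-- The reference triangle. -/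
def auxT : Set (Fin 2 → ℝ) := {w | 0 ≤ w 0 ∧ 0 ≤ w 1 ∧ w 0 + w 1 ≤ 1}

lemma auxT_compact : IsCompact auxT := by
  refine (isCompact_univ_pi (fun _ : Fin 2 => isCompact_Icc (a := (0 : ℝ)) (b := 1))).of_isClosed_subset
    ?_ ?_
  · have : auxT = {w | 0 ≤ w 0} ∩ ({w | 0 ≤ w 1} ∩ {w | w 0 + w 1 ≤ 1}) := rfl
    rw [this]
    refine IsClosed.inter ?_ (IsClosed.inter ?_ ?_)
    · exact isClosed_le continuous_const (continuous_apply _)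
    · exact isClosed_le continuous_const (continuous_apply _)
    · exact isClosed_le (by fun_prop) continuous_const
  · rintro w ⟨h0, h1, h2⟩ i -
    fin_cases i
    · exact ⟨h0, by simp only [Fin.zero_eta]; linarith⟩
    · exact ⟨h1, by simp only [Fin.mk_one]; linarith⟩

lemma auxT_interior : (interior auxT).Nonempty := by
  refine ⟨fun _ => 1 / 4, ?_⟩
  rw [mem_interior]
  refine ⟨{w | 0 < w 0} ∩ ({w | 0 < w 1} ∩ {w | w 0 + w 1 < 1}), ?_, ?_, ?_⟩
  · rintro w ⟨h0, h1, h2⟩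
    exact ⟨le_of_lt h0, le_of_lt h1, le_of_lt h2⟩
  · refine IsOpen.inter ?_ (IsOpen.inter ?_ ?_)
    · exact isOpen_lt continuous_const (continuous_apply _)
    · exact isOpen_lt continuous_const (continuous_apply _)
    · exact isOpen_lt (by fun_prop) continuous_const
  · refine ⟨?_, ?_, ?_⟩ <;> simp <;> norm_num

/-- The two-face argument on the reference triangle. -/
lemma aux_face_core (k : ℕ) (Q₁ Q₂ : MvPolynomial (Fin 2) ℝ)
    (h₁ : ∀ u : MvPolynomial (Fin 2) ℝ, u.totalDegree ≤ k →
      ∫ w in auxT, eval w (Q₁ * u) = 0)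
    (h₂ : ∀ u : MvPolynomial (Fin 2) ℝ, u.totalDegree ≤ k →
      ∫ w in auxT, eval w (Q₂ * u) = 0)
    (hd : Q₁.totalDegree ≤ k + 1) (hs : (Q₁ + Q₂).totalDegree ≤ k)
    (he : ∀ w : Fin 2 → ℝ, w 0 = 0 → eval w Q₁ = eval w Q₂) : Q₁ = 0 ∧ Q₂ = 0 := by
  have hI : ∀ f : MvPolynomial (Fin 2) ℝ, IntegrableOn (fun w => eval w f) auxT :=
    fun f => (MvPolynomial.continuous_eval f).continuousOn.integrableOn_compact auxT_compact
  have hsum : Q₁ + Q₂ = 0 := by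
    have : (Q₁ + Q₂) * (Q₁ + Q₂) = 0 := by
      refine aux_integral_zero auxT auxT_compact auxT_interior _ (fun y _ => ?_) ?_
      · rw [map_mul]; exact mul_self_nonneg _
      · have := integral_add (hI (Q₁ * (Q₁ + Q₂))) (hI (Q₂ * (Q₁ + Q₂)))
        rw [h₁ _ hs, h₂ _ hs, add_zero] at this
        rw [← this]
        congr 1; funext w; simp only [map_mul, map_add]; ring
    exact mul_self_eq_zero.1 this
  have hQ₂ : Q₂ = -Q₁ := (neg_eq_of_add_eq_zero_right hsum).symm
  have hdvd : (X 0 : MvPolynomial (Fin 2) ℝ) ∣ Q₁ := by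
    apply aux_X_dvd
    intro w hw
    have := he w hw
    rw [hQ₂, map_neg] at this
    linarith
  obtain ⟨h, hh⟩ := hdvd
  have h0 : h = 0 := by
    by_contra hne
    have hdeg : h.totalDegree ≤ k := by
      rw [hh, totalDegree_mul_of_isDomain (X_ne_zero _) hne, totalDegree_X] at hd
      omega
    have : X 0 * h * h = 0 := by
      refine aux_integral_zero auxT auxT_compact auxT_interior _ (fun y hy => ?_) ?_
      · rw [map_mul, map_mul, eval_X, mul_assoc]
        exact mul_nonneg hy.1 (mul_self_nonneg _)
      · rw [← hh]; exact h₁ _ hdeg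
    rcases mul_eq_zero.1 this with h' | h'
    · rcases mul_eq_zero.1 h' with h' | h'
      · exact X_ne_zero _ h'
      · exact hne h'
    · exact hne h'
  have hQ₁ : Q₁ = 0 := by rw [hh, h0, mul_zero]
  exact ⟨hQ₁, by rw [hQ₂, hQ₁, neg_zero]⟩

lemma aux_eval_aeval {n m : ℕ} (f : Fin n → MvPolynomial (Fin m) ℝ) (w : Fin m → ℝ)
    (p : MvPolynomial (Fin n) ℝ) :
    eval w (aeval f p) = eval (fun i => eval w (f i)) p := by
  induction p using MvPolynomial.induction_on with
  | C a => simp [algebraMap_eq]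
  | add p q hp hq => rw [map_add, map_add, map_add, hp, hq]
  | mul_X p j hp => rw [map_mul, map_mul, map_mul, hp, aeval_X, eval_X]

/-- Parametrization of a face by the reference triangle. -/
noncomputable def auxPar (a b c : Fin 3 → ℝ) : Fin 3 → MvPolynomial (Fin 2) ℝ :=
  fun r => C (a r) + X 0 * C (b r - a r) + X 1 * C (c r - a r)

lemma auxPar_degree (a b c : Fin 3 → ℝ) (r : Fin 3) : (auxPar a b c r).totalDegree ≤ 1 := by
  unfold auxPar
  refine (totalDegree_add _ _).trans (max_le ((totalDegree_add _ _).trans (max_le ?_ ?_)) ?_)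
  · simp
  · exact (totalDegree_mul _ _).trans (by rw [totalDegree_X, totalDegree_C])
  · exact (totalDegree_mul _ _).trans (by rw [totalDegree_X, totalDegree_C])

lemma auxPar_eval (a b c : Fin 3 → ℝ) (w : Fin 2 → ℝ) (p : MvPolynomial (Fin 3) ℝ) :
    eval w (aeval (auxPar a b c) p) = eval (a + w 0 • (b - a) + w 1 • (c - a)) p := by
  rw [aux_eval_aeval]
  congr 2
  funext r
  simp [auxPar]

/-- Gradients of the barycentric coordinates. -/
lemma aux_grad (x : Fin 4 → (Fin 3 → ℝ)) (lam : Fin 4 → MvPolynomial (Fin 3) ℝ)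
    (hdeg : ∀ i, (lam i).totalDegree ≤ 1)
    (hlam : ∀ i j, eval (x j) (lam i) = if i = j then (1 : ℝ) else 0) :
    ∃ g : Fin 4 → Fin 3 → ℝ,
      (∀ i y z, eval (y + z) (lam i) = eval y (lam i) + g i ⬝ᵥ z) ∧
      (∀ i a b, g i ⬝ᵥ (x b - x a) = (if i = b then (1 : ℝ) else 0) - if i = a then 1 else 0) := by
  choose c g hcg using fun i => aux_affine (lam i) (hdeg i)
  refine ⟨g, fun i y z => ?_, fun i a b => ?_⟩
  · rw [hcg, hcg, dotProduct_add, add_assoc]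
  · rw [← hlam i b, ← hlam i a, hcg, hcg, dotProduct_sub]; ring

/-- Barycentric representation of points. -/
lemma aux_bary (x : Fin 4 → (Fin 3 → ℝ))
    (hnd : LinearIndependent ℝ ![x 1 - x 0, x 2 - x 0, x 3 - x 0])
    (lam : Fin 4 → MvPolynomial (Fin 3) ℝ)
    (hdeg : ∀ i, (lam i).totalDegree ≤ 1)
    (hlam : ∀ i j, eval (x j) (lam i) = if i = j then (1 : ℝ) else 0) (y : Fin 3 → ℝ) :
    ∑ i, eval y (lam i) • x i = y ∧ ∑ i, eval y (lam i) = 1 := by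
  obtain ⟨g, hg, hgx⟩ := aux_grad x lam hdeg hlam
  have hspan := hnd.span_eq_top_of_card_eq_finrank (by simp)
  have hy : y - x 0 ∈ Submodule.span ℝ (Set.range ![x 1 - x 0, x 2 - x 0, x 3 - x 0]) := by
    rw [hspan]; trivial
  obtain ⟨c, hc⟩ := (Submodule.mem_span_range_iff_exists_fun ℝ).1 hy
  have hy' : y = x 0 + (c 0 • (x 1 - x 0) + c 1 • (x 2 - x 0) + c 2 • (x 3 - x 0)) := by
    rw [Fin.sum_univ_three] at hc
    simp only [cons_val_zero, cons_val_one, cons_val] at hc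
    rw [hc]; abel
  have hv : ∀ i, eval y (lam i) = (if i = 0 then (1 : ℝ) else 0)
      + (c 0 * (g i ⬝ᵥ (x 1 - x 0)) + c 1 * (g i ⬝ᵥ (x 2 - x 0)) + c 2 * (g i ⬝ᵥ (x 3 - x 0))) := by
    intro i
    conv_lhs => rw [hy']
    rw [hg, hlam, dotProduct_add, dotProduct_add, dotProduct_smul, dotProduct_smul,
      dotProduct_smul]
    simp only [smul_eq_mul]
  simp only [hgx] at hv
  constructor
  · rw [Fin.sum_univ_four, hv, hv, hv, hv]
    conv_rhs => rw [hy']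
    funext r
    simp
    ring
  · rw [Fin.sum_univ_four, hv, hv, hv, hv]
    simp
    ring

lemma aux_sum4 {A : Type*} [AddCommMonoid A] (f : Fin 4 → A) (i j l m : Fin 4)
    (hij : i ≠ j) (hil : i ≠ l) (him : i ≠ m) (hjl : j ≠ l) (hjm : j ≠ m) (hlm : l ≠ m) :
    ∑ a, f a = f i + f j + f m + f l := by
  have : (Finset.univ : Finset (Fin 4)) = {i, j, m, l} := by
    symm
    apply Finset.eq_univ_of_card
    rw [Finset.card_insert_of_notMem (by simp [*]), Finset.card_insert_of_notMem (by simp [*]),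
      Finset.card_insert_of_notMem (by simp [hlm.symm]), Finset.card_singleton, Fintype.card_fin]
  rw [this, Finset.sum_insert (by simp [*]), Finset.sum_insert (by simp [*]),
    Finset.sum_insert (by simp [hlm.symm]), Finset.sum_singleton]
  simp only [add_assoc]

/-- A polynomial vanishing on the faces opposite to `i` and `j` is `λ_i λ_j r`. -/
lemma aux_divis (k : ℕ) (hk : 1 ≤ k) (x : Fin 4 → (Fin 3 → ℝ))
    (hnd : LinearIndependent ℝ ![x 1 - x 0, x 2 - x 0, x 3 - x 0])
    (lam : Fin 4 → MvPolynomial (Fin 3) ℝ)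
    (hdeg : ∀ i, (lam i).totalDegree ≤ 1)
    (hlam : ∀ i j, eval (x j) (lam i) = if i = j then (1 : ℝ) else 0)
    (i j l m : Fin 4)
    (hij : i ≠ j) (hil : i ≠ l) (him : i ≠ m) (hjl : j ≠ l) (hjm : j ≠ m) (hlm : l ≠ m)
    (p : MvPolynomial (Fin 3) ℝ) (hp : p.totalDegree ≤ k + 1)
    (hi : aeval (auxPar (x l) (x j) (x m)) p = 0)
    (hj : aeval (auxPar (x l) (x i) (x m)) p = 0) :
    ∃ r : MvPolynomial (Fin 3) ℝ, r.totalDegree ≤ k - 1 ∧ p = lam i * lam j * r := by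
  let f : Fin 3 → MvPolynomial (Fin 3) ℝ := fun r =>
    C (x l r) + X 0 * C (x i r - x l r) + X 1 * C (x j r - x l r) + X 2 * C (x m r - x l r)
  have hf : ∀ r, (f r).totalDegree ≤ 1 := by
    intro r
    refine (totalDegree_add _ _).trans (max_le ((totalDegree_add _ _).trans (max_le
      ((totalDegree_add _ _).trans (max_le ?_ ?_)) ?_)) ?_)
    · simp
    · exact (totalDegree_mul _ _).trans (by rw [totalDegree_X, totalDegree_C])
    · exact (totalDegree_mul _ _).trans (by rw [totalDegree_X, totalDegree_C])
    · exact (totalDegree_mul _ _).trans (by rw [totalDegree_X, totalDegree_C])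
  have hfe : ∀ w : Fin 3 → ℝ, eval w (aeval f p) =
      eval (x l + w 0 • (x i - x l) + w 1 • (x j - x l) + w 2 • (x m - x l)) p := by
    intro w
    rw [aux_eval_aeval]
    congr 2
    funext r
    simp [f]
  have hback : aeval ![lam i, lam j, lam m] (aeval f p) = p := by
    apply MvPolynomial.funext
    intro y
    rw [aux_eval_aeval, hfe]
    congr 2
    obtain ⟨h1, h2⟩ := aux_bary x hnd lam hdeg hlam y
    rw [aux_sum4 _ i j l m hij hil him hjl hjm hlm] at h1 h2
    conv_rhs => rw [← h1]
    funext r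
    simp only [cons_val_zero, cons_val_one, cons_val, Pi.add_apply, Pi.smul_apply, Pi.sub_apply,
      smul_eq_mul]
    linear_combination (-(x l r)) * h2
  have hP : (aeval f p).totalDegree ≤ k + 1 := (aux_totalDegree_aeval_le f hf p).trans hp
  have hX0 : X 0 ∣ aeval f p := by
    refine aux_X_dvd 0 _ fun w hw => ?_
    have := auxPar_eval (x l) (x j) (x m) ![w 1, w 2] p
    rw [hi, map_zero] at this
    rw [hfe, hw]
    refine Eq.trans ?_ this.symm
    simp
  have hX1 : X 1 ∣ aeval f p := by
    refine aux_X_dvd 1 _ fun w hw => ?_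
    have := auxPar_eval (x l) (x i) (x m) ![w 0, w 2] p
    rw [hj, map_zero] at this
    rw [hfe, hw]
    refine Eq.trans ?_ this.symm
    simp
  obtain ⟨A, hA⟩ := hX0
  rw [hA] at hX1
  have hX1A : X 1 ∣ A := by
    rcases (X_prime (R := ℝ) (i := (1 : Fin 3))).dvd_or_dvd hX1 with h | h
    · exact absurd (X_dvd_X.1 h) (by decide)
    · exact h
  obtain ⟨R, hR⟩ := hX1A
  refine ⟨aeval ![lam i, lam j, lam m] R, ?_, ?_⟩
  · refine (aux_totalDegree_aeval_le _ ?_ R).trans ?_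
    · intro r; fin_cases r <;> simp [hdeg]
    · by_cases hR0 : R = 0
      · simp [hR0]
      · rw [hA, hR, totalDegree_mul_of_isDomain (X_ne_zero _) (mul_ne_zero (X_ne_zero _) hR0),
          totalDegree_mul_of_isDomain (X_ne_zero _) hR0, totalDegree_X, totalDegree_X] at hP
        omega
  · conv_lhs => rw [← hback]
    rw [hA, hR]
    simp [mul_assoc]

/-- Degree and symmetry information contained in the shape space `P_{ij}`. -/
lemma aux_shape (k : ℕ) (hk : 1 ≤ k) (x : Fin 4 → (Fin 3 → ℝ))
    (lam : Fin 4 → MvPolynomial (Fin 3) ℝ)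
    (hdeg : ∀ i, (lam i).totalDegree ≤ 1)
    (i j l m : Fin 4) (φ ψ : MvPolynomial (Fin 3) ℝ →ₐ[ℝ] MvPolynomial (Fin 2) ℝ)
    (hφ : ∀ q, (φ q).totalDegree ≤ q.totalDegree) (hψ : ∀ q, (ψ q).totalDegree ≤ q.totalDegree)
    (hφi : φ (lam i) = 0) (hψj : ψ (lam j) = 0) (hφψ : φ (lam j) = ψ (lam i))
    (hl : φ (lam l) = ψ (lam l)) (hm : φ (lam m) = ψ (lam m))
    (p : MvPolynomial (Fin 3) ℝ)
    (hp : p ∈ restrictTotalDegree (Fin 3) ℝ k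
        ⊔ Submodule.span ℝ
            {q | ∃ a b : ℕ, a + b = k ∧ q = (lam i - lam j) * lam l ^ a * lam m ^ b}
        ⊔ Submodule.span ℝ
            {q | ∃ r : MvPolynomial (Fin 3) ℝ, r.totalDegree ≤ k - 1 ∧
              q = lam i * lam j * r}) :
    p.totalDegree ≤ k + 1 ∧ (φ p + ψ p).totalDegree ≤ k := by
  constructor
  · rw [← mem_restrictTotalDegree]
    refine (show _ ≤ restrictTotalDegree (Fin 3) ℝ (k + 1) from sup_le (sup_le ?_ ?_) ?_) hp
    · intro q hq
      rw [mem_restrictTotalDegree] at hq ⊢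
      omega
    · rw [Submodule.span_le]
      rintro q ⟨a, b, hab, rfl⟩
      rw [SetLike.mem_coe, mem_restrictTotalDegree]
      have h1 := totalDegree_mul ((lam i - lam j) * lam l ^ a) (lam m ^ b)
      have h2 := totalDegree_mul (lam i - lam j) (lam l ^ a)
      have h3 := totalDegree_sub (lam i) (lam j)
      have h4 := (totalDegree_pow (lam l) a).trans (Nat.mul_le_mul_left a (hdeg l))
      have h5 := (totalDegree_pow (lam m) b).trans (Nat.mul_le_mul_left b (hdeg m))
      have := hdeg i
      have := hdeg j
      omega
    · rw [Submodule.span_le]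
      rintro q ⟨r, hr, rfl⟩
      rw [SetLike.mem_coe, mem_restrictTotalDegree]
      have h1 := totalDegree_mul (lam i * lam j) r
      have h2 := totalDegree_mul (lam i) (lam j)
      have := hdeg i
      have := hdeg j
      omega
  · suffices h : p ∈ (restrictTotalDegree (Fin 2) ℝ k).comap (φ.toLinearMap + ψ.toLinearMap) by
      rw [Submodule.mem_comap, mem_restrictTotalDegree] at h
      exact h
    refine (show _ ≤ (restrictTotalDegree (Fin 2) ℝ k).comap (φ.toLinearMap + ψ.toLinearMap) from
      sup_le (sup_le ?_ ?_) ?_) hp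
    · intro q hq
      rw [mem_restrictTotalDegree] at hq
      rw [Submodule.mem_comap, mem_restrictTotalDegree]
      exact (totalDegree_add _ _).trans (max_le ((hφ q).trans hq) ((hψ q).trans hq))
    · rw [Submodule.span_le]
      rintro q ⟨a, b, hab, rfl⟩
      rw [SetLike.mem_coe, Submodule.mem_comap]
      convert Submodule.zero_mem _
      simp only [LinearMap.add_apply, AlgHom.toLinearMap_apply, map_mul, map_sub, map_pow, hφi,
        hψj, hφψ, hl, hm]
      ring
    · rw [Submodule.span_le]
      rintro q ⟨r, hr, rfl⟩
      rw [SetLike.mem_coe, Submodule.mem_comap]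
      convert Submodule.zero_mem _
      simp only [LinearMap.add_apply, AlgHom.toLinearMap_apply, map_mul, hφi, hψj]
      ring

/-- Barycentric coordinates restricted to a face. -/
lemma aux_lam_face (x : Fin 4 → (Fin 3 → ℝ)) (lam : Fin 4 → MvPolynomial (Fin 3) ℝ)
    (hdeg : ∀ i, (lam i).totalDegree ≤ 1)
    (hlam : ∀ i j, eval (x j) (lam i) = if i = j then (1 : ℝ) else 0)
    (a b c n : Fin 4) :
    aeval (auxPar (x a) (x b) (x c)) (lam n) =
      C (if n = a then 1 else 0) + X 0 * C ((if n = b then 1 else 0) - if n = a then 1 else 0)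
      + X 1 * C ((if n = c then 1 else 0) - if n = a then 1 else 0) := by
  obtain ⟨g, hg, hgx⟩ := aux_grad x lam hdeg hlam
  apply MvPolynomial.funext
  intro w
  rw [auxPar_eval, add_assoc, hg, dotProduct_add, dotProduct_smul, dotProduct_smul, hgx, hgx, hlam]
  simp only [smul_eq_mul, map_add, map_mul, eval_C, eval_X]
  ring

/-- The main step: the face moments imply `p_{ij} = λ_i λ_j r`. -/
lemma aux_main (k : ℕ) (hk : 1 ≤ k) (x : Fin 4 → (Fin 3 → ℝ))
    (hnd : LinearIndependent ℝ ![x 1 - x 0, x 2 - x 0, x 3 - x 0])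
    (lam : Fin 4 → MvPolynomial (Fin 3) ℝ)
    (hdeg : ∀ i, (lam i).totalDegree ≤ 1)
    (hlam : ∀ i j, eval (x j) (lam i) = if i = j then (1 : ℝ) else 0)
    (p : MvPolynomial (Fin 3) ℝ)
    (i j l m : Fin 4)
    (hij : i ≠ j) (hil : i ≠ l) (him : i ≠ m) (hjl : j ≠ l) (hjm : j ≠ m) (hlm : l ≠ m)
    (hp : p ∈ restrictTotalDegree (Fin 3) ℝ k
        ⊔ Submodule.span ℝ
            {q | ∃ a b : ℕ, a + b = k ∧ q = (lam i - lam j) * lam l ^ a * lam m ^ b}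
        ⊔ Submodule.span ℝ
            {q | ∃ r : MvPolynomial (Fin 3) ℝ, r.totalDegree ≤ k - 1 ∧
              q = lam i * lam j * r})
    (g : Fin 4 → Fin 3 → ℝ)
    (hgx : ∀ i a b, g i ⬝ᵥ (x b - x a) = (if i = b then (1 : ℝ) else 0) - if i = a then 1 else 0)
    (τ : Matrix (Fin 3) (Fin 3) (MvPolynomial (Fin 3) ℝ))
    (hτi : ∀ y s, (τ.map (eval y) *ᵥ g i) ⬝ᵥ (fun r => g j r * s) = -(eval y p * s))
    (hτj : ∀ y s, (τ.map (eval y) *ᵥ g j) ⬝ᵥ (fun r => g i r * s) = -(eval y p * s))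
    (hface : ∀ a b c : Fin 4, a ≠ b → a ≠ c → b ≠ c →
      ∀ ν : Fin 3 → ℝ, ν ≠ 0 →
        ν ⬝ᵥ (x b - x a) = 0 → ν ⬝ᵥ (x c - x a) = 0 →
        ∀ v : Fin 3 → MvPolynomial (Fin 3) ℝ, (∀ r, (v r).totalDegree ≤ k) →
          ∫ w in auxT,
            ((τ.map (eval (x a + w 0 • (x b - x a) + w 1 • (x c - x a)))) *ᵥ ν)
              ⬝ᵥ (fun r =>
                eval (x a + w 0 • (x b - x a) + w 1 • (x c - x a)) (v r)) = 0) :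
    ∃ r : MvPolynomial (Fin 3) ℝ, r.totalDegree ≤ k - 1 ∧ p = lam i * lam j * r := by
  have hg0 : ∀ a, g a ≠ 0 := by
    intro a ha
    obtain ⟨b, hb⟩ : ∃ b, a ≠ b := by
      by_cases h : a = i
      · exact ⟨j, h ▸ hij⟩
      · exact ⟨i, h⟩
    have := hgx a b a
    rw [ha, zero_dotProduct] at this
    simp [hb] at this
  -- moments on the face opposite to `a`, with vertices `l, b, m`
  have hmom : ∀ a b : Fin 4, a ≠ b → a ≠ l → a ≠ m → b ≠ l → b ≠ m →
      (∀ y s, (τ.map (eval y) *ᵥ g a) ⬝ᵥ (fun r => g b r * s) = -(eval y p * s)) →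
      ∀ u : MvPolynomial (Fin 2) ℝ, u.totalDegree ≤ k →
        ∫ w in auxT, eval w (aeval (auxPar (x l) (x b) (x m)) p * u) = 0 := by
    intro a b hab hal ham hbl hbm hτ u hu
    have h := hface l b m hbl.symm hlm hbm (g a) (hg0 a)
      (by rw [hgx]; simp [hab, hal]) (by rw [hgx]; simp [ham, hal])
      (fun r => C (g b r) * aeval ![lam b, lam m] u) (fun r => by
        refine (totalDegree_mul _ _).trans ?_
        rw [totalDegree_C, zero_add]
        refine (aux_totalDegree_aeval_le _ ?_ u).trans hu
        intro s; fin_cases s <;> simp [hdeg])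
    simp only [map_mul, eval_C] at h
    simp only [hτ] at h
    rw [integral_neg, neg_eq_zero] at h
    rw [← h]
    congr 1
    funext w
    rw [map_mul, auxPar_eval]
    congr 1
    rw [← auxPar_eval, aux_eval_aeval, aux_eval_aeval]
    congr 2
    funext s
    rw [← aux_eval_aeval]
    fin_cases s
    · change _ = eval w (aeval _ (lam b))
      simp only [aux_lam_face x lam hdeg hlam]; simp [hbl, hbm]
    · change _ = eval w (aeval _ (lam m))
      simp only [aux_lam_face x lam hdeg hlam]; simp [hlm.symm, hbm.symm]
  have hsh := aux_shape k hk x lam hdeg i j l m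
    (aeval (auxPar (x l) (x j) (x m))) (aeval (auxPar (x l) (x i) (x m)))
    (aux_totalDegree_aeval_le _ (auxPar_degree _ _ _))
    (aux_totalDegree_aeval_le _ (auxPar_degree _ _ _))
    (by simp only [aux_lam_face x lam hdeg hlam]; simp [hij, hil, him])
    (by simp only [aux_lam_face x lam hdeg hlam]; simp [hij.symm, hjl, hjm])
    (by simp only [aux_lam_face x lam hdeg hlam]; simp [hil, him, hjl, hjm])
    (by simp only [aux_lam_face x lam hdeg hlam]; simp [hil.symm, hjl.symm])
    (by simp only [aux_lam_face x lam hdeg hlam]; simp [him.symm, hjm.symm])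
    p hp
  have hcore := aux_face_core k _ _ (hmom i j hij hil him hjl hjm hτi)
    (hmom j i hij.symm hjl hjm hil him hτj)
    ((aux_totalDegree_aeval_le _ (auxPar_degree _ _ _) p).trans hsh.1) hsh.2
    (fun w hw => by rw [auxPar_eval, auxPar_eval, hw]; simp)
  exact aux_divis k hk x hnd lam hdeg hlam i j l m hij hil him hjl hjm hlm p hsh.1
    hcore.1 hcore.2

/-- Contraction of `τ` with two vectors. -/
lemma aux_contract (x : Fin 4 → (Fin 3 → ℝ))
    (M : Fin 4 → Fin 4 → Matrix (Fin 3) (Fin 3) (MvPolynomial (Fin 3) ℝ))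
    (hM : ∀ i j, M i j = (vecMulVec (x j - x i) (x j - x i)).map C)
    (p : MvPolynomial (Fin 3) ℝ) (a b : Fin 4) (y : Fin 3 → ℝ) (ν c : Fin 3 → ℝ) :
    ((p • M a b).map (eval y) *ᵥ ν) ⬝ᵥ c =
      eval y p * (ν ⬝ᵥ (x b - x a)) * (c ⬝ᵥ (x b - x a)) := by
  simp [hM, Matrix.mulVec, dotProduct, Fin.sum_univ_three, vecMulVec_apply]
  ring

/-- Unisolvence of the nonconforming tetrahedral stress element: if
`τ = Σ_{i<j} p_{ij} t_{i,j}t_{i,j}ᵀ` with `p_{ij} ∈ P_{ij}` annihilates the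
face degrees of freedom against `P_k(F;ℝ³)` and the interior degrees of
freedom against the bubble space `H_{K,k+1,b}`, then `τ = 0`. -/
theorem nonconforming_tetrahedral_unisolvence
    (k : ℕ) (hk : 1 ≤ k)
    (x : Fin 4 → (Fin 3 → ℝ))
    (hnd : LinearIndependent ℝ ![x 1 - x 0, x 2 - x 0, x 3 - x 0])
    (K : Set (Fin 3 → ℝ)) (hK : K = convexHull ℝ (Set.range x))
    (lam : Fin 4 → MvPolynomial (Fin 3) ℝ)
    (hdeg : ∀ i, (lam i).totalDegree ≤ 1)
    (hlam : ∀ i j, eval (x j) (lam i) = if i = j then (1 : ℝ) else 0)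
    (M : Fin 4 → Fin 4 → Matrix (Fin 3) (Fin 3) (MvPolynomial (Fin 3) ℝ))
    (hM : ∀ i j, M i j = (vecMulVec (x j - x i) (x j - x i)).map C)
    (T : Set (Fin 2 → ℝ))
    (hT : T = {w | 0 ≤ w 0 ∧ 0 ≤ w 1 ∧ w 0 + w 1 ≤ 1})
    (p : Fin 4 → Fin 4 → MvPolynomial (Fin 3) ℝ)
    -- each `p i j` belongs to the shape space `P_{ij}`
    (hp : ∀ i j l m : Fin 4, i ≠ j → i ≠ l → i ≠ m → j ≠ l → j ≠ m → l ≠ m →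
      p i j ∈ restrictTotalDegree (Fin 3) ℝ k
        ⊔ Submodule.span ℝ
            {q | ∃ a b : ℕ, a + b = k ∧ q = (lam i - lam j) * lam l ^ a * lam m ^ b}
        ⊔ Submodule.span ℝ
            {q | ∃ r : MvPolynomial (Fin 3) ℝ, r.totalDegree ≤ k - 1 ∧
              q = lam i * lam j * r})
    (τ : Matrix (Fin 3) (Fin 3) (MvPolynomial (Fin 3) ℝ))
    (hτ : τ = p 0 1 • M 0 1 + p 0 2 • M 0 2 + p 0 3 • M 0 3
            + p 1 2 • M 1 2 + p 1 3 • M 1 3 + p 2 3 • M 2 3)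
    -- (1) the face moments of `τν` against `P_k(F;ℝ³)` vanish on every face
    (hface : ∀ a b c : Fin 4, a ≠ b → a ≠ c → b ≠ c →
      ∀ ν : Fin 3 → ℝ, ν ≠ 0 →
        ν ⬝ᵥ (x b - x a) = 0 → ν ⬝ᵥ (x c - x a) = 0 →
        ∀ v : Fin 3 → MvPolynomial (Fin 3) ℝ, (∀ r, (v r).totalDegree ≤ k) →
          ∫ w in T,
            ((τ.map (eval (x a + w 0 • (x b - x a) + w 1 • (x c - x a)))) *ᵥ ν)
              ⬝ᵥ (fun r =>
                eval (x a + w 0 • (x b - x a) + w 1 • (x c - x a)) (v r)) = 0)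
    -- (2) the interior moments against the bubble space `H_{K,k+1,b}` vanish
    (hint : ∀ q : Fin 4 → Fin 4 → MvPolynomial (Fin 3) ℝ,
      (∀ i j, (q i j).totalDegree ≤ k - 1) →
      ∫ y in K, ∑ r : Fin 3, ∑ s : Fin 3,
        eval y (τ r s) *
          eval y (((lam 0 * lam 1 * q 0 1) • M 0 1
            + (lam 0 * lam 2 * q 0 2) • M 0 2
            + (lam 0 * lam 3 * q 0 3) • M 0 3
            + (lam 1 * lam 2 * q 1 2) • M 1 2
            + (lam 1 * lam 3 * q 1 3) • M 1 3
            + (lam 2 * lam 3 * q 2 3) • M 2 3) r s) = 0) :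
    τ = 0 := by
  obtain ⟨g, hg, hgx⟩ := aux_grad x lam hdeg hlam
  have hT' : T = auxT := hT
  rw [hT'] at hface
  have hcon : ∀ (y : Fin 3 → ℝ) (s : ℝ) (i j : Fin 4),
      (τ.map (eval y) *ᵥ g i) ⬝ᵥ (fun r => g j r * s) =
        (eval y (p 0 1) * (g i ⬝ᵥ (x 1 - x 0)) * (g j ⬝ᵥ (x 1 - x 0))
        + eval y (p 0 2) * (g i ⬝ᵥ (x 2 - x 0)) * (g j ⬝ᵥ (x 2 - x 0))
        + eval y (p 0 3) * (g i ⬝ᵥ (x 3 - x 0)) * (g j ⬝ᵥ (x 3 - x 0))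
        + eval y (p 1 2) * (g i ⬝ᵥ (x 2 - x 1)) * (g j ⬝ᵥ (x 2 - x 1))
        + eval y (p 1 3) * (g i ⬝ᵥ (x 3 - x 1)) * (g j ⬝ᵥ (x 3 - x 1))
        + eval y (p 2 3) * (g i ⬝ᵥ (x 3 - x 2)) * (g j ⬝ᵥ (x 3 - x 2))) * s := by
    intro y s i j
    have hs : (fun r => g j r * s) = s • g j := by
      funext r; simp [mul_comm]
    have hadd : ∀ A B : Matrix (Fin 3) (Fin 3) (MvPolynomial (Fin 3) ℝ),
        (A + B).map (eval y) = A.map (eval y) + B.map (eval y) :=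
      fun A B => Matrix.map_add _ (map_add _) A B
    rw [hs, dotProduct_smul, hτ]
    simp only [hadd, Matrix.add_mulVec, add_dotProduct, aux_contract x M hM]
    simp only [smul_eq_mul]
    ring
  simp only [hgx] at hcon
  obtain ⟨r01, hr01, h01⟩ := aux_main k hk x hnd lam hdeg hlam (p 0 1) 0 1 2 3
    (by decide) (by decide) (by decide) (by decide) (by decide) (by decide)
    (hp 0 1 2 3 (by decide) (by decide) (by decide) (by decide) (by decide) (by decide))
    g hgx τ (fun y s => by rw [hcon]; simp) (fun y s => by rw [hcon]; simp) hface
  obtain ⟨r02, hr02, h02⟩ := aux_main k hk x hnd lam hdeg hlam (p 0 2) 0 2 1 3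
    (by decide) (by decide) (by decide) (by decide) (by decide) (by decide)
    (hp 0 2 1 3 (by decide) (by decide) (by decide) (by decide) (by decide) (by decide))
    g hgx τ (fun y s => by rw [hcon]; simp) (fun y s => by rw [hcon]; simp) hface
  obtain ⟨r03, hr03, h03⟩ := aux_main k hk x hnd lam hdeg hlam (p 0 3) 0 3 1 2
    (by decide) (by decide) (by decide) (by decide) (by decide) (by decide)
    (hp 0 3 1 2 (by decide) (by decide) (by decide) (by decide) (by decide) (by decide))
    g hgx τ (fun y s => by rw [hcon]; simp) (fun y s => by rw [hcon]; simp) hface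
  obtain ⟨r12, hr12, h12⟩ := aux_main k hk x hnd lam hdeg hlam (p 1 2) 1 2 0 3
    (by decide) (by decide) (by decide) (by decide) (by decide) (by decide)
    (hp 1 2 0 3 (by decide) (by decide) (by decide) (by decide) (by decide) (by decide))
    g hgx τ (fun y s => by rw [hcon]; simp) (fun y s => by rw [hcon]; simp) hface
  obtain ⟨r13, hr13, h13⟩ := aux_main k hk x hnd lam hdeg hlam (p 1 3) 1 3 0 2
    (by decide) (by decide) (by decide) (by decide) (by decide) (by decide)
    (hp 1 3 0 2 (by decide) (by decide) (by decide) (by decide) (by decide) (by decide))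
    g hgx τ (fun y s => by rw [hcon]; simp) (fun y s => by rw [hcon]; simp) hface
  obtain ⟨r23, hr23, h23⟩ := aux_main k hk x hnd lam hdeg hlam (p 2 3) 2 3 0 1
    (by decide) (by decide) (by decide) (by decide) (by decide) (by decide)
    (hp 2 3 0 1 (by decide) (by decide) (by decide) (by decide) (by decide) (by decide))
    g hgx τ (fun y s => by rw [hcon]; simp) (fun y s => by rw [hcon]; simp) hface
  -- test with `τ` itself
  let q : Fin 4 → Fin 4 → MvPolynomial (Fin 3) ℝ :=
    ![![0, r01, r02, r03], ![0, 0, r12, r13], ![0, 0, 0, r23], ![0, 0, 0, 0]]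
  have hI := hint q (by
    intro i j
    fin_cases i <;> fin_cases j <;> simp [q, hr01, hr02, hr03, hr12, hr13, hr23])
  have hq : (lam 0 * lam 1 * q 0 1) • M 0 1 + (lam 0 * lam 2 * q 0 2) • M 0 2
            + (lam 0 * lam 3 * q 0 3) • M 0 3 + (lam 1 * lam 2 * q 1 2) • M 1 2
            + (lam 1 * lam 3 * q 1 3) • M 1 3 + (lam 2 * lam 3 * q 2 3) • M 2 3 = τ := by
    rw [hτ, h01, h02, h03, h12, h13, h23]
    rfl
  rw [hq] at hI
  have hKc : IsCompact K := by
    rw [hK]; exact (Set.finite_range x).isCompact_convexHull ℝ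
  have hKi : (interior K).Nonempty := by
    have hb := aux_bary x hnd lam hdeg hlam
    refine ⟨x 0 + ((1 / 4 : ℝ) • (x 1 - x 0) + (1 / 4 : ℝ) • (x 2 - x 0)
      + (1 / 4 : ℝ) • (x 3 - x 0)), ?_⟩
    rw [mem_interior]
    refine ⟨⋂ i, {y | 0 < eval y (lam i)}, ?_, ?_, ?_⟩
    · intro y hy
      rw [Set.mem_iInter] at hy
      rw [hK, ← (hb y).1]
      exact (convex_convexHull ℝ _).sum_mem (fun i _ => (hy i).le) (hb y).2
        (fun i _ => subset_convexHull ℝ _ ⟨i, rfl⟩)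
    · exact isOpen_iInter_of_finite fun i =>
        isOpen_lt continuous_const (MvPolynomial.continuous_eval _)
    · rw [Set.mem_iInter]
      intro i
      rw [Set.mem_setOf_eq, hg, hlam, dotProduct_add, dotProduct_add, dotProduct_smul,
        dotProduct_smul, dotProduct_smul, hgx, hgx, hgx]
      fin_cases i <;> simp <;> norm_num
  have hzero : ∑ r : Fin 3, ∑ s : Fin 3, τ r s * τ r s = 0 := by
    refine aux_integral_zero K hKc hKi _ (fun y _ => ?_) ?_
    · simp only [map_sum, map_mul]
      exact Finset.sum_nonneg fun r _ => Finset.sum_nonneg fun s _ => mul_self_nonneg _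
    · simpa only [map_sum, map_mul] using hI
  ext1 r s
  apply MvPolynomial.funext
  intro y
  have h := congrArg (eval y) hzero
  simp only [map_sum, map_mul, map_zero] at h
  rw [Finset.sum_eq_zero_iff_of_nonneg
    (fun r _ => Finset.sum_nonneg fun s _ => mul_self_nonneg _)] at h
  have h' := h r (Finset.mem_univ _)
  rw [Finset.sum_eq_zero_iff_of_nonneg (fun s _ => mul_self_nonneg _)] at h'
  simpa using h' s (Finset.mem_univ _)
end
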